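/- Let F(x,y) ∈ ℤ[x,y] be a homogeneous binary form of degree d. Assume that F is not divisible by the square of any nonunit of ℤ[x,y], and that every irreducible factor of F in ℤ[x,y] has degree at most 6. Fix a sequence (p₁, …, p_r) of distinct primes and a sequence (t₁, …, t_r) of nonnegative integers. Let M be a positive integer such that p² | M for every prime p < d and such that p₁^{t₁+1}···p_r^{t_r+1} | M. Suppose there exist integers a, b with F(a,b) ≠ 0 such that F(a,b) ≢ 0 (mod p²) for every prime p | M with p ∉ {p₁, …, p_r}, and such that v_{p_i}(F(a,b)) = t_i for every i. Then there are infinitely many pairs of integers (m,n) with m ≡ a (mod M) and n ≡ b (mod M) such that F(m,n) = p₁^{t₁}···p_r^{t_r}·ℓ, where ℓ is a squarefree integer not divisible by any of the p_i. -/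

import Mathlib

open Polynomial in
/-- `h ^ k` times the `k`-th derivative of `h ^ e * b` is `h ^ e * twist h e k b`. -/
noncomputable def twist {F : Type*} [CommRing F] (h : F[X]) (e : ℕ) : ℕ → F[X] →ₗ[F] F[X]
  | 0 => LinearMap.id
  | k + 1 => LinearMap.mulLeft F h ∘ₗ derivative ∘ₗ twist h e k +
      LinearMap.mulLeft F (((e - k : ℕ) : F[X]) * derivative h) ∘ₗ twist h e k

namespace Polynomial

theorem iterate_derivative_pow_mul_eq_twist {F : Type*} [CommRing F] (h b : F[X]) (e k : ℕ)
    (hk : k ≤ e) :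
    derivative^[k] (h ^ e * b) = h ^ (e - k) * twist h e k b := by
  induction k with
  | zero => simp [twist]
  | succ k ih =>
    obtain ⟨n, rfl⟩ : ∃ n, e = k + 1 + n := ⟨e - (k + 1), by omega⟩
    rw [Function.iterate_succ_apply', ih (by omega)]
    have h1 : k + 1 + n - k = n + 1 := by omega
    have h2 : k + 1 + n - (k + 1) = n := by omega
    simp only [twist, h1, h2, LinearMap.add_apply, LinearMap.comp_apply, LinearMap.mulLeft_apply,
      derivative_mul, derivative_pow_succ, map_add, map_natCast, map_one]
    push_cast
    ring

theorem natDegree_twist_le {F : Type*} [CommRing F] {h : F[X]} (hh : h.natDegree ≤ 6) (e k : ℕ)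
    (b : F[X]) : (twist h e k b).natDegree ≤ b.natDegree + 6 * k := by
  induction k with
  | zero => simp [twist]
  | succ k ih =>
    simp only [twist, LinearMap.add_apply, LinearMap.comp_apply, LinearMap.mulLeft_apply]
    refine natDegree_add_le_of_degree_le ?_ ?_
    · refine natDegree_mul_le.trans ?_
      have := natDegree_derivative_le (twist h e k b)
      omega
    · refine natDegree_mul_le.trans ?_
      have h1 : (((e - k : ℕ) : F[X]) * derivative h).natDegree ≤ 6 := by
        refine natDegree_mul_le.trans ?_
        have := natDegree_derivative_le h
        rw [natDegree_natCast]
        omega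
      omega

section Stepanov

variable {p : ℕ} [Fact p.Prime]

theorem iterate_derivative_mul_X_pow_mul (a : (ZMod p)[X]) (i k : ℕ) :
    derivative^[k] (a * X ^ (p * i)) = derivative^[k] a * X ^ (p * i) := by
  induction k with
  | zero => rfl
  | succ k ih =>
    rw [Function.iterate_succ_apply', ih, Function.iterate_succ_apply', derivative_mul,
      derivative_X_pow]
    simp

theorem stepanov_ne_zero {h : (ZMod p)[X]} (hdeg : h.natDegree ≤ 6)
    (hns : ∀ (c : ZMod p) (A B : (ZMod p)[X]), h * A ^ 2 = C c * B ^ 2 → A = 0)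
    (h0 : h.eval 0 ≠ 0) {e : ℕ} (hpe : p = 2 * e + 1) {D : ℕ} (hD : 2 * D + 4 < p) {I : ℕ}
    (a b : Fin I → (ZMod p)[X]) (ha : ∀ i, (a i).natDegree < D) (hb : ∀ i, (b i).natDegree < D)
    (hR : ∑ i, (a i + h ^ e * b i) * X ^ (p * (i : ℕ)) = 0) : ∀ i, a i = 0 ∧ b i = 0 := by
  by_contra hcon
  push Not at hcon
  classical
  have hne : (Finset.univ.filter fun i => ¬ (a i = 0 ∧ b i = 0)).Nonempty := by
    obtain ⟨i, hi⟩ := hcon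
    exact ⟨i, by simpa using hi⟩
  obtain ⟨i₀, hi₀, hmin⟩ := Finset.exists_min_image _ (fun i : Fin I => (i : ℕ)) hne
  simp only [Finset.mem_filter, Finset.mem_univ, true_and] at hi₀ hmin
  have hprime : p.Prime := Fact.out
  have hdvd : (X : (ZMod p)[X]) ^ p ∣ a i₀ + h ^ e * b i₀ := by
    have h1 : (X : (ZMod p)[X]) ^ (p * (i₀ : ℕ) + p) ∣
        (a i₀ + h ^ e * b i₀) * X ^ (p * (i₀ : ℕ)) := by
      rw [← Finset.add_sum_erase _ _ (Finset.mem_univ i₀)] at hR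
      rw [eq_neg_of_add_eq_zero_left hR, dvd_neg]
      refine Finset.dvd_sum fun i hi => ?_
      by_cases hz : a i = 0 ∧ b i = 0
      · simp [hz.1, hz.2]
      · have h2 := hmin i hz
        have h3 : (i : ℕ) ≠ i₀ := fun h => (Finset.ne_of_mem_erase hi) (Fin.ext h)
        refine Dvd.dvd.mul_left (pow_dvd_pow _ ?_) _
        have : (i₀ : ℕ) + 1 ≤ i := by omega
        calc p * (i₀ : ℕ) + p = p * (i₀ + 1) := by ring
          _ ≤ p * i := Nat.mul_le_mul_left _ this
    rw [pow_add, mul_comm ((X : (ZMod p)[X]) ^ _)] at h1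
    exact (mul_dvd_mul_iff_right (pow_ne_zero _ X_ne_zero)).1 h1
  have hpow : (X : (ZMod p)[X]) ^ p ∣ h ^ p - C (h.eval 0) := by
    obtain ⟨k, hk⟩ : (X : (ZMod p)[X]) ∣ h - C (h.eval 0) := by
      have := X_sub_C_dvd_sub_C_eval (a := (0 : ZMod p)) (p := h)
      simpa using this
    refine ⟨expand (ZMod p) p k, ?_⟩
    have := congrArg (expand (ZMod p) p) hk
    rw [map_sub, ZMod.expand_card] at this
    simpa using this
  have hmain : (X : (ZMod p)[X]) ^ p ∣ h * a i₀ ^ 2 - C (h.eval 0) * b i₀ ^ 2 := by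
    have e1 : h * a i₀ ^ 2 - C (h.eval 0) * b i₀ ^ 2 =
        (a i₀ + h ^ e * b i₀) * (h * (a i₀ - h ^ e * b i₀)) +
          (h ^ p - C (h.eval 0)) * b i₀ ^ 2 := by
      have : h ^ p = h ^ e * h ^ e * h :=
        calc h ^ p = h ^ (2 * e + 1) := congrArg (h ^ ·) hpe
          _ = _ := by ring
      rw [this]; ring
    rw [e1]
    exact dvd_add (hdvd.mul_right _) (hpow.mul_right _)
  have hzero : h * a i₀ ^ 2 - C (h.eval 0) * b i₀ ^ 2 = 0 := by
    by_contra hnz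
    have h1 := natDegree_le_of_dvd hmain hnz
    rw [natDegree_X_pow] at h1
    have h2 : (h * a i₀ ^ 2 - C (h.eval 0) * b i₀ ^ 2).natDegree ≤ 2 * D + 4 := by
      refine (natDegree_sub_le_of_le (m := 2 * D + 4) (n := 2 * D + 4) ?_ ?_).trans (by simp)
      · refine natDegree_mul_le.trans ?_
        have := natDegree_pow_le (p := a i₀) (n := 2)
        have := ha i₀
        omega
      · refine (natDegree_C_mul_le _ _).trans ?_
        have := natDegree_pow_le (p := b i₀) (n := 2)
        have := hb i₀
        omega
    omega
  have ha0 := hns _ _ _ (sub_eq_zero.1 hzero)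
  refine hi₀ ⟨ha0, ?_⟩
  rw [ha0] at hzero
  have : C (h.eval 0) * b i₀ ^ 2 = 0 := by simpa using hzero
  rcases mul_eq_zero.1 this with h1 | h1
  · exact absurd (C_eq_zero.1 h1) h0
  · exact pow_eq_zero_iff (two_ne_zero) |>.1 h1

theorem stepanov_card_le (hp : 2000 ≤ p) {h : (ZMod p)[X]} (hdeg : h.natDegree ≤ 6)
    (hns : ∀ (c : ZMod p) (A B : (ZMod p)[X]), h * A ^ 2 = C c * B ^ 2 → A = 0)
    (h0 : h.eval 0 ≠ 0) {e : ℕ} (hpe : p = 2 * e + 1) (S : Finset (ZMod p))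
    (hS : ∀ x ∈ S, h.eval x ^ e = 1) : 32 * S.card ≤ 23 * p := by
  classical
  set D := e - 2 with hDdef
  let V := (Fin 9 → degreeLT (ZMod p) D) × (Fin 9 → degreeLT (ZMod p) D)
  let Q : Fin 16 → V →ₗ[ZMod p] (ZMod p)[X] := fun k =>
    ∑ i : Fin 9, LinearMap.mulRight (ZMod p) (X ^ (i : ℕ)) ∘ₗ
      (LinearMap.mulLeft (ZMod p) (h ^ (k : ℕ)) ∘ₗ (derivative ^ (k : ℕ)) ∘ₗ
          (degreeLT (ZMod p) D).subtype ∘ₗ LinearMap.proj i ∘ₗ LinearMap.fst _ _ _ +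
        twist h e k ∘ₗ (degreeLT (ZMod p) D).subtype ∘ₗ LinearMap.proj i ∘ₗ
          LinearMap.snd _ _ _)
  have hQ : ∀ k v, Q k v = ∑ i : Fin 9, (h ^ (k : ℕ) * derivative^[k] (v.1 i : (ZMod p)[X]) +
      twist h e k (v.2 i : (ZMod p)[X])) * X ^ (i : ℕ) := by
    intro k v
    simp [Q, LinearMap.sum_apply, Module.End.pow_apply]
    rfl
  have hDpos : 0 < D := by omega
  have hlt : ∀ q : degreeLT (ZMod p) D, (q : (ZMod p)[X]).natDegree < D := by
    intro q
    have := mem_degreeLT.1 q.2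
    by_cases hq : (q : (ZMod p)[X]) = 0
    · rw [hq]; simpa using hDpos
    · exact (natDegree_lt_iff_degree_lt hq).2 this
  let N := D + 6 * 16 + 9
  have hQdeg : ∀ k v, (Q k v).natDegree < N := by
    intro k v
    rw [hQ]
    refine lt_of_le_of_lt (natDegree_sum_le_of_forall_le (n := D + 6 * 16 + 8) _ _ fun i _ => ?_)
      (Nat.lt_succ_self _)
    refine natDegree_mul_le.trans ?_
    rw [natDegree_X_pow]
    have hi := i.2
    have hk := k.2
    have : (h ^ (k : ℕ) * derivative^[k] (v.1 i : (ZMod p)[X]) +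
      twist h e k (v.2 i : (ZMod p)[X])).natDegree ≤ D + 6 * 16 := by
      refine natDegree_add_le_of_degree_le ?_ ?_
      · refine natDegree_mul_le.trans ?_
        have h1 := natDegree_pow_le (p := h) (n := k)
        have h2 := natDegree_iterate_derivative (v.1 i : (ZMod p)[X]) k
        have h3 := hlt (v.1 i)
        have h4 : (k : ℕ) * h.natDegree ≤ 15 * 6 := Nat.mul_le_mul (by omega) hdeg
        omega
      · have h1 := natDegree_twist_le hdeg e k (v.2 i : (ZMod p)[X])
        have h3 := hlt (v.2 i)
        omega
    omega
  let Φ : V →ₗ[ZMod p] (Fin 16 × Fin N → ZMod p) :=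
    LinearMap.pi fun kj => lcoeff (ZMod p) kj.2 ∘ₗ Q kj.1
  have hfr : Module.finrank (ZMod p) (Fin 16 × Fin N → ZMod p) < Module.finrank (ZMod p) V := by
    have hd : Module.finrank (ZMod p) (degreeLT (ZMod p) D) = D := by
      rw [(degreeLTEquiv (ZMod p) D).finrank_eq]; simp
    have : Module.Finite (ZMod p) (degreeLT (ZMod p) D) :=
      Module.Finite.equiv (degreeLTEquiv (ZMod p) D).symm
    simp only [V, Module.finrank_prod, Module.finrank_pi_fintype, hd, Module.finrank_self, mul_one,
      Fintype.card_prod, Fintype.card_fin, Finset.sum_const, Finset.card_univ, smul_eq_mul, N]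
    omega
  have : Module.Finite (ZMod p) (degreeLT (ZMod p) D) :=
    Module.Finite.equiv (degreeLTEquiv (ZMod p) D).symm
  obtain ⟨v, hv, hv0⟩ := Submodule.exists_mem_ne_zero_of_ne_bot
    (LinearMap.ker_ne_bot_of_finrank_lt (f := Φ) hfr)
  have hQ0 : ∀ k, Q k v = 0 := by
    intro k
    ext j
    rw [coeff_zero]
    by_cases hj : j < N
    · have := congrFun (LinearMap.mem_ker.1 hv) (k, ⟨j, hj⟩)
      simpa [Φ] using this
    · exact coeff_eq_zero_of_natDegree_lt ((hQdeg k v).trans_le (not_lt.1 hj))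
  set R : (ZMod p)[X] := ∑ i : Fin 9,
    ((v.1 i : (ZMod p)[X]) + h ^ e * (v.2 i : (ZMod p)[X])) * X ^ (p * (i : ℕ)) with hRdef
  have hR0 : R ≠ 0 := by
    intro hR
    have := stepanov_ne_zero hdeg hns h0 hpe (D := D) (by omega) (fun i => (v.1 i : (ZMod p)[X]))
      (fun i => (v.2 i : (ZMod p)[X])) (fun i => hlt _) (fun i => hlt _) hR
    apply hv0
    refine Prod.ext ?_ ?_
    · funext i; exact Subtype.ext (this i).1
    · funext i; exact Subtype.ext (this i).2
  have hRd : ∀ k : Fin 16, ∀ x ∈ S, (derivative^[k] R).IsRoot x := by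
    intro k x hx
    have hk := k.2
    have hhx : h.eval x ≠ 0 := by
      intro h1
      have := hS x hx
      rw [h1, zero_pow (by omega)] at this
      exact zero_ne_one this
    have h1 : h.eval x ^ (k : ℕ) * (derivative^[k] R).eval x = (Q k v).eval x := by
      rw [hQ, hRdef, iterate_derivative_sum, eval_finsetSum, eval_finsetSum, Finset.mul_sum]
      refine Finset.sum_congr rfl fun i _ => ?_
      rw [iterate_derivative_mul_X_pow_mul, iterate_map_add,
        iterate_derivative_pow_mul_eq_twist _ _ _ _ (by omega)]
      simp only [eval_mul, eval_add, eval_pow, eval_X, pow_mul, ZMod.pow_card]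
      have h2 : h.eval x ^ (k : ℕ) * h.eval x ^ (e - k) = 1 := by
        rw [← pow_add, ← hS x hx]; congr 1; omega
      linear_combination (eval x ((twist h e k) (v.2 i : (ZMod p)[X]))) * x ^ (i : ℕ) * h2
    rw [hQ0, eval_zero] at h1
    exact (mul_eq_zero.1 h1).resolve_left (pow_ne_zero _ hhx)
  have hmult : ∀ x ∈ S, 16 ≤ R.rootMultiplicity x := by
    intro x hx
    refine lt_rootMultiplicity_of_isRoot_iterate_derivative_of_mem_nonZeroDivisors' (n := 15) hR0
      (fun m hm => hRd ⟨m, by omega⟩ x hx) fun m hm hm0 => ?_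
    refine mem_nonZeroDivisors_of_ne_zero ?_
    rw [Ne, ZMod.natCast_eq_zero_iff]
    intro hdvd
    have := Nat.le_of_dvd (by omega) hdvd
    omega
  have hle : (16 • S.val) ≤ R.roots := by
    rw [Multiset.le_iff_count]
    intro x
    rw [Multiset.count_nsmul, count_roots]
    by_cases hx : x ∈ S
    · have : Multiset.count x S.val ≤ 1 := Multiset.nodup_iff_count_le_one.1 S.nodup x
      have := hmult x hx
      omega
    · rw [Multiset.count_eq_zero_of_notMem (by simpa using hx)]; simp
  have hcard := (Multiset.card_le_card hle).trans (card_roots' R)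
  have hRdeg : R.natDegree ≤ D + e * 6 + p * 8 := by
    refine natDegree_sum_le_of_forall_le _ _ fun i _ => ?_
    refine natDegree_mul_le.trans ?_
    rw [natDegree_X_pow]
    have h1 : ((v.1 i : (ZMod p)[X]) + h ^ e * (v.2 i : (ZMod p)[X])).natDegree ≤ D + e * 6 := by
      refine natDegree_add_le_of_degree_le ((hlt _).le.trans (by omega)) ?_
      refine natDegree_mul_le.trans ?_
      have h1 := natDegree_pow_le (p := h) (n := e)
      have h2 := hlt (v.2 i)
      have h3 : e * h.natDegree ≤ e * 6 := Nat.mul_le_mul_left _ hdeg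
      omega
    have h2 : p * (i : ℕ) ≤ p * 8 := Nat.mul_le_mul_left _ (by have := i.2; omega)
    omega
  rw [Multiset.card_nsmul, Finset.card_val] at hcard
  omega

theorem card_isSquare_eval_le (hp : 2000 ≤ p) {h : (ZMod p)[X]} (hdeg : h.natDegree ≤ 6)
    (hns : ∀ (c : ZMod p) (A B : (ZMod p)[X]), h * A ^ 2 = C c * B ^ 2 → A = 0) :
    4 * (Finset.univ.filter fun x : ZMod p => IsSquare (h.eval x)).card ≤ 3 * p := by
  classical
  have hprime : p.Prime := Fact.out
  have hodd : p % 2 = 1 := hprime.eq_two_or_odd.resolve_left (by omega)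
  have hh0 : h ≠ 0 := by
    rintro rfl
    exact one_ne_zero (hns 0 1 0 (by simp))
  have hroots : (Finset.univ.filter fun x : ZMod p => h.eval x = 0).card ≤ 6 := by
    refine le_trans ?_ hdeg
    refine card_le_degree_of_subset_roots fun x hx => ?_
    simpa [hh0] using hx
  obtain ⟨x₀, hx₀⟩ : ∃ x₀, h.eval x₀ ≠ 0 := by
    by_contra! hall
    have : (Finset.univ.filter fun x : ZMod p => h.eval x = 0) = Finset.univ := by
      ext x; simp [hall]
    rw [this, Finset.card_univ, ZMod.card] at hroots
    omega
  set S := Finset.univ.filter fun x : ZMod p => h.eval x ^ (p / 2) = 1 with hSdef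
  have hcomp : ∀ q : (ZMod p)[X], (q.comp (X - C x₀)).comp (X + C x₀) = q := by
    intro q; rw [comp_assoc]; simp
  have hcomp' : ∀ q : (ZMod p)[X], (q.comp (X + C x₀)).comp (X - C x₀) = q := by
    intro q; rw [comp_assoc]; simp
  have key := stepanov_card_le hp (h := h.comp (X + C x₀)) (e := p / 2)
    (by rw [natDegree_comp, natDegree_X_add_C, mul_one]; exact hdeg)
    (by
      intro c A B hAB
      have h1 := congrArg (fun q => comp q (X - C x₀)) hAB
      simp only [mul_comp, pow_comp, C_comp, hcomp'] at h1
      have h2 := hns _ _ _ h1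
      have := hcomp A
      rw [h2] at this
      simpa using this.symm)
    (by simpa using hx₀) (by omega) (S.map ⟨fun x => x - x₀, sub_left_injective⟩)
    (by
      intro x hx
      simp only [Finset.mem_map, Function.Embedding.coeFn_mk] at hx
      obtain ⟨y, hy, rfl⟩ := hx
      simpa [S] using hy)
  rw [Finset.card_map] at key
  have hsub : (Finset.univ.filter fun x : ZMod p => IsSquare (h.eval x)) ⊆
      S ∪ Finset.univ.filter fun x : ZMod p => h.eval x = 0 := by
    intro x hx
    simp only [Finset.mem_filter, Finset.mem_univ, true_and, Finset.mem_union, S] at hx ⊢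
    by_cases hz : h.eval x = 0
    · exact Or.inr hz
    · exact Or.inl ((ZMod.euler_criterion p hz).1 hx)
  have := (Finset.card_le_card hsub).trans (Finset.card_union_le _ _)
  omega

end Stepanov

end Polynomial

namespace Polynomial

/-- The value at `(m, n)` of the binary form of degree `natDegree g` that dehomogenizes to `g`. -/
noncomputable def bform (g : ℤ[X]) {R : Type*} [CommRing R] (m n : R) : R :=
  MvPolynomial.aeval ![m, n] (g.homogenize g.natDegree)

section bform

variable {R S : Type*} [CommRing R] [CommRing S]

theorem bform_eq_sum (g : ℤ[X]) (m n : R) :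
    bform g m n = ∑ i ∈ Finset.range (g.natDegree + 1),
      (g.coeff i : R) * m ^ i * n ^ (g.natDegree - i) := by
  rw [bform, homogenize, map_sum, Finset.Nat.sum_antidiagonal_eq_sum_range_succ_mk]
  refine Finset.sum_congr rfl fun i _ => ?_
  simp [MvPolynomial.aeval_monomial, mul_assoc]

theorem map_bform (φ : R →+* S) (g : ℤ[X]) (m n : R) :
    φ (bform g m n) = bform g (φ m) (φ n) := by
  simp [bform_eq_sum]

theorem bform_mul (g k : ℤ[X]) (hg : g ≠ 0) (hk : k ≠ 0) (m n : R) :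
    bform (g * k) m n = bform g m n * bform k m n := by
  rw [bform, natDegree_mul hg hk, homogenize_mul _ _ le_rfl le_rfl, map_mul, bform, bform]

theorem bform_mul_right (g : ℤ[X]) (r n : R) :
    bform g (r * n) n = n ^ g.natDegree * eval₂ (Int.castRingHom R) r g := by
  rw [bform_eq_sum, eval₂_eq_sum_range, Finset.mul_sum]
  refine Finset.sum_congr rfl fun i hi => ?_
  have : g.natDegree = i + (g.natDegree - i) := by
    have := Finset.mem_range.1 hi; omega
  conv_rhs => rw [this]
  simp only [pow_add, mul_pow, eq_intCast]
  ring

theorem bform_zero_right (g : ℤ[X]) (m : R) :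
    bform g m 0 = (g.leadingCoeff : R) * m ^ g.natDegree := by
  rw [bform_eq_sum, Finset.sum_range_succ, Finset.sum_eq_zero]
  · simp
  · intro i hi
    have := Finset.mem_range.1 hi
    rw [zero_pow (by omega), mul_zero]

theorem bform_eq_prod {K : Type*} [Field K] [IsAlgClosed K] (g : ℤ[X])
    (hg : (g.leadingCoeff : K) ≠ 0) (m n : K) :
    bform g m n = (g.leadingCoeff : K) *
      ((g.map (Int.castRingHom K)).roots.map fun α => m - α * n).prod := by
  set G := g.map (Int.castRingHom K) with hG
  have hlc : G.leadingCoeff = (g.leadingCoeff : K) := by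
    rw [hG, leadingCoeff_map_of_leadingCoeff_ne_zero _ (by simpa using hg)]; simp
  have hdeg : G.natDegree = g.natDegree :=
    natDegree_map_of_leadingCoeff_ne_zero _ (by simpa using hg)
  have hcard : G.roots.card = g.natDegree := by
    rw [← hdeg]; exact (IsAlgClosed.splits G).natDegree_eq_card_roots.symm
  by_cases hn : n = 0
  · subst hn
    rw [bform_zero_right]
    simp [hcard]
  · have h1 : m = (m / n) * n := by field_simp
    conv_lhs => rw [h1]
    rw [bform_mul_right, ← eval_map, ← hG]
    have h2 := (IsAlgClosed.splits G).eq_prod_roots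
    conv_lhs => rw [h2]
    rw [hlc, eval_mul, eval_C, eval_multiset_prod, Multiset.map_map, ← hcard]
    rw [mul_left_comm]
    congr 1
    generalize G.roots = T
    induction T using Multiset.induction with
    | empty => simp
    | cons a T ih =>
      simp only [Multiset.card_cons, Multiset.map_cons, Multiset.prod_cons, Function.comp_apply,
        pow_succ, eval_sub, eval_X, eval_C] at ih ⊢
      rw [← ih]
      field_simp

end bform
end Polynomial

namespace Polynomial

/-- `W` is a multiple of the leading coefficient of `g` and lies in the ideal generated by `g` and
its derivative. -/
def SepBy (g : ℤ[X]) (W : ℤ) : Prop :=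
  g.leadingCoeff ∣ W ∧ ∃ u v : ℤ[X], u * g + v * derivative g = C W

theorem SepBy.of_mul_right {g k : ℤ[X]} {W : ℤ} (h : SepBy (g * k) W) : SepBy g W := by
  obtain ⟨h1, u, v, h2⟩ := h
  refine ⟨(Dvd.intro _ (leadingCoeff_mul g k).symm).trans h1, u * k + v * derivative k, v * k, ?_⟩
  rw [← h2, derivative_mul]
  ring

theorem SepBy.of_dvd {g f : ℤ[X]} {W : ℤ} (h : SepBy f W) (hg : g ∣ f) : SepBy g W := by
  obtain ⟨k, rfl⟩ := hg
  exact h.of_mul_right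

theorem SepBy.mul_right {g : ℤ[X]} {W : ℤ} (h : SepBy g W) (c : ℤ) : SepBy g (W * c) := by
  obtain ⟨h1, u, v, h2⟩ := h
  refine ⟨h1.mul_right c, u * C c, v * C c, ?_⟩
  rw [C_mul, ← h2]
  ring

theorem exists_map_eq_C_mul (x : ℚ[X]) :
    ∃ (b : ℤ) (y : ℤ[X]), b ≠ 0 ∧ y.map (Int.castRingHom ℚ) = C (b : ℚ) * x := by
  obtain ⟨b, hb0, hb⟩ := IsLocalization.integerNormalization_spec (nonZeroDivisors ℤ) x
  refine ⟨b, IsLocalization.integerNormalization (nonZeroDivisors ℤ) x,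
    nonZeroDivisors.ne_zero hb0, ?_⟩
  rw [← algebraMap_int_eq, hb, ← Int.cast_smul_eq_zsmul ℚ, smul_eq_C_mul]

theorem squarefree_map_of_squarefree {f : ℤ[X]} (hf : Squarefree f) :
    Squarefree (f.map (Int.castRingHom ℚ)) := by
  intro x hx
  have hf0 : f ≠ 0 := hf.ne_zero
  obtain ⟨b, y, hb, hy⟩ := exists_map_eq_C_mul x
  have hinj : Function.Injective (Int.castRingHom ℚ) := Int.cast_injective
  have hfQ : f.map (Int.castRingHom ℚ) ≠ 0 := (Polynomial.map_ne_zero_iff hinj).2 hf0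
  have hx0 : x ≠ 0 := by rintro rfl; exact hfQ (by simpa using hx)
  have hbu : IsUnit (C (b : ℚ)) := isUnit_C.2 (by simpa using hb)
  have hy0 : y ≠ 0 := by
    rintro rfl
    simp [hb, hx0] at hy
  have hcu : ∀ p : ℤ[X], p ≠ 0 →
      Associated (p.primPart.map (Int.castRingHom ℚ)) (p.map (Int.castRingHom ℚ)) := by
    intro p hp
    have hu : IsUnit (C (p.content : ℚ)) := isUnit_C.2 (by simpa [content_eq_zero_iff] using hp)
    refine ⟨hu.unit, ?_⟩
    conv_rhs => rw [p.eq_C_content_mul_primPart]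
    simp [mul_comm]
  have hyx : Associated (y.primPart.map (Int.castRingHom ℚ)) x := by
    refine (hcu y hy0).trans ?_
    rw [hy]
    exact (associated_isUnit_mul_left_iff hbu).2 (Associated.refl _)
  have h1 : (y.primPart * y.primPart).map (Int.castRingHom ℚ) ∣
      f.primPart.map (Int.castRingHom ℚ) := by
    rw [Polynomial.map_mul]
    exact ((hyx.mul_mul hyx).dvd.trans hx).trans (hcu f hf0).symm.dvd
  have h2 := (IsPrimitive.Int.dvd_iff_map_cast_dvd_map_cast _ _
    (y.isPrimitive_primPart.mul y.isPrimitive_primPart)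
    ).2 h1
  have h3 := hf _ (h2.trans (primPart_dvd f))
  exact hyx.isUnit (h3.map (mapRingHom (Int.castRingHom ℚ)))

theorem exists_sepBy {f : ℤ[X]} (hf : Squarefree f) : ∃ W : ℤ, W ≠ 0 ∧ SepBy f W := by
  have hsep := PerfectField.separable_iff_squarefree.2 (squarefree_map_of_squarefree hf)
  obtain ⟨a, b, hab⟩ := hsep
  obtain ⟨D, u, hD, hu⟩ := exists_map_eq_C_mul a
  obtain ⟨E, v, hE, hv⟩ := exists_map_eq_C_mul b
  refine ⟨D * E * f.leadingCoeff, by simp [hD, hE, hf.ne_zero], Dvd.intro_left _ rfl,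
    u * C E * C f.leadingCoeff, v * C D * C f.leadingCoeff, ?_⟩
  apply map_injective (Int.castRingHom ℚ) Int.cast_injective
  have hC : ∀ z : ℤ, (C z).map (Int.castRingHom ℚ) = C (z : ℚ) := fun z => map_C _
  rw [derivative_map] at hab
  simp only [Polynomial.map_add, Polynomial.map_mul, hu, hv, hC, C_mul]
  linear_combination (C (D : ℚ) * C (E : ℚ) * C (f.leadingCoeff : ℚ)) * hab

section Local

variable {g : ℤ[X]} {W : ℤ} {q : ℕ}

theorem SepBy.not_dvd_leadingCoeff (h : SepBy g W) (hqW : ¬ (q : ℤ) ∣ W) :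
    ¬ (q : ℤ) ∣ g.leadingCoeff := fun hd => hqW (hd.trans h.1)

theorem SepBy.dvd_of_dvd_bform (h : SepBy g W) (hq : q.Prime) (hqW : ¬ (q : ℤ) ∣ W) {m n : ℤ}
    (hn : (q : ℤ) ∣ n) (hb : (q : ℤ) ∣ bform g m n) : (q : ℤ) ∣ m := by
  have : Fact q.Prime := ⟨hq⟩
  rw [← ZMod.intCast_zmod_eq_zero_iff_dvd] at hn hb ⊢
  have h1 := map_bform (Int.castRingHom (ZMod q)) g m n
  simp only [eq_intCast, hn, hb] at h1
  rw [bform_zero_right] at h1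
  have h2 : (g.leadingCoeff : ZMod q) ≠ 0 := by
    rw [Ne, ZMod.intCast_zmod_eq_zero_iff_dvd]; exact h.not_dvd_leadingCoeff hqW
  exact eq_zero_of_pow_eq_zero (by simpa [h2] using h1.symm)

/-- Uniqueness part of Hensel's lemma. -/
theorem SepBy.dvd_sub_of_dvd_eval (h : SepBy g W) (hq : q.Prime) (hqW : ¬ (q : ℤ) ∣ W) {c r s : ℤ}
    (hc : c ∣ r - s) (hqrs : (q : ℤ) ∣ r - s) (hr : c * q ∣ g.eval r) (hs : c * q ∣ g.eval s) :
    c * q ∣ r - s := by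
  have hqp : Prime (q : ℤ) := Nat.prime_iff_prime_int.1 hq
  by_cases hqc : (q : ℤ) ∣ c
  · obtain ⟨k, hk⟩ := hc
    by_cases hc0 : c = 0
    · simp [hk, hc0]
    obtain ⟨h1, u, v, huv⟩ := h
    obtain ⟨z, hz⟩ := (g.binomExpansion s (c * k))
    have hrs : r = s + c * k := by linarith
    rw [← hrs] at hz
    obtain ⟨j, rfl⟩ := hqc
    have h3 : (q : ℤ) * j * q ∣ (q * j) * (k * (derivative g).eval s) := by
      have : (q * j : ℤ) * (k * (derivative g).eval s)
          = g.eval r - g.eval s - (q * j * q) * (z * j * k ^ 2) := by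
        rw [hz]; ring
      rw [this]
      exact dvd_sub (dvd_sub hr hs) (Dvd.intro _ rfl)
    have h4 : (q : ℤ) ∣ k * (derivative g).eval s := Int.dvd_of_mul_dvd_mul_left hc0 h3
    have h5 : ¬ (q : ℤ) ∣ (derivative g).eval s := by
      intro h6
      apply hqW
      have := congrArg (eval s) huv
      simp only [eval_add, eval_mul, eval_C] at this
      rw [← this]
      exact dvd_add (((Dvd.intro_left _ rfl).trans hs).mul_left _) (h6.mul_left _)
    rw [hk]
    exact mul_dvd_mul_left _ ((hqp.dvd_or_dvd h4).resolve_right h5)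
  · exact IsCoprime.mul_dvd ((hqp.coprime_iff_not_dvd.2 hqc).symm) hc hqrs

theorem SepBy.card_roots_le (h : SepBy g W) [Fact q.Prime] (hqW : ¬ (q : ℤ) ∣ W) :
    (Finset.univ.filter fun r : ZMod q => (g.map (Int.castRingHom (ZMod q))).eval r = 0).card ≤
      g.natDegree := by
  have h2 : (g.leadingCoeff : ZMod q) ≠ 0 := by
    rw [Ne, ZMod.intCast_zmod_eq_zero_iff_dvd]; exact h.not_dvd_leadingCoeff hqW
  have h0 : g.map (Int.castRingHom (ZMod q)) ≠ 0 := by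
    intro h0
    apply h2
    have := congrArg (fun p => coeff p g.natDegree) h0
    simpa using this
  calc _ ≤ (g.map (Int.castRingHom (ZMod q))).roots.toFinset.card := by
        apply Finset.card_le_card
        intro r hr
        simpa [h0] using hr
    _ ≤ _ := (Multiset.toFinset_card_le _).trans ((card_roots' _).trans natDegree_map_le)

end Local

/-- Trivial upper bound for a binary form on a box. -/
theorem exists_abs_bform_le (g : ℤ[X]) : ∃ C : ℕ, 0 < C ∧ ∀ (X : ℕ) (m n : ℤ), |m| ≤ X → |n| ≤ X →
    |bform g m n| ≤ C * X ^ g.natDegree := by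
  refine ⟨1 + ∑ i ∈ Finset.range (g.natDegree + 1), (g.coeff i).natAbs, by omega, ?_⟩
  intro X m n hm hn
  rw [bform_eq_sum]
  refine (Finset.abs_sum_le_sum_abs _ _).trans ?_
  push_cast
  rw [add_mul, one_mul, Finset.sum_mul]
  refine le_add_of_nonneg_of_le (by positivity) (Finset.sum_le_sum fun i hi => ?_)
  have hi : i ≤ g.natDegree := by have := Finset.mem_range.1 hi; omega
  rw [abs_mul, abs_mul, abs_pow, abs_pow, mul_assoc]
  gcongr
  calc |m| ^ i * |n| ^ (g.natDegree - i) ≤ (X : ℤ) ^ i * (X : ℤ) ^ (g.natDegree - i) := by gcongr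
    _ = _ := by rw [← pow_add]; congr 1; omega

end Polynomial

namespace Polynomial

theorem SepBy.separable_map {g : ℤ[X]} {W : ℤ} (h : SepBy g W) {K : Type*} [Field K]
    (hW : (W : K) ≠ 0) : (g.map (Int.castRingHom K)).Separable := by
  obtain ⟨-, u, v, huv⟩ := h
  have h1 := congrArg (map (Int.castRingHom K)) huv
  have hC : (C W).map (Int.castRingHom K) = C (W : K) := map_C _
  simp only [Polynomial.map_add, Polynomial.map_mul, ← derivative_map, hC] at h1
  refine ⟨C (W : K)⁻¹ * u.map (Int.castRingHom K), C (W : K)⁻¹ * v.map (Int.castRingHom K), ?_⟩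
  rw [mul_assoc, mul_assoc, ← mul_add, h1, ← C_mul, inv_mul_cancel₀ hW, C_1]

/-- A polynomial of degree at most `6` with at least four distinct roots, each of even multiplicity,
vanishes. -/
theorem eq_zero_of_mul_sq_eq {K : Type*} [Field K] {h A B : K[X]} {c : K}
    (hdeg : h.natDegree ≤ 6) (hh : h ≠ 0) (S : Finset K) (hS : 4 ≤ S.card)
    (hroot : ∀ s ∈ S, h.eval s = 0) (hAB : h * A ^ 2 = C c * B ^ 2) : A = 0 := by
  classical
  by_contra hA
  have hl : h * A ^ 2 ≠ 0 := mul_ne_zero hh (pow_ne_zero _ hA)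
  have hc : c ≠ 0 := by rintro rfl; simp [hAB] at hl
  have hB : B ≠ 0 := by rintro rfl; simp [hAB] at hl
  have h2 : 2 • S.val ≤ h.roots := by
    rw [Multiset.le_iff_count]
    intro s
    rw [Multiset.count_nsmul, count_roots]
    by_cases hs : s ∈ S
    · have h3 := congrArg (rootMultiplicity s) hAB
      simp only [← count_roots] at h3
      rw [roots_mul hl, roots_pow, roots_mul (hAB ▸ hl), roots_pow, roots_C, Multiset.count_add,
        Multiset.count_add, Multiset.count_nsmul, Multiset.count_nsmul, Multiset.count_zero,
        count_roots] at h3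
      have h4 : 0 < rootMultiplicity s h := (rootMultiplicity_pos hh).2 (hroot s hs)
      have h5 : Multiset.count s S.val ≤ 1 := Multiset.nodup_iff_count_le_one.1 S.nodup s
      omega
    · rw [Multiset.count_eq_zero_of_notMem hs]
      simp
  have h3 := Multiset.card_le_card h2
  have h4 := card_roots' h
  rw [Multiset.card_nsmul, Finset.card_val] at h3
  omega

theorem bform_line_ne_zero_and_roots {K : Type*} [Field K] [IsAlgClosed K] {g : ℤ[X]} {W : ℤ}
    (h : SepBy g W) (hW : (W : K) ≠ 0) (hg : 5 ≤ g.natDegree) {w₁ w₂ v₁ v₂ : K}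
    (hdet : w₁ * v₂ - w₂ * v₁ ≠ 0) :
    bform g (C w₁ + C v₁ * X) (C w₂ + C v₂ * X) ≠ 0 ∧
      ∃ S : Finset K, 4 ≤ S.card ∧
        ∀ s ∈ S, (bform g (C w₁ + C v₁ * X) (C w₂ + C v₂ * X)).eval s = 0 := by
  classical
  have hlc : (g.leadingCoeff : K) ≠ 0 := by
    obtain ⟨k, hk⟩ := h.1
    rintro h0
    apply hW
    rw [hk]; simp [h0]
  set T := (g.map (Int.castRingHom K)).roots with hT
  have hTn : T.Nodup := nodup_roots (h.separable_map hW)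
  have hTc : T.card = g.natDegree := by
    rw [hT, ← (IsAlgClosed.splits _).natDegree_eq_card_roots]
    exact natDegree_map_of_leadingCoeff_ne_zero _ (by simpa using hlc)
  have heval : ∀ s : K, (bform g (C w₁ + C v₁ * X) (C w₂ + C v₂ * X)).eval s =
      (g.leadingCoeff : K) * (T.map fun α => (w₁ + v₁ * s) - α * (w₂ + v₂ * s)).prod := by
    intro s
    have := map_bform (evalRingHom s) g (C w₁ + C v₁ * X) (C w₂ + C v₂ * X)
    simp only [coe_evalRingHom, eval_add, eval_C, eval_mul, eval_X] at this
    rw [this, bform_eq_prod g hlc]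
  set S : Finset K := (T.toFinset.filter fun α => v₁ - α * v₂ ≠ 0).image
    fun α => -(w₁ - α * w₂) / (v₁ - α * v₂) with hS
  have hinj : Set.InjOn (fun α => -(w₁ - α * w₂) / (v₁ - α * v₂))
      (T.toFinset.filter fun α => v₁ - α * v₂ ≠ 0 : Finset K) := by
    intro α hα β hβ hab
    simp only [Finset.coe_filter, Set.mem_ofPred_eq] at hα hβ hab
    rw [div_eq_div_iff hα.2 hβ.2] at hab
    have : (w₁ * v₂ - w₂ * v₁) * (α - β) = 0 := by linear_combination -hab
    exact sub_eq_zero.1 ((mul_eq_zero.1 this).resolve_left hdet)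
  have hcard : g.natDegree ≤ S.card + 1 := by
    rw [Finset.card_image_of_injOn hinj, ← hTc, ← Multiset.toFinset_card_of_nodup hTn,
      ← Finset.card_filter_add_card_filter_not (fun α => v₁ - α * v₂ ≠ 0)]
    gcongr
    rw [Finset.card_le_one]
    intro α hα β hβ
    simp only [Finset.mem_filter, not_not] at hα hβ
    have h1 : v₂ ≠ 0 := by
      rintro rfl
      apply hdet
      have := hα.2
      simp only [mul_zero, sub_zero] at this
      simp [this]
    have : v₂ * (α - β) = 0 := by linear_combination hβ.2 - hα.2
    exact sub_eq_zero.1 ((mul_eq_zero.1 this).resolve_left h1)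
  refine ⟨?_, S, by omega, ?_⟩
  · have : bform g (C w₁ + C v₁ * X) (C w₂ + C v₂ * X) =
        C (g.leadingCoeff : K) *
          (T.map fun α => C (w₁ - α * w₂) + C (v₁ - α * v₂) * X).prod := by
      apply funext
      intro s
      rw [heval, eval_mul, eval_C, eval_multiset_prod, Multiset.map_map]
      congr 2
      apply Multiset.map_congr rfl
      intro α _
      simp
      ring
    rw [this]
    refine mul_ne_zero (C_ne_zero.2 hlc) (Multiset.prod_ne_zero ?_)
    rw [Multiset.mem_map]
    rintro ⟨α, -, hα⟩
    have h0 := congrArg (coeff · 0) hα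
    have h1 := congrArg (coeff · 1) hα
    simp at h0 h1
    apply hdet
    linear_combination v₂ * h0 - w₂ * h1
  · intro s hs
    obtain ⟨α, hα, rfl⟩ := Finset.mem_image.1 hs
    rw [heval, Multiset.prod_eq_zero, mul_zero]
    rw [Finset.mem_filter, Multiset.mem_toFinset] at hα
    refine Multiset.mem_map.2 ⟨α, hα.1, ?_⟩
    have := hα.2
    field_simp
    ring

/-- For at most three quarters of the points on an affine line not through the origin, a separable
binary form of degree `5` or `6` takes a square value, up to a fixed nonzero factor. -/
theorem SepBy.card_isSquare_bform_le {g : ℤ[X]} {W : ℤ} (h : SepBy g W) {ℓ : ℕ} [Fact ℓ.Prime]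
    (hℓ : 2000 ≤ ℓ) (hℓW : ¬ (ℓ : ℤ) ∣ W) (hg : 5 ≤ g.natDegree) (hg6 : g.natDegree ≤ 6)
    {w₁ w₂ v₁ v₂ u : ZMod ℓ} (hu : u ≠ 0) (hdet : w₁ * v₂ - w₂ * v₁ ≠ 0) :
    4 * (Finset.univ.filter fun s : ZMod ℓ =>
      IsSquare (u * bform g (w₁ + v₁ * s) (w₂ + v₂ * s))).card ≤ 3 * ℓ := by
  set B : (ZMod ℓ)[X] := bform g (C w₁ + C v₁ * X) (C w₂ + C v₂ * X) with hB
  have heval : ∀ s, (C u * B).eval s = u * bform g (w₁ + v₁ * s) (w₂ + v₂ * s) := by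
    intro s
    have := map_bform (evalRingHom s) g (C w₁ + C v₁ * X) (C w₂ + C v₂ * X)
    simp only [coe_evalRingHom, eval_add, eval_C, eval_mul, eval_X] at this
    rw [eval_mul, eval_C, this]
  have hdegB : (C u * B).natDegree ≤ 6 := by
    refine (natDegree_C_mul_le _ _).trans (le_trans ?_ hg6)
    rw [hB, bform_eq_sum]
    refine natDegree_sum_le_of_forall_le _ _ fun i hi => ?_
    have hi : i ≤ g.natDegree := by have := Finset.mem_range.1 hi; omega
    have hl : ∀ a b : ZMod ℓ, ∀ k, ((C a + C b * X) ^ k).natDegree ≤ k := by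
      intro a b k
      have : (C a + C b * X).natDegree ≤ 1 := by compute_degree
      exact natDegree_pow_le.trans (by nlinarith)
    rw [← C_eq_intCast, mul_assoc]
    refine (natDegree_C_mul_le _ _).trans (natDegree_mul_le.trans ?_)
    have := hl w₁ v₁ i
    have := hl w₂ v₂ (g.natDegree - i)
    omega
  have key := card_isSquare_eval_le hℓ hdegB ?_
  · simpa only [heval] using key
  intro c A D hAD
  let K := AlgebraicClosure (ZMod ℓ)
  let φ := algebraMap (ZMod ℓ) K
  have hφ : Function.Injective φ := φ.injective
  have hWK : (W : K) ≠ 0 := by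
    have h1 : (W : ZMod ℓ) ≠ 0 := by rwa [Ne, ZMod.intCast_zmod_eq_zero_iff_dvd]
    have := (_root_.map_ne_zero φ).2 h1
    simpa using this
  have hBK : B.map φ = bform g (C (φ w₁) + C (φ v₁) * X) (C (φ w₂) + C (φ v₂) * X) := by
    have := map_bform (mapRingHom φ) g (C w₁ + C v₁ * X) (C w₂ + C v₂ * X)
    simpa using this
  have hdetK : φ w₁ * φ v₂ - φ w₂ * φ v₁ ≠ 0 := by
    have := (_root_.map_ne_zero φ).2 hdet
    simpa using this
  obtain ⟨h1, S, hS, hroot⟩ := bform_line_ne_zero_and_roots h hWK hg hdetK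
  have h2 := congrArg (map φ) hAD
  rw [Polynomial.map_mul, Polynomial.map_pow, Polynomial.map_mul _ (p := C c), Polynomial.map_pow,
    map_C] at h2
  have h3 : A.map φ = 0 := by
    refine eq_zero_of_mul_sq_eq (natDegree_map_le.trans hdegB) ?_ S hS ?_ h2
    · rw [Polynomial.map_mul, map_C, hBK]
      exact mul_ne_zero (by simpa using hu) h1
    · intro s hs
      rw [Polynomial.map_mul, eval_mul, hBK, hroot s hs, mul_zero]
  exact (Polynomial.map_eq_zero_iff hφ).1 h3

end Polynomial

section Counting

theorem card_filter_modEq_Icc_le (S L : ℕ) (hL : 0 < L) (c : ℤ) :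
    ((Finset.Icc (-S : ℤ) S).filter fun s => s ≡ c [ZMOD L]).card ≤ 2 * S / L + 1 := by
  rw [← Finset.card_range (2 * S / L + 1)]
  have hL' : (0 : ℤ) < L := by exact_mod_cast hL
  refine Finset.card_le_card_of_injOn (fun s => ((s + S) / L).toNat) ?_ ?_
  · intro s hs
    simp only [Finset.coe_filter, Finset.mem_Icc, Set.mem_ofPred_eq] at hs
    simp only [Finset.coe_range, Set.mem_Iio]
    have h1 : (s + S) / L ≤ (2 * S) / L := Int.ediv_le_ediv hL' (by linarith [hs.1.2])
    have h2 : ((2 * S / L : ℕ) : ℤ) = (2 * S) / L := by push_cast; rfl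
    have h3 : 0 ≤ (s + S) / L := Int.ediv_nonneg (by linarith [hs.1.1]) hL'.le
    omega
  · intro s hs s' hs' h
    simp only [Finset.coe_filter, Finset.mem_Icc, Set.mem_ofPred_eq] at hs hs' h
    have h3 : 0 ≤ (s + S) / L := Int.ediv_nonneg (by linarith [hs.1.1]) hL'.le
    have h4 : 0 ≤ (s' + S) / L := Int.ediv_nonneg (by linarith [hs'.1.1]) hL'.le
    have h5 : (s + S) / L = (s' + S) / L := by omega
    have h6 : (s + S) % L = (s' + S) % L := (hs.2.trans hs'.2.symm).add_right S
    have h7 := Int.emod_add_mul_ediv (s + S) L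
    have h8 := Int.emod_add_mul_ediv (s' + S) L
    rw [h5, h6] at h7
    linarith

/-- Integers in an interval lying in prescribed residue classes modulo several primes. -/
theorem card_filter_forall_mem_le (S : ℕ) (P : Finset ℕ) (hP : ∀ ℓ ∈ P, ℓ.Prime)
    (R : ∀ ℓ : ℕ, Set (ZMod ℓ)) (B : Finset ℤ) (hB : ∀ s ∈ B, |s| ≤ S)
    (hBR : ∀ ℓ ∈ P, ∀ s ∈ B, (s : ZMod ℓ) ∈ R ℓ) :
    B.card ≤ (2 * S / (∏ ℓ ∈ P, ℓ) + 1) * ∏ ℓ ∈ P, Nat.card (R ℓ) := by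
  classical
  set L := ∏ ℓ ∈ P, ℓ with hL
  have hL0 : 0 < L := Finset.prod_pos fun ℓ hℓ => (hP ℓ hℓ).pos
  have hcast : ∀ s s' : ℤ, (∀ ℓ ∈ P, (s : ZMod ℓ) = s') → s ≡ s' [ZMOD L] := by
    intro s s' h
    rw [Int.modEq_iff_dvd, hL]
    push_cast
    refine Finset.prod_dvd_of_coprime ?_ fun ℓ hℓ =>
      (ZMod.intCast_eq_intCast_iff_dvd_sub _ _ _).1 (h ℓ hℓ)
    intro a ha b hb hab
    exact Nat.isCoprime_iff_coprime.2 ((Nat.coprime_primes (hP a ha) (hP b hb)).2 hab)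
  have hfin : ∀ ℓ : P, Fintype (R ℓ) := fun ℓ =>
    have : NeZero (ℓ : ℕ) := ⟨(hP ℓ ℓ.2).ne_zero⟩
    Fintype.ofFinite _
  let φ : ℤ → ∀ ℓ : P, ZMod ℓ := fun s ℓ => (s : ZMod ℓ)
  have himg : (B.image φ).card ≤ ∏ ℓ ∈ P, Nat.card (R ℓ) := by
    have h1 : B.image φ ⊆ Fintype.piFinset fun ℓ : P => (R ℓ).toFinset := by
      intro f hf
      obtain ⟨s, hs, rfl⟩ := Finset.mem_image.1 hf
      rw [Fintype.mem_piFinset]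
      intro ℓ
      rw [Set.mem_toFinset]
      exact hBR ℓ ℓ.2 s hs
    refine (Finset.card_le_card h1).trans ?_
    rw [Fintype.card_piFinset, ← Finset.prod_coe_sort P]
    refine le_of_eq (Finset.prod_congr rfl fun ℓ _ => ?_)
    rw [Set.toFinset_card, Nat.card_eq_fintype_card]
  refine (Finset.card_le_mul_card_image (f := φ) B (2 * S / L + 1) ?_).trans
    (Nat.mul_le_mul_left _ himg)
  intro f hf
  obtain ⟨c, hc, rfl⟩ := Finset.mem_image.1 hf
  refine (Finset.card_le_card ?_).trans (card_filter_modEq_Icc_le S L hL0 c)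
  intro s hs
  rw [Finset.mem_filter] at hs ⊢
  refine ⟨Finset.mem_Icc.2 (abs_le.1 (hB s hs.1)), hcast _ _ fun ℓ hℓ => ?_⟩
  exact congrFun hs.2 ⟨ℓ, hℓ⟩

theorem card_le_of_four_mul_card_le (S : ℕ) (P : Finset ℕ) (hP : ∀ ℓ ∈ P, ℓ.Prime)
    (hPS : ∏ ℓ ∈ P, ℓ ≤ S) (R : ∀ ℓ : ℕ, Set (ZMod ℓ))
    (hR : ∀ ℓ ∈ P, 4 * Nat.card (R ℓ) ≤ 3 * ℓ) (B : Finset ℤ) (hB : ∀ s ∈ B, |s| ≤ S)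
    (hBR : ∀ ℓ ∈ P, ∀ s ∈ B, (s : ZMod ℓ) ∈ R ℓ) :
    (B.card : ℝ) ≤ 3 * S * (3 / 4) ^ P.card := by
  have h1 : (B.card : ℝ) ≤
      ((2 * S / (∏ ℓ ∈ P, ℓ) + 1) * ∏ ℓ ∈ P, Nat.card (R ℓ) : ℕ) :=
    Nat.cast_le.2 (card_filter_forall_mem_le S P hP R B hB hBR)
  refine h1.trans ?_
  set L := ∏ ℓ ∈ P, ℓ with hL
  have hL0 : 0 < L := Finset.prod_pos fun ℓ hℓ => (hP ℓ hℓ).pos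
  have h2 : ((∏ ℓ ∈ P, Nat.card (R ℓ) : ℕ) : ℝ) ≤ (3 / 4) ^ P.card * L := by
    rw [hL]
    push_cast
    rw [← Finset.prod_const, ← Finset.prod_mul_distrib]
    refine Finset.prod_le_prod (fun _ _ => by positivity) fun ℓ hℓ => ?_
    have : (4 * Nat.card (R ℓ) : ℝ) ≤ 3 * ℓ := by exact_mod_cast hR ℓ hℓ
    linarith
  rw [Nat.cast_mul]
  have h3 : (((2 * S / L + 1 : ℕ)) : ℝ) * L ≤ 3 * S := by
    have : (2 * S / L + 1) * L ≤ 3 * S := by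
      have := Nat.div_mul_le_self (2 * S) L
      linarith
    exact_mod_cast this
  calc _ ≤ ((2 * S / L + 1 : ℕ) : ℝ) * ((3 / 4) ^ P.card * L) := by gcongr
    _ = (((2 * S / L + 1 : ℕ)) : ℝ) * L * (3 / 4) ^ P.card := by ring
    _ ≤ _ := by gcongr

/-- **Thue's lemma**. -/
theorem exists_ne_zero_dvd_sub_mul (q : ℕ) (hq : 0 < q) (r : ℤ) :
    ∃ a b : ℤ, (a ≠ 0 ∨ b ≠ 0) ∧ a ^ 2 ≤ q ∧ b ^ 2 ≤ q ∧ (q : ℤ) ∣ a - r * b := by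
  classical
  have : NeZero q := ⟨hq.ne'⟩
  set k := q.sqrt with hk
  let A := Finset.range (k + 1) ×ˢ Finset.range (k + 1)
  have hA : (Finset.univ : Finset (ZMod q)).card < A.card := by
    rw [Finset.card_univ, ZMod.card, Finset.card_product, Finset.card_range]
    exact Nat.lt_succ_sqrt q
  obtain ⟨x, hx, y, hy, hxy, h⟩ := Finset.exists_ne_map_eq_of_card_lt_of_maps_to hA
    (f := fun z : ℕ × ℕ => ((z.1 - r * z.2 : ℤ) : ZMod q)) (fun _ _ => Finset.mem_univ _)
  simp only [A, Finset.mem_product, Finset.mem_range] at hx hy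
  have hkq : k * k ≤ q := Nat.sqrt_le q
  have hsq : ∀ u v : ℕ, u < k + 1 → v < k + 1 → ((u : ℤ) - v) ^ 2 ≤ q := by
    intro u v hu hv
    have h1 : ((u : ℤ) - v) ^ 2 ≤ (k : ℤ) ^ 2 := sq_le_sq' (by omega) (by omega)
    have h2 : (k : ℤ) * k ≤ q := by exact_mod_cast hkq
    nlinarith
  refine ⟨(x.1 : ℤ) - y.1, (x.2 : ℤ) - y.2, ?_, hsq _ _ hx.1 hy.1, hsq _ _ hx.2 hy.2, ?_⟩
  · by_contra! h0
    exact hxy (Prod.ext (by omega) (by omega))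
  · rw [ZMod.intCast_eq_intCast_iff_dvd_sub] at h
    rw [← dvd_neg]
    have e : -((x.1 : ℤ) - y.1 - r * (x.2 - y.2)) = (y.1 - r * y.2) - (x.1 - r * x.2) := by ring
    rw [e]
    exact h

/-- A shortest nonzero vector generates the lattice points on its line. -/
theorem exists_short_vector (q : ℕ) (hq : 0 < q) (r : ℤ) :
    ∃ (a b : ℤ) (ν : ℕ), 0 < ν ∧ ν ^ 2 ≤ q ∧ |a| ≤ ν ∧ |b| ≤ ν ∧ (|a| = ν ∨ |b| = ν) ∧
      (q : ℤ) ∣ a - r * b ∧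
      ∀ m n : ℤ, (q : ℤ) ∣ m - r * n → a * n = b * m → ∃ k : ℤ, m = k * a ∧ n = k * b := by
  classical
  have hex : ∃ ν : ℕ, ∃ a b : ℤ, 0 < ν ∧ |a| ≤ ν ∧ |b| ≤ ν ∧ (|a| = ν ∨ |b| = ν) ∧
      (q : ℤ) ∣ a - r * b ∧ ν ^ 2 ≤ q := by
    obtain ⟨a, b, h0, ha, hb, hd⟩ := exists_ne_zero_dvd_sub_mul q hq r
    have ha2 : a.natAbs ^ 2 ≤ q := by zify; simpa using ha
    have hb2 : b.natAbs ^ 2 ≤ q := by zify; simpa using hb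
    simp only [Int.abs_eq_natAbs]
    refine ⟨max a.natAbs b.natAbs, a, b, by omega, by omega, by omega, by omega, hd, ?_⟩
    rcases max_choice a.natAbs b.natAbs with h | h <;> rw [h] <;> assumption
  obtain ⟨a, b, hν, ha, hb, hab, hd, hq'⟩ := Nat.find_spec hex
  have hmin := fun ν hν => Nat.find_min hex (m := ν) hν
  set ν := Nat.find hex
  refine ⟨a, b, ν, hν, hq', ha, hb, hab, hd, ?_⟩
  have hzero : ∀ m n : ℤ, (q : ℤ) ∣ m - r * n → |m| < ν → |n| < ν → m = 0 ∧ n = 0 := by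
    intro m n hmn hm hn
    by_contra h0
    simp only [Int.abs_eq_natAbs] at hmin hm hn
    refine hmin (max m.natAbs n.natAbs) (by omega) ⟨m, n, by omega, by omega, by omega, by omega,
      hmn, le_trans ?_ hq'⟩
    exact Nat.pow_le_pow_left (by omega) 2
  intro m n hmn hpar
  have hround : ∀ c x : ℤ, |c| = ν → ∃ k, 2 * |x - k * c| ≤ ν := by
    intro c x hc
    have hc0 : c ≠ 0 := by rintro rfl; simp at hc; omega
    refine ⟨round ((x : ℚ) / c), ?_⟩
    have h1 := abs_sub_round ((x : ℚ) / c)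
    have hcQ : (c : ℚ) ≠ 0 := by exact_mod_cast hc0
    have h2 : |(x : ℚ) - round ((x : ℚ) / c) * c| =
        |(x : ℚ) / c - round ((x : ℚ) / c)| * |(c : ℚ)| := by
      rw [← abs_mul, sub_mul, div_mul_cancel₀ _ hcQ]
    have h3 : 2 * |(x : ℚ) - round ((x : ℚ) / c) * c| ≤ |(c : ℚ)| := by
      rw [h2]
      nlinarith [abs_nonneg (c : ℚ)]
    rw [← hc]
    exact_mod_cast h3
  rcases hab with h | h
  · obtain ⟨k, hk⟩ := hround a m h
    have h1 : |a| * |n - k * b| = |b| * |m - k * a| := by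
      rw [← abs_mul, ← abs_mul]; congr 1; linear_combination hpar
    have h2 : |n - k * b| ≤ |m - k * a| := by
      have : |a| * |n - k * b| ≤ |a| * |m - k * a| := by
        rw [h1]; exact mul_le_mul_of_nonneg_right (by rw [h]; exact hb) (abs_nonneg _)
      exact le_of_mul_le_mul_left this (by omega)
    obtain ⟨h3, h4⟩ := hzero (m - k * a) (n - k * b) (by
      have e : m - k * a - r * (n - k * b) = m - r * n - k * (a - r * b) := by ring
      rw [e]
      exact dvd_sub hmn (hd.mul_left k)) (by omega) (by omega)
    exact ⟨k, by linarith, by linarith⟩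
  · obtain ⟨k, hk⟩ := hround b n h
    have h1 : |a| * |n - k * b| = |b| * |m - k * a| := by
      rw [← abs_mul, ← abs_mul]; congr 1; linear_combination hpar
    have h2 : |m - k * a| ≤ |n - k * b| := by
      have : |b| * |m - k * a| ≤ |b| * |n - k * b| := by
        rw [← h1]; exact mul_le_mul_of_nonneg_right (by rw [h]; exact ha) (abs_nonneg _)
      exact le_of_mul_le_mul_left this (by omega)
    obtain ⟨h3, h4⟩ := hzero (m - k * a) (n - k * b) (by
      have e : m - k * a - r * (n - k * b) = m - r * n - k * (a - r * b) := by ring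
      rw [e]
      exact dvd_sub hmn (hd.mul_left k)) (by omega) (by omega)
    exact ⟨k, by linarith, by linarith⟩

end Counting

section LatticeSieve

theorem card_filter_ne_zero_dvd_le (T ℓ : ℕ) (hℓ : 0 < ℓ) :
    ((((Finset.Icc (-T : ℤ) T).erase 0).filter fun t => (ℓ : ℤ) ∣ t).card : ℝ) ≤ 2 * T / ℓ := by
  have h1 := card_filter_modEq_Icc_le T ℓ hℓ 0
  have h2 : ((Finset.Icc (-T : ℤ) T).filter fun t => t ≡ 0 [ZMOD ℓ]).erase 0 =
      ((Finset.Icc (-T : ℤ) T).erase 0).filter fun t => (ℓ : ℤ) ∣ t := by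
    ext t
    simp only [Finset.mem_erase, Finset.mem_filter, Int.modEq_zero_iff_dvd]
    tauto
  rw [← h2, Finset.card_erase_of_mem (by simp)]
  have h3 : ((2 * T / ℓ : ℕ) : ℝ) ≤ 2 * T / ℓ := by
    refine Nat.cast_div_le.trans ?_
    push_cast; rfl
  refine le_trans ?_ h3
  exact Nat.cast_le.2 (Nat.sub_le_of_le_add h1)

/-- Points on a line through the origin with small greatest common divisor. -/
theorem card_le_of_forall_eq_mul (A : Finset (ℤ × ℤ)) (G : ℕ) (a b : ℤ)
    (hgcd : ∀ v ∈ A, 0 < Int.gcd v.1 v.2 ∧ Int.gcd v.1 v.2 ≤ G)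
    (hA : ∀ v ∈ A, ∃ k : ℤ, v.1 = k * a ∧ v.2 = k * b) : A.card ≤ 2 * G + 1 := by
  have h1 : A ⊆ (Finset.Icc (-G : ℤ) G).image fun k => (k * a, k * b) := by
    intro v hv
    obtain ⟨k, h1, h2⟩ := hA v hv
    refine Finset.mem_image.2 ⟨k, Finset.mem_Icc.2 (abs_le.1 ?_), Prod.ext h1.symm h2.symm⟩
    obtain ⟨h3, h4⟩ := hgcd v hv
    have h5 : k ∣ (Int.gcd v.1 v.2 : ℤ) :=
      Int.dvd_coe_gcd (h1 ▸ Dvd.intro _ rfl) (h2 ▸ Dvd.intro _ rfl)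
    have h6 := Int.le_of_dvd (by exact_mod_cast h3) ((abs_dvd _ _).2 h5)
    exact h6.trans (by exact_mod_cast h4)
  refine (Finset.card_le_card h1).trans (Finset.card_image_le.trans ?_)
  simp
  omega

/-- A sieve for points of a lattice `m ≡ r n (mod q)` in a box. -/
theorem lattice_sieve {q X G lam : ℕ} (r : ℤ) (hq : 0 < q) (A : Finset (ℤ × ℤ))
    (hbox : ∀ v ∈ A, |v.1| ≤ X ∧ |v.2| ≤ X)
    (hgcd : ∀ v ∈ A, 0 < Int.gcd v.1 v.2 ∧ Int.gcd v.1 v.2 ≤ G)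
    (hlat : ∀ v ∈ A, (q : ℤ) ∣ v.1 - r * v.2)
    (P : Finset ℕ) (hP : ∀ ℓ ∈ P, ℓ.Prime) (hPq : ∀ ℓ ∈ P, ¬ ℓ ∣ q)
    (hL : (∏ ℓ ∈ P, ℓ) ^ 2 * q ≤ X ^ 2) (Q : ∀ ℓ : ℕ, ZMod ℓ → ZMod ℓ → Prop)
    (hQA : ∀ ℓ ∈ P, ∀ v ∈ A, Q ℓ v.1 v.2)
    (hQ : ∀ ℓ ∈ P, ∀ w₁ w₂ v₁ v₂ : ZMod ℓ, w₁ * v₂ - w₂ * v₁ ≠ 0 →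
      4 * Nat.card {s : ZMod ℓ | Q ℓ (w₁ + v₁ * s) (w₂ + v₂ * s)} ≤ 3 * ℓ)
    (hlam : 0 < lam) (hPlam : ∀ ℓ ∈ P, lam ≤ ℓ) :
    (A.card : ℝ) ≤ 2 * G + 1 + 24 * (X ^ 2 / q) * ((3 / 4) ^ P.card + P.card / lam) := by
  classical
  obtain ⟨a, b, ν, hν, hνq, ha, hb, hab, hdab, hgen⟩ := exists_short_vector q hq r
  set L := ∏ ℓ ∈ P, ℓ with hLdef
  have hL0 : 0 < L := Finset.prod_pos fun ℓ hℓ => (hP ℓ hℓ).pos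
  have hq0 : (0 : ℤ) < q := by exact_mod_cast hq
  set S := 2 * X / ν with hS
  set T := 2 * ν * X / q with hT
  have hLν : L * ν ≤ X := by
    by_contra! h
    have : X ^ 2 < (L * ν) ^ 2 := Nat.pow_lt_pow_left h (by norm_num)
    have : (L * ν) ^ 2 ≤ L ^ 2 * q := by rw [mul_pow]; gcongr
    omega
  have hLS : L ≤ S := (Nat.le_div_iff_mul_le hν).2 (by omega)
  let τ : ℤ × ℤ → ℤ := fun v => (a * v.2 - b * v.1) / q
  have hτ : ∀ v ∈ A, q * τ v = a * v.2 - b * v.1 := by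
    intro v hv
    refine Int.mul_ediv_cancel' ?_
    have : a * v.2 - b * v.1 = (a - r * b) * v.2 - b * (v.1 - r * v.2) := by ring
    rw [this]
    exact dvd_sub (hdab.mul_right _) ((hlat v hv).mul_left _)
  have hmaps : ∀ v ∈ A, τ v ∈ Finset.Icc (-T : ℤ) T := by
    intro v hv
    rw [Finset.mem_Icc, ← abs_le]
    have h1 : q * |τ v| ≤ 2 * ν * X := by
      have h2 : |(q : ℤ)| = q := abs_of_pos hq0
      rw [← h2, ← abs_mul, hτ v hv]
      obtain ⟨h3, h4⟩ := hbox v hv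
      calc |a * v.2 - b * v.1| ≤ |a * v.2| + |b * v.1| := abs_sub _ _
        _ = |a| * |v.2| + |b| * |v.1| := by rw [abs_mul, abs_mul]
        _ ≤ ν * X + ν * X := by gcongr
        _ = _ := by ring
    have h7 : (τ v).natAbs * q ≤ 2 * ν * X := by
      zify; linarith
    have h8 := (Nat.le_div_iff_mul_le hq).2 h7
    rw [Int.abs_eq_natAbs]
    exact_mod_cast h8
  have hline : ∀ v ∈ A, ∀ w ∈ A, τ v = τ w → ∃ k : ℤ, |k| ≤ S ∧ v = (w.1 + k * a, w.2 + k * b) := by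
    intro v hv w hw h
    obtain ⟨k, h1, h2⟩ := hgen (v.1 - w.1) (v.2 - w.2) (by
      have e : v.1 - w.1 - r * (v.2 - w.2) = (v.1 - r * v.2) - (w.1 - r * w.2) := by ring
      rw [e]
      exact dvd_sub (hlat v hv) (hlat w hw)) (by
      have h3 := hτ v hv
      have h4 := hτ w hw
      rw [h] at h3
      linarith)
    refine ⟨k, ?_, Prod.ext (by simp; linarith) (by simp; linarith)⟩
    have hkν : |k| * ν ≤ 2 * X := by
      obtain ⟨h3, h4⟩ := hbox v hv
      obtain ⟨h5, h6⟩ := hbox w hw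
      rcases hab with h | h
      · rw [← h, ← abs_mul, ← h1]
        exact (abs_sub _ _).trans (by linarith)
      · rw [← h, ← abs_mul, ← h2]
        exact (abs_sub _ _).trans (by linarith)
    have h7 : k.natAbs * ν ≤ 2 * X := by
      zify; exact hkν
    have h8 := (Nat.le_div_iff_mul_le hν).2 h7
    rw [Int.abs_eq_natAbs]
    exact_mod_cast h8
  have hfib : ∀ t ∈ (Finset.Icc (-T : ℤ) T).erase 0, ((A.filter fun v => τ v = t).card : ℝ) ≤
      3 * S * (3 / 4) ^ P.card + ∑ ℓ ∈ P, if (ℓ : ℤ) ∣ t then (3 * S : ℝ) else 0 := by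
    intro t ht
    rcases (A.filter fun v => τ v = t).eq_empty_or_nonempty with h0 | ⟨w, hw⟩
    · rw [h0]
      simp only [Finset.card_empty, Nat.cast_zero]
      have : 0 ≤ ∑ ℓ ∈ P, if (ℓ : ℤ) ∣ t then (3 * S : ℝ) else 0 :=
        Finset.sum_nonneg fun ℓ _ => by split_ifs <;> positivity
      positivity
    rw [Finset.mem_filter] at hw
    set B := (Finset.Icc (-S : ℤ) S).filter fun s => (w.1 + s * a, w.2 + s * b) ∈ A with hB
    have hAB : (A.filter fun v => τ v = t).card ≤ B.card := by
      refine (Finset.card_le_card ?_).trans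
        (Finset.card_image_le (s := B) (f := fun s => (w.1 + s * a, w.2 + s * b)))
      intro v hv
      rw [Finset.mem_filter] at hv
      obtain ⟨k, hk, rfl⟩ := hline v hv.1 w hw.1 (hv.2.trans hw.2.symm)
      exact Finset.mem_image.2
        ⟨k, Finset.mem_filter.2 ⟨Finset.mem_Icc.2 (abs_le.1 hk), hv.1⟩, rfl⟩
    have hBS : ∀ s ∈ B, |s| ≤ S := by
      intro s hs
      exact abs_le.2 (Finset.mem_Icc.1 (Finset.mem_filter.1 hs).1)
    refine (Nat.cast_le.2 hAB).trans ?_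
    by_cases hdiv : ∃ ℓ ∈ P, (ℓ : ℤ) ∣ t
    · obtain ⟨ℓ, hℓ, hℓt⟩ := hdiv
      have h1 : (3 * S : ℝ) ≤ ∑ ℓ ∈ P, if (ℓ : ℤ) ∣ t then (3 * S : ℝ) else 0 := by
        refine le_trans ?_ (Finset.single_le_sum (f := fun ℓ : ℕ =>
          if (ℓ : ℤ) ∣ t then (3 * S : ℝ) else 0)
          (fun ℓ _ => by split_ifs <;> positivity) hℓ)
        simp [hℓt]
      have h2 : (B.card : ℝ) ≤ 3 * S := by
        have := card_le_of_four_mul_card_le S ∅ (by simp) (by simp; omega) (fun _ => ∅) (by simp)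
          B hBS (by simp)
        simpa using this
      have : (0 : ℝ) ≤ 3 * S * (3 / 4) ^ P.card := by positivity
      linarith
    · push Not at hdiv
      have h1 := card_le_of_four_mul_card_le S P hP hLS
        (fun ℓ => {s : ZMod ℓ | Q ℓ ((w.1 : ZMod ℓ) + a * s) (w.2 + b * s)}) (by
          intro ℓ hℓ
          refine hQ ℓ hℓ _ _ _ _ ?_
          intro h0
          have h1 : ((w.1 * b - w.2 * a : ℤ) : ZMod ℓ) = 0 := by push_cast; exact h0
          have h2 : w.1 * b - w.2 * a = -(q * t) := by rw [← hw.2, hτ w hw.1]; ring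
          rw [h2, ZMod.intCast_zmod_eq_zero_iff_dvd, dvd_neg] at h1
          rcases (Nat.prime_iff_prime_int.1 (hP ℓ hℓ)).dvd_or_dvd h1 with h3 | h3
          · exact hPq ℓ hℓ (Int.natCast_dvd_natCast.1 h3)
          · exact hdiv ℓ hℓ h3) B hBS (by
          intro ℓ hℓ s hs
          have := hQA ℓ hℓ _ (Finset.mem_filter.1 hs).2
          simpa [mul_comm] using this)
      have : 0 ≤ ∑ ℓ ∈ P, if (ℓ : ℤ) ∣ t then (3 * S : ℝ) else 0 :=
        Finset.sum_nonneg fun ℓ _ => by split_ifs <;> positivity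
      linarith
  have hzero : ((A.filter fun v => τ v = 0).card : ℝ) ≤ 2 * G + 1 := by
    have := card_le_of_forall_eq_mul (A.filter fun v => τ v = 0) G a b
      (fun v hv => hgcd v (Finset.mem_filter.1 hv).1) (by
        intro v hv
        rw [Finset.mem_filter] at hv
        refine hgen v.1 v.2 (hlat v hv.1) ?_
        have := hτ v hv.1
        rw [hv.2] at this
        linarith)
    exact_mod_cast this
  have hsum : (A.card : ℝ) = ∑ t ∈ Finset.Icc (-T : ℤ) T, ((A.filter fun v => τ v = t).card : ℝ) := by
    exact_mod_cast Finset.card_eq_sum_card_fiberwise hmaps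
  have h0T : (0 : ℤ) ∈ Finset.Icc (-T : ℤ) T := by simp
  rw [hsum, ← Finset.add_sum_erase _ _ h0T]
  have hmain : ∑ t ∈ (Finset.Icc (-T : ℤ) T).erase 0, ((A.filter fun v => τ v = t).card : ℝ) ≤
      6 * (T * S) * ((3 / 4) ^ P.card + P.card / lam) := by
    refine (Finset.sum_le_sum hfib).trans ?_
    rw [Finset.sum_add_distrib, Finset.sum_comm, Finset.sum_const, Finset.card_erase_of_mem h0T]
    have h1 : ∀ ℓ ∈ P, (∑ t ∈ (Finset.Icc (-T : ℤ) T).erase 0,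
        if (ℓ : ℤ) ∣ t then (3 * S : ℝ) else 0) ≤ 6 * (T * S) / lam := by
      intro ℓ hℓ
      rw [← Finset.sum_filter, Finset.sum_const, nsmul_eq_mul]
      have h2 := card_filter_ne_zero_dvd_le T ℓ (hP ℓ hℓ).pos
      have h3 : (lam : ℝ) ≤ ℓ := by exact_mod_cast hPlam ℓ hℓ
      have h4 : (0 : ℝ) < lam := by exact_mod_cast hlam
      calc _ ≤ (2 * T / ℓ : ℝ) * (3 * S) := by gcongr
        _ ≤ (2 * T / lam : ℝ) * (3 * S) := by gcongr
        _ = _ := by ring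
    have h5 : ((Finset.Icc (-T : ℤ) T).card - 1) = 2 * T := by
      rw [Int.card_Icc]; omega
    rw [h5, nsmul_eq_mul]
    refine (add_le_add le_rfl (Finset.sum_le_sum h1)).trans ?_
    rw [Finset.sum_const, nsmul_eq_mul]
    push_cast
    apply le_of_eq
    ring
  have hTS : (T * S : ℝ) ≤ 4 * (X ^ 2 / q) := by
    have h1 : (T : ℝ) ≤ 2 * ν * X / q := by
      refine Nat.cast_div_le.trans ?_
      push_cast; rfl
    have h2 : (S : ℝ) ≤ 2 * X / ν := by
      refine Nat.cast_div_le.trans ?_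
      push_cast; rfl
    have hν' : (ν : ℝ) ≠ 0 := by exact_mod_cast hν.ne'
    calc (T * S : ℝ) ≤ (2 * ν * X / q) * (2 * X / ν) := by gcongr
      _ = _ := by field_simp; ring
  have h6 : 6 * (T * S : ℝ) * ((3 / 4) ^ P.card + P.card / lam) ≤
      24 * (X ^ 2 / q) * ((3 / 4) ^ P.card + P.card / lam) := by
    have : 6 * (T * S : ℝ) ≤ 24 * (X ^ 2 / q) := by linarith
    gcongr
  linarith

end LatticeSieve

section RootAverage

open NumberField

theorem exists_ncard_absNorm_le (K : Type*) [Field K] [NumberField K] :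
    ∃ A : ℕ, 0 < A ∧ ∀ Q : ℕ, 0 < Q →
      {I : Ideal (𝓞 K) | Ideal.absNorm I ≤ Q}.ncard ≤ A * Q := by
  obtain ⟨c, hc⟩ : ∃ c, Filter.Tendsto (fun s : ℝ ↦
      (Nat.card {I : Ideal (𝓞 K) // (Ideal.absNorm I : ℝ) ≤ s} : ℝ) / s) Filter.atTop (nhds c) :=
    ⟨_, NumberField.Ideal.tendsto_norm_le_div_atTop K⟩
  have hc := hc.comp tendsto_natCast_atTop_atTop
  have h1 := hc.eventually_le_const (lt_add_one c)
  obtain ⟨N, hN⟩ := Filter.eventually_atTop.1 h1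
  set f : ℕ → ℕ := fun Q => {I : Ideal (𝓞 K) | Ideal.absNorm I ≤ Q}.ncard with hf
  have hfeq : ∀ Q : ℕ, Nat.card {I : Ideal (𝓞 K) // (Ideal.absNorm I : ℝ) ≤ (Q : ℝ)} = f Q := by
    intro Q
    simp only [hf, Nat.cast_le]
    exact Nat.card_coe_set_eq _
  have hmono : ∀ Q R, Q ≤ R → f Q ≤ f R := fun Q R h =>
    Set.ncard_le_ncard (fun I (hI : _ ≤ _) => hI.trans h) (Ideal.finite_setOfPred_absNorm_le R)
  refine ⟨⌈c + 1⌉₊ + f N + 1, by omega, fun Q hQ => ?_⟩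
  rcases le_total Q N with h | h
  · calc f Q ≤ f N := hmono _ _ h
      _ ≤ (⌈c + 1⌉₊ + f N + 1) * 1 := by omega
      _ ≤ _ := Nat.mul_le_mul_left _ hQ
  · have h2 := hN Q h
    simp only [Function.comp_apply, hfeq] at h2
    rw [div_le_iff₀ (by exact_mod_cast hQ)] at h2
    have h3 : (f Q : ℝ) ≤ (⌈c + 1⌉₊ : ℝ) * Q :=
      h2.trans (by gcongr; exact Nat.le_ceil _)
    have h4 : f Q ≤ ⌈c + 1⌉₊ * Q := by exact_mod_cast h3
    refine h4.trans (Nat.mul_le_mul_right _ (by omega))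

open Polynomial

/-- A common denominator for the ring of integers with respect to a generator. -/
theorem exists_mul_eq_aeval {K : Type*} [Field K] [NumberField K] (α : K)
    (hα : ∀ x : K, ∃ p : ℚ[X], aeval α p = x) :
    ∃ D : ℤ, D ≠ 0 ∧ ∀ x : 𝓞 K, ∃ p : ℤ[X], (D : K) * x = aeval α p := by
  classical
  have h1 : ∀ x : K, ∃ (b : ℤ) (p : ℤ[X]), b ≠ 0 ∧ (b : K) * x = aeval α p := by
    intro x
    obtain ⟨p, rfl⟩ := hα x
    obtain ⟨b, y, hb, hy⟩ := exists_map_eq_C_mul p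
    refine ⟨b, y, hb, ?_⟩
    have := congrArg (aeval α) hy
    rw [map_mul, aeval_C] at this
    rw [← algebraMap_int_eq, aeval_map_algebraMap] at this
    rw [this]
    simp
  choose b p hb hp using fun i => h1 (RingOfIntegers.basis K i : K)
  refine ⟨∏ i, b i, Finset.prod_ne_zero_iff.2 fun i _ => hb i, fun x => ?_⟩
  refine ⟨∑ i, C ((RingOfIntegers.basis K).repr x i * ∏ j ∈ Finset.univ.erase i, b j) * p i, ?_⟩
  conv_lhs => rw [← (RingOfIntegers.basis K).sum_repr x]
  simp only [map_sum, map_mul, ← hp, aeval_C, Finset.mul_sum]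
  refine Finset.sum_congr rfl fun i _ => ?_
  rw [← Finset.mul_prod_erase _ _ (Finset.mem_univ i)]
  simp
  ring

theorem exists_field_of_irreducible {G : ℚ[X]} (hG : Irreducible G) :
    ∃ (K : Type) (_ : Field K) (_ : NumberField K) (θ : K),
      (∀ x : K, ∃ p : ℚ[X], aeval θ p = x) ∧ aeval θ G = 0 ∧
        ∀ p : ℚ[X], aeval θ p = 0 → G ∣ p := by
  have : Fact (Irreducible G) := ⟨hG⟩
  have hfin : FiniteDimensional ℚ (AdjoinRoot G) := (AdjoinRoot.powerBasis hG.ne_zero).finite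
  have hchar : CharZero (AdjoinRoot G) :=
    charZero_of_injective_algebraMap (algebraMap ℚ (AdjoinRoot G)).injective
  have halg : (DivisionRing.toRatAlgebra : Algebra ℚ (AdjoinRoot G)) = AdjoinRoot.instAlgebra G :=
    Subsingleton.elim _ _
  have hnf : NumberField (AdjoinRoot G) := { to_finiteDimensional := by rw [halg]; exact hfin }
  refine ⟨AdjoinRoot G, inferInstance, hnf, AdjoinRoot.root G, ?_⟩
  rw [halg]
  refine ⟨fun x => ?_, ?_, fun p hp => ?_⟩
  · obtain ⟨p, rfl⟩ := AdjoinRoot.mk_surjective x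
    exact ⟨p, AdjoinRoot.aeval_eq p⟩
  · rw [AdjoinRoot.aeval_eq, AdjoinRoot.mk_self]
  · rwa [AdjoinRoot.aeval_eq, AdjoinRoot.mk_eq_zero] at hp

/-- On average over `q`, a polynomial irreducible over `ℤ` has boundedly many roots modulo `q`. -/
theorem exists_card_roots_le {g : ℤ[X]} (hg : Irreducible g) (hdeg : 0 < g.natDegree) :
    ∃ (D : ℤ) (A : ℕ), D ≠ 0 ∧ 0 < A ∧ ∀ (Q : ℕ) (B : Finset (ℕ × ℕ)), 0 < Q →
      (∀ x ∈ B, 0 < x.1 ∧ x.1 ≤ Q ∧ x.2 < x.1 ∧ IsCoprime (x.1 : ℤ) D ∧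
        (x.1 : ℤ) ∣ g.eval (x.2 : ℤ)) → B.card ≤ A * Q := by
  classical
  have hprim : g.IsPrimitive := hg.isPrimitive hdeg.ne'
  have hgQ : Irreducible (g.map (Int.castRingHom ℚ)) :=
    (IsPrimitive.Int.irreducible_iff_irreducible_map_cast hprim).1 hg
  obtain ⟨K, _, _, θ, hθgen, hθ0, hθdvd⟩ := exists_field_of_irreducible hgQ
  set c := g.leadingCoeff with hc
  have hc0 : c ≠ 0 := leadingCoeff_ne_zero.2 hg.ne_zero
  have hcK : (c : K) ≠ 0 := by exact_mod_cast hc0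
  have hθ : aeval θ g = 0 := by
    rwa [← algebraMap_int_eq, aeval_map_algebraMap] at hθ0
  have hint : IsIntegral ℤ ((c : K) * θ) := by
    have := isIntegral_leadingCoeff_smul g θ hθ
    rwa [zsmul_eq_mul] at this
  let α : 𝓞 K := ⟨(c : K) * θ, hint⟩
  have hαK : ((α : 𝓞 K) : K) = (c : K) * θ := rfl
  have hgen : ∀ x : K, ∃ p : ℚ[X], aeval (α : K) p = x := by
    intro x
    obtain ⟨p, rfl⟩ := hθgen x
    refine ⟨p.comp (C (c : ℚ)⁻¹ * X), ?_⟩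
    rw [aeval_comp]
    simp only [map_mul, aeval_C, aeval_X, hαK]
    have : (algebraMap ℚ K) (c : ℚ)⁻¹ * ((c : K) * θ) = θ := by
      rw [map_inv₀, map_intCast, inv_mul_cancel_left₀ hcK]
    rw [this]
  obtain ⟨D, hD, hDα⟩ := exists_mul_eq_aeval (α : K) hgen
  obtain ⟨A, hA, hcount⟩ := exists_ncard_absNorm_le K
  have hdvd : ∀ P : ℤ[X], aeval (α : K) P = 0 → ∀ r : ℤ, g.eval r ∣ P.eval (c * r) := by
    intro P hP r
    have h1 : aeval θ (P.comp (C c * X)) = 0 := by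
      rw [aeval_comp]
      simpa [hαK] using hP
    have h2 : (g.map (Int.castRingHom ℚ)) ∣ (P.comp (C c * X)).map (Int.castRingHom ℚ) := by
      refine hθdvd _ ?_
      rw [← algebraMap_int_eq, aeval_map_algebraMap]
      exact h1
    have h3 := (IsPrimitive.Int.dvd_iff_map_cast_dvd_map_cast _ _ hprim).2 h2
    have h4 := eval_dvd h3 (x := r)
    simpa using h4
  let J : ℕ × ℕ → Ideal (𝓞 K) := fun x => Ideal.span {(x.1 : 𝓞 K), α - (c : 𝓞 K) * (x.2 : 𝓞 K)}
  have hJint : ∀ x : ℕ × ℕ, (x.1 : ℤ) ∣ g.eval (x.2 : ℤ) → IsCoprime (x.1 : ℤ) D →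
      ∀ k : ℤ, (k : 𝓞 K) ∈ J x → (x.1 : ℤ) ∣ k := by
    intro x hx hxD k hk
    obtain ⟨u, v, huv⟩ := Ideal.mem_span_pair.1 hk
    obtain ⟨p₁, hp₁⟩ := hDα u
    obtain ⟨p₂, hp₂⟩ := hDα v
    have huvK := congrArg (algebraMap (𝓞 K) K) huv
    simp only [map_add, map_mul, map_sub, map_natCast, map_intCast] at huvK
    have h1 := hdvd (p₁ * C (x.1 : ℤ) + p₂ * (X - C (c * x.2)) - C (D * k)) (by
      simp only [map_sub, map_add, map_mul, aeval_C, aeval_X]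
      simp only [algebraMap_int_eq, eq_intCast, Int.cast_natCast]
      linear_combination (D : K) * huvK - (x.1 : K) * hp₁ -
        ((α : K) - c * x.2) * hp₂) x.2
    have h2 := hx.trans h1
    simp only [eval_sub, eval_add, eval_mul, eval_C, eval_X, sub_self, mul_zero, add_zero] at h2
    have h3 : (x.1 : ℤ) ∣ D * k := by
      have := dvd_sub (Dvd.intro_left (eval (c * (x.2 : ℤ)) p₁) rfl) h2
      simpa using this
    exact hxD.dvd_of_dvd_mul_left h3
  have hJnorm : ∀ x : ℕ × ℕ, 0 < x.1 → IsCoprime (x.1 : ℤ) D → Ideal.absNorm (J x) ≤ x.1 := by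
    intro x hx0 hxD
    have : NeZero x.1 := ⟨hx0.ne'⟩
    have hq : ((x.1 : 𝓞 K) : 𝓞 K ⧸ J x) = 0 :=
      Ideal.Quotient.eq_zero_iff_mem.2 (Ideal.subset_span (by simp))
    have hα : (α : 𝓞 K ⧸ J x) = (c * x.2 : ℤ) := by
      have h1 : α - (c : 𝓞 K) * (x.2 : 𝓞 K) ∈ J x := Ideal.subset_span (by simp)
      have h2 := Ideal.Quotient.eq_zero_iff_mem.2 h1
      rw [map_sub, sub_eq_zero] at h2
      rw [h2]
      simp
    have hsurj : ∀ y : 𝓞 K ⧸ J x, ∃ n : ℤ, (n : 𝓞 K ⧸ J x) = y := by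
      intro y
      obtain ⟨z, rfl⟩ := Ideal.Quotient.mk_surjective y
      obtain ⟨p, hp⟩ := hDα z
      have hp' : (D : 𝓞 K) * z = aeval α p := by
        apply RingOfIntegers.ext
        change algebraMap (𝓞 K) K _ = algebraMap (𝓞 K) K _
        rw [map_mul, map_intCast]
        exact hp.trans (aeval_algebraMap_apply K α p)
      obtain ⟨i, j, hij⟩ := hxD
      refine ⟨j * p.eval (c * x.2), ?_⟩
      have h1 : Ideal.Quotient.mk (J x) (aeval α p) = (p.eval (c * x.2 : ℤ) : ℤ) := by
        have : Ideal.Quotient.mk (J x) (aeval α p) = aeval (Ideal.Quotient.mk (J x) α) p := by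
          rw [← Ideal.Quotient.algebraMap_eq, aeval_algebraMap_apply]
        rw [this, hα]
        have := aeval_algebraMap_apply (𝓞 K ⧸ J x) (c * x.2 : ℤ) p
        simpa using this
      have h2 := congrArg (Ideal.Quotient.mk (J x)) hp'
      rw [h1, map_mul, map_intCast] at h2
      have h3 := congrArg (Int.cast (R := 𝓞 K ⧸ J x)) hij
      push_cast at h3 ⊢
      rw [← h2]
      have hq' : ((x.1 : ℕ) : 𝓞 K ⧸ J x) = 0 := by rw [← hq, map_natCast]
      rw [hq', mul_zero, zero_add] at h3
      rw [← mul_assoc, h3]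
      simp
    have hsurj' : Function.Surjective fun n : Fin x.1 => ((n : ℕ) : 𝓞 K ⧸ J x) := by
      intro y
      obtain ⟨n, rfl⟩ := hsurj y
      have hq' : ((x.1 : ℕ) : 𝓞 K ⧸ J x) = 0 := by rw [← hq, map_natCast]
      have hx0' : (0 : ℤ) < x.1 := by exact_mod_cast hx0
      have h1 := Int.emod_nonneg n hx0'.ne'
      have h2 := Int.emod_lt_of_pos n hx0'
      refine ⟨⟨(n % x.1).toNat, by omega⟩, ?_⟩
      have h3 : (((n % x.1).toNat : ℤ) : 𝓞 K ⧸ J x) = (n : ℤ) := by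
        rw [Int.toNat_of_nonneg h1]
        conv_rhs => rw [← Int.emod_add_mul_ediv n x.1]
        push_cast
        rw [hq']
        ring
      change (((n % x.1).toNat : ℕ) : 𝓞 K ⧸ J x) = _
      exact_mod_cast h3
    have h4 := Nat.card_le_card_of_surjective _ hsurj'
    rw [Nat.card_fin] at h4
    exact h4
  refine ⟨D * c, A, mul_ne_zero hD hc0, hA, fun Q B hQ hB => ?_⟩
  refine le_trans ?_ (hcount Q hQ)
  rw [← Set.ncard_coe_finset]
  refine Set.ncard_le_ncard_of_injOn J ?_ ?_ (Ideal.finite_setOfPred_absNorm_le Q)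
  · intro x hx
    obtain ⟨h1, h2, h3, h4, h5⟩ := hB x hx
    exact (hJnorm x h1 h4.of_mul_right_left).trans h2
  · intro x hx y hy hxy
    obtain ⟨h1, h2, h3, h4, h5⟩ := hB x hx
    obtain ⟨k1, k2, k3, k4, k5⟩ := hB y hy
    have e1 : (x.1 : ℤ) ∣ y.1 := by
      refine hJint x h5 h4.of_mul_right_left _ ?_
      rw [hxy]
      exact Ideal.subset_span (by simp)
    have e2 : (y.1 : ℤ) ∣ x.1 := by
      refine hJint y k5 k4.of_mul_right_left _ ?_
      rw [← hxy]
      exact Ideal.subset_span (by simp)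
    have e3 : x.1 = y.1 := Nat.dvd_antisymm (by exact_mod_cast e1) (by exact_mod_cast e2)
    have e4 : (x.1 : ℤ) ∣ c * (x.2 - y.2) := by
      refine hJint x h5 h4.of_mul_right_left _ ?_
      have f1 : α - (c : 𝓞 K) * (x.2 : 𝓞 K) ∈ J x := Ideal.subset_span (by simp)
      have f2 : α - (c : 𝓞 K) * (y.2 : 𝓞 K) ∈ J x := hxy ▸ Ideal.subset_span (by simp)
      have f3 := sub_mem f2 f1
      push_cast
      convert f3 using 1
      ring
    have e5 := h4.of_mul_right_right.dvd_of_dvd_mul_left e4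
    have e6 : (x.2 : ℤ) - y.2 = 0 := by
      refine Int.eq_zero_of_abs_lt_dvd e5 ?_
      rw [abs_lt]
      omega
    exact Prod.ext e3 (by omega)

end RootAverage

namespace Polynomial

open Finset in
theorem SepBy.card_roots_prime_dvd_le {g : ℤ[X]} {W : ℤ} (h : SepBy g W) {A : ℕ}
    (hcount : ∀ (Q : ℕ) (B : Finset (ℕ × ℕ)), 0 < Q → (∀ x ∈ B, 0 < x.1 ∧ x.1 ≤ Q ∧ x.2 < x.1 ∧
      IsCoprime (x.1 : ℤ) W ∧ (x.1 : ℤ) ∣ g.eval (x.2 : ℤ)) → B.card ≤ A * Q)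
    {ℓ : ℕ} (hℓ : ℓ.Prime) (hℓW : ¬ (ℓ : ℤ) ∣ W) (Q : ℕ) (B : Finset (ℕ × ℕ))
    (hB : ∀ x ∈ B, 0 < x.1 ∧ x.1 ≤ Q ∧ x.2 < x.1 ∧
      IsCoprime (x.1 : ℤ) W ∧ (x.1 : ℤ) ∣ g.eval (x.2 : ℤ)) (hBℓ : ∀ x ∈ B, ℓ ∣ x.1) :
    B.card * ℓ ≤ g.natDegree * A * Q := by
  classical
  have : Fact ℓ.Prime := ⟨hℓ⟩
  rcases lt_or_ge Q ℓ with hQ | hQ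
  · have : B = ∅ := by
      refine eq_empty_of_forall_notMem fun x hx => ?_
      obtain ⟨h1, h2, -⟩ := hB x hx
      exact absurd (Nat.le_of_dvd h1 (hBℓ x hx)) (by omega)
    simp [this]
  set R := univ.filter fun r : ZMod ℓ => (g.map (Int.castRingHom _)).eval r = 0 with hR
  let φ : ℕ × ℕ → ℕ × ℕ := fun x => (x.1 / ℓ, x.2 % (x.1 / ℓ))
  have hφ : ∀ x ∈ B, 0 < x.1 / ℓ ∧ x.1 = x.1 / ℓ * ℓ := fun x hx =>
    ⟨Nat.div_pos (Nat.le_of_dvd (hB x hx).1 (hBℓ x hx)) hℓ.pos,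
      (Nat.div_mul_cancel (hBℓ x hx)).symm⟩
  have h1 : (B.image φ).card ≤ A * (Q / ℓ) := by
    refine hcount _ _ (Nat.div_pos hQ hℓ.pos) fun y hy => ?_
    obtain ⟨x, hx, rfl⟩ := mem_image.1 hy
    obtain ⟨k1, k2, k3, k4, k5⟩ := hB x hx
    obtain ⟨f1, f2⟩ := hφ x hx
    have hd : ((x.1 / ℓ : ℕ) : ℤ) ∣ x.1 := by
      exact_mod_cast Nat.div_dvd_of_dvd (hBℓ x hx)
    refine ⟨f1, Nat.div_le_div_right k2, Nat.mod_lt _ f1, k4.of_isCoprime_of_dvd_left hd, ?_⟩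
    have hs : ((x.1 / ℓ : ℕ) : ℤ) ∣ g.eval (x.2 : ℤ) - g.eval ((x.2 % (x.1 / ℓ) : ℕ) : ℤ) := by
      refine dvd_trans ?_ (sub_dvd_eval_sub _ _ _)
      exact (Nat.modEq_iff_dvd).1 (Nat.mod_modEq _ _)
    exact (dvd_sub_right (hd.trans k5)).1 hs
  have h2 : B.card ≤ ((B.image φ) ×ˢ R).card := by
    refine card_le_card_of_injOn (fun x => (φ x, (x.2 : ZMod ℓ))) ?_ ?_
    · intro x hx
      have hx : x ∈ B := hx
      simp only [coe_product, Set.mem_prod, mem_coe]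
      refine ⟨mem_image_of_mem _ hx, ?_⟩
      rw [hR, mem_filter]
      refine ⟨mem_univ _, ?_⟩
      have := (ZMod.intCast_zmod_eq_zero_iff_dvd (g.eval (x.2 : ℤ)) ℓ).2
        (dvd_trans (by exact_mod_cast hBℓ x hx) (hB x hx).2.2.2.2)
      rw [← eq_intCast (Int.castRingHom (ZMod ℓ)), ← eval_map_apply] at this
      simpa using this
    · intro x hx y hy hxy
      have hx : x ∈ B := hx
      have hy : y ∈ B := hy
      simp only [Prod.mk.injEq, φ] at hxy
      obtain ⟨⟨e1, e2⟩, e3⟩ := hxy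
      obtain ⟨f1, f2⟩ := hφ x hx
      obtain ⟨-, f3⟩ := hφ y hy
      have e4 : x.1 = y.1 := by rw [f2, f3, e1]
      rw [← e1] at e2
      have c1 : ((x.1 / ℓ : ℕ) : ℤ) ∣ (x.2 : ℤ) - y.2 := Nat.modEq_iff_dvd.1 (Eq.symm e2)
      have c2 : (ℓ : ℤ) ∣ (x.2 : ℤ) - y.2 :=
        Nat.modEq_iff_dvd.1 ((ZMod.natCast_eq_natCast_iff _ _ _).1 e3.symm)
      have c3 : ((x.1 / ℓ : ℕ) : ℤ) * ℓ = x.1 := by exact_mod_cast f2.symm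
      have c4 := h.dvd_sub_of_dvd_eval hℓ hℓW c1 c2 (by rw [c3]; exact (hB x hx).2.2.2.2)
        (by rw [c3, e4]; exact (hB y hy).2.2.2.2)
      rw [c3] at c4
      have l1 := (hB x hx).2.2.1
      have l2 := (hB y hy).2.2.1
      have e6 : (x.2 : ℤ) - y.2 = 0 := by
        refine Int.eq_zero_of_abs_lt_dvd c4 ?_
        rw [abs_lt]
        omega
      exact Prod.ext e4 (by omega)
  rw [card_product] at h2
  have h3 : R.card ≤ g.natDegree := h.card_roots_le hℓW
  calc B.card * ℓ ≤ (A * (Q / ℓ) * g.natDegree) * ℓ := by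
        gcongr
        exact h2.trans (Nat.mul_le_mul h1 h3)
    _ = g.natDegree * A * (Q / ℓ * ℓ) := by ring
    _ ≤ _ := by gcongr; exact Nat.div_mul_le_self _ _

theorem SepBy.isCoprime_of_dvd_bform {g : ℤ[X]} {W : ℤ} (h : SepBy g W) {q : ℕ}
    (hqW : IsCoprime (q : ℤ) W) {m n : ℤ} (hgcd : (Int.gcd m n : ℤ) ∣ W)
    (hb : (q : ℤ) ∣ bform g m n) : IsCoprime (q : ℤ) n := by
  rw [Int.isCoprime_iff_gcd_eq_one]
  change Nat.Coprime (Int.natAbs q) n.natAbs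
  rw [Int.natAbs_natCast]
  refine Nat.coprime_of_dvd fun ℓ hℓ h1 h2 => ?_
  have hℓq : (ℓ : ℤ) ∣ q := by exact_mod_cast h1
  have hℓn : (ℓ : ℤ) ∣ n := Int.natCast_dvd.2 h2
  have hℓW : ¬ (ℓ : ℤ) ∣ W := fun h3 => by
    have := hqW.isUnit_of_dvd' hℓq h3
    exact hℓ.one_lt.ne' (by simpa using Int.isUnit_iff_natAbs_eq.1 this)
  have hm := h.dvd_of_dvd_bform hℓ hℓW hℓn (hℓq.trans hb)
  exact hℓW ((Int.dvd_coe_gcd hm hℓn).trans hgcd)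

theorem dvd_eval_of_dvd_bform {g : ℤ[X]} {q : ℕ} {m n r : ℤ} (hqn : IsCoprime (q : ℤ) n)
    (hr : (q : ℤ) ∣ m - r * n) (hb : (q : ℤ) ∣ bform g m n) : (q : ℤ) ∣ g.eval r := by
  have h3 : (q : ℤ) ∣ bform g (r * n) n := by
    have h4 : ((bform g m n : ℤ) : ZMod q) = ((bform g (r * n) n : ℤ) : ZMod q) := by
      have e1 := map_bform (Int.castRingHom (ZMod q)) g m n
      have e2 := map_bform (Int.castRingHom (ZMod q)) g (r * n) n
      simp only [eq_intCast] at e1 e2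
      rw [e1, e2]
      congr 1
      exact ((ZMod.intCast_eq_intCast_iff_dvd_sub _ _ _).2 (dvd_sub_comm.1 hr))
    rw [← ZMod.intCast_zmod_eq_zero_iff_dvd, ← h4, ZMod.intCast_zmod_eq_zero_iff_dvd]
    exact hb
  rw [bform_mul_right] at h3
  have h6 := (hqn.pow_right (n := g.natDegree)).dvd_of_dvd_mul_left h3
  rwa [eval₂_eq_eval_map, show Int.castRingHom ℤ = RingHom.id ℤ from RingHom.ext_int _ _,
    map_id] at h6

theorem exists_root_of_dvd_bform {g : ℤ[X]} {q : ℕ} (hq : 0 < q) {m n : ℤ}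
    (hqn : IsCoprime (q : ℤ) n) (hb : (q : ℤ) ∣ bform g m n) :
    ∃ r : ℕ, r < q ∧ (q : ℤ) ∣ g.eval (r : ℤ) ∧ (q : ℤ) ∣ m - r * n := by
  obtain ⟨u, v, huv⟩ := id hqn
  have hq' : (0 : ℤ) < q := by exact_mod_cast hq
  set r := (m * v) % q with hr
  have hr0 := Int.emod_nonneg (m * v) hq'.ne'
  have hr1 := Int.emod_lt_of_pos (m * v) hq'
  have hrr : (r.toNat : ℤ) = r := Int.toNat_of_nonneg hr0
  have hd : (q : ℤ) ∣ m - r * n := by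
    have h1 : (q : ℤ) ∣ m * v - r := Int.dvd_self_sub_emod
    have h2 : m - r * n = n * (m * v - r) + m * u * q := by linear_combination (-m) * huv
    rw [h2]
    exact dvd_add (h1.mul_left _) (Dvd.intro_left _ rfl)
  refine ⟨r.toNat, by omega, ?_, by rwa [hrr]⟩
  rw [hrr]
  exact dvd_eval_of_dvd_bform hqn hd hb

end Polynomial

theorem exists_primes_card_eq (a k : ℕ) : ∃ P : Finset ℕ,
    (∀ ℓ ∈ P, ℓ.Prime ∧ 2 ^ a < ℓ ∧ ℓ ≤ 2 ^ (a + k)) ∧ P.card = k := by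
  induction k with
  | zero => exact ⟨∅, by simp⟩
  | succ k ih =>
    obtain ⟨P, hP, hPk⟩ := ih
    obtain ⟨ℓ, hℓ, h1, h2⟩ := Nat.exists_prime_lt_and_le_two_mul (2 ^ (a + k)) (by positivity)
    have hn : ℓ ∉ P := fun h => absurd (hP ℓ h).2.2 (by omega)
    refine ⟨insert ℓ P, fun x hx => ?_, by rw [Finset.card_insert_of_notMem hn, hPk]⟩
    have e1 : 2 ^ (a + (k + 1)) = 2 * 2 ^ (a + k) := by ring
    have e2 : 2 ^ a ≤ 2 ^ (a + k) := Nat.pow_le_pow_right (by norm_num) (by omega)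
    rcases Finset.mem_insert.1 hx with rfl | hx
    · exact ⟨hℓ, by omega, by omega⟩
    · obtain ⟨k1, k2, k3⟩ := hP x hx
      exact ⟨k1, k2, by omega⟩

theorem exists_sieving_primes (G : ℕ) : ∃ J : ℕ, 0 < J ∧ ∀ j, J ≤ j → ∃ (P : Finset ℕ) (lam : ℕ),
    0 < lam ∧ (∀ ℓ ∈ P, ℓ.Prime ∧ 2000 ≤ ℓ ∧ G < ℓ ∧ lam ≤ ℓ) ∧ (∏ ℓ ∈ P, ℓ) ^ 2 ≤ 2 ^ j ∧
    ((3 / 4 : ℝ) ^ P.card + P.card / lam ≤ 24 / (j : ℝ) ^ 2) ∧ j ^ 2 ≤ 2 ^ j := by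
  refine ⟨2 ^ (15 + G), by positivity, fun j hj => ?_⟩
  have hj0 : j ≠ 0 := by
    have : 0 < 2 ^ (15 + G) := by positivity
    omega
  set i := Nat.log 2 j with hi
  have hi1 : 15 + G ≤ i := Nat.le_log_of_pow_le (by norm_num) hj
  have hi2 : 2 ^ i ≤ j := Nat.pow_log_le_self 2 hj0
  have hi3 : j < 2 ^ (i + 1) := Nat.lt_pow_succ_log_self (by norm_num) j
  obtain ⟨P, hP, hPk⟩ := exists_primes_card_eq (4 * i) (5 * i)
  have h90 : 90 * i ^ 2 ≤ 2 ^ i := by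
    have : ∀ n, 15 ≤ n → 90 * n ^ 2 ≤ 2 ^ n := by
      intro n hn
      induction n, hn using Nat.le_induction with
      | base => norm_num
      | succ n hn ih => rw [pow_succ 2 n]; nlinarith
    exact this i (by omega)
  have hbig : 2 ^ (15 + G) ≤ 2 ^ (4 * i) := Nat.pow_le_pow_right (by norm_num) (by omega)
  have hG : G < 2 ^ G := Nat.lt_two_pow_self
  rw [pow_add] at hbig
  refine ⟨P, 2 ^ (4 * i), by positivity, fun ℓ hℓ => ?_, ?_, ?_, ?_⟩
  · obtain ⟨h1, h2, h3⟩ := hP ℓ hℓ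
    refine ⟨h1, ?_, ?_, h2.le⟩
    · have : 1 ≤ 2 ^ G := Nat.one_le_two_pow
      omega
    · omega
  · have h1 : ∏ ℓ ∈ P, ℓ ≤ (2 ^ (4 * i + 5 * i)) ^ P.card :=
      Finset.prod_le_pow_card _ _ _ fun ℓ hℓ => (hP ℓ hℓ).2.2
    calc (∏ ℓ ∈ P, ℓ) ^ 2 ≤ ((2 ^ (4 * i + 5 * i)) ^ P.card) ^ 2 := by gcongr
      _ = 2 ^ (90 * i ^ 2) := by rw [hPk, ← pow_mul, ← pow_mul]; congr 1; ring
      _ ≤ 2 ^ j := Nat.pow_le_pow_right (by norm_num) (h90.trans hi2)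
  · rw [hPk]
    have h1 : (3 / 4 : ℝ) ^ (5 * i) ≤ (1 / 4) ^ i := by
      rw [pow_mul]
      gcongr
      norm_num
    have h2 : ((5 * i : ℕ) : ℝ) / (2 ^ (4 * i) : ℕ) ≤ 5 * (1 / 4) ^ i := by
      have h3 : (i : ℝ) ≤ 4 ^ i := by exact_mod_cast (Nat.lt_pow_self (by norm_num)).le
      have h4 : ((2 ^ (4 * i) : ℕ) : ℝ) = 4 ^ i * 4 ^ i := by
        push_cast
        rw [pow_mul, ← mul_pow]
        norm_num
      rw [h4, div_le_iff₀ (by positivity), div_pow, one_pow]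
      have : 5 * (1 / (4 : ℝ) ^ i) * (4 ^ i * 4 ^ i) = 5 * 4 ^ i := by field_simp
      rw [this]
      push_cast
      linarith
    have h5 : (j : ℝ) ^ 2 ≤ 4 * 4 ^ i := by
      have : (j : ℝ) ≤ 2 * 2 ^ i := by
        have : j ≤ 2 * 2 ^ i := by rw [pow_succ] at hi3; omega
        exact_mod_cast this
      calc (j : ℝ) ^ 2 ≤ (2 * 2 ^ i) ^ 2 := by gcongr
        _ = 4 * 4 ^ i := by rw [mul_pow, ← pow_mul, mul_comm i 2, pow_mul]; norm_num
    have hj0' : (0 : ℝ) < j := by exact_mod_cast Nat.pos_of_ne_zero hj0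
    calc _ ≤ (1 / 4 : ℝ) ^ i + 5 * (1 / 4) ^ i := add_le_add h1 h2
      _ = 6 / 4 ^ i := by rw [div_pow, one_pow]; ring
      _ ≤ 24 / (j : ℝ) ^ 2 := by
        rw [div_le_div_iff₀ (by positivity) (by positivity)]
        linarith
  · have h15 : 15 ≤ j := by
      have : i < 2 ^ i := Nat.lt_two_pow_self
      omega
    have : ∀ n, 4 ≤ n → n ^ 2 ≤ 2 ^ n := by
      intro n hn
      induction n, hn using Nat.le_induction with
      | base => norm_num
      | succ n hn ih => rw [pow_succ 2 n]; nlinarith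
    exact this j (by omega)

namespace Polynomial

theorem SepBy.card_fibre_le {g : ℤ[X]} {W : ℤ} (h : SepBy g W) (hW0 : W ≠ 0)
    (h5 : 5 ≤ g.natDegree) (h6 : g.natDegree ≤ 6) {q X lam : ℕ} (hq : 0 < q) (r E : ℤ)
    (hE : E ∣ W) (S : Finset (ℤ × ℤ)) (hS : ∀ v ∈ S, |v.1| ≤ X ∧ |v.2| ≤ X ∧
      (Int.gcd v.1 v.2 : ℤ) ∣ W ∧ (q : ℤ) ∣ v.1 - r * v.2 ∧ ∃ y : ℤ, bform g v.1 v.2 = E * q * y ^ 2)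
    (P : Finset ℕ) (hP : ∀ ℓ ∈ P, ℓ.Prime ∧ 2000 ≤ ℓ ∧ W.natAbs < ℓ ∧ lam ≤ ℓ) (hlam : 0 < lam)
    (hPq : ∀ ℓ ∈ P, ¬ ℓ ∣ q) (hL : (∏ ℓ ∈ P, ℓ) ^ 2 * q ≤ X ^ 2) :
    (S.card : ℝ) ≤ 2 * W.natAbs + 1 + 24 * (X ^ 2 / q) * ((3 / 4) ^ P.card + P.card / lam) := by
  have hPW : ∀ ℓ ∈ P, ¬ (ℓ : ℤ) ∣ W := fun ℓ hℓ hd => by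
    have := Nat.le_of_dvd (Int.natAbs_pos.2 hW0) (Int.natCast_dvd.1 hd)
    exact absurd (hP ℓ hℓ).2.2.1 (by omega)
  refine lattice_sieve r hq S (fun v hv => ⟨(hS v hv).1, (hS v hv).2.1⟩) (fun v hv => ?_)
    (fun v hv => (hS v hv).2.2.2.1) P (fun ℓ hℓ => (hP ℓ hℓ).1) hPq hL
    (fun ℓ x y => IsSquare (((E * q : ℤ) : ZMod ℓ) * bform g x y)) ?_ ?_ hlam
    (fun ℓ hℓ => (hP ℓ hℓ).2.2.2)
  · have h1 := Int.natCast_dvd.1 (hS v hv).2.2.1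
    exact ⟨Nat.pos_of_dvd_of_pos h1 (Int.natAbs_pos.2 hW0),
      Nat.le_of_dvd (Int.natAbs_pos.2 hW0) h1⟩
  · intro ℓ hℓ v hv
    obtain ⟨y, hy⟩ := (hS v hv).2.2.2.2
    have e1 := map_bform (Int.castRingHom (ZMod ℓ)) g v.1 v.2
    simp only [eq_intCast] at e1
    rw [← e1, hy]
    exact ⟨(E * q * y : ℤ), by push_cast; ring⟩
  · intro ℓ hℓ w₁ w₂ v₁ v₂ hw
    have : Fact ℓ.Prime := ⟨(hP ℓ hℓ).1⟩
    have hu : ((E * q : ℤ) : ZMod ℓ) ≠ 0 := by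
      rw [Ne, ZMod.intCast_zmod_eq_zero_iff_dvd]
      intro hd
      rcases (Nat.prime_iff_prime_int.1 (hP ℓ hℓ).1).dvd_or_dvd hd with hd | hd
      · exact hPW ℓ hℓ (hd.trans hE)
      · exact hPq ℓ hℓ (by exact_mod_cast hd)
    have := h.card_isSquare_bform_le (hP ℓ hℓ).2.1 (hPW ℓ hℓ) h5 h6 hu hw
    convert this using 2
    rw [Nat.card_coe_set_eq, ← Set.ncard_coe_finset, Finset.coe_filter]
    simp

end Polynomial

namespace Polynomial

open Finset in
theorem SepBy.card_block_le {g : ℤ[X]} {W : ℤ} (h : SepBy g W) (hW0 : W ≠ 0)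
    (h5 : 5 ≤ g.natDegree) (h6 : g.natDegree ≤ 6) {A : ℕ}
    (hcount : ∀ (Q : ℕ) (B : Finset (ℕ × ℕ)), 0 < Q → (∀ x ∈ B, 0 < x.1 ∧ x.1 ≤ Q ∧ x.2 < x.1 ∧
      IsCoprime (x.1 : ℤ) W ∧ (x.1 : ℤ) ∣ g.eval (x.2 : ℤ)) → B.card ≤ A * Q) :
    ∃ (K : ℝ) (J : ℕ), 0 < K ∧ 0 < J ∧ ∀ j, J ≤ j → ∀ (X : ℕ) (S : Finset (ℤ × ℤ)),
      (∀ v ∈ S, |v.1| ≤ X ∧ |v.2| ≤ X ∧ (Int.gcd v.1 v.2 : ℤ) ∣ W ∧ ∃ (E y : ℤ) (q : ℕ),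
        E ∣ W ∧ IsCoprime (q : ℤ) W ∧ 0 < q ∧ bform g v.1 v.2 = E * q * y ^ 2 ∧
        q * 2 ^ j ≤ X ^ 2 ∧ X ^ 2 < q * 2 ^ (j + 1)) →
      (S.card : ℝ) ≤ K * X ^ 2 / j ^ 2 := by
  classical
  set G := W.natAbs with hG
  obtain ⟨J, hJ0, hJ⟩ := exists_sieving_primes G
  refine ⟨(2 * G + 1) * A * (2 * G + 1 + 8064) + 1, J, by positivity, hJ0, fun j hj X S hS => ?_⟩
  obtain ⟨P, lam, hlam, hP, hPL, hδ, hj2⟩ := hJ j hj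
  set δ : ℝ := (3 / 4 : ℝ) ^ P.card + P.card / lam with hδdef
  have hj0 : (0 : ℝ) < j := by exact_mod_cast hJ0.trans_le hj
  have hPW : ∀ ℓ ∈ P, ¬ (ℓ : ℤ) ∣ W := fun ℓ hℓ hd => by
    have := Nat.le_of_dvd (Int.natAbs_pos.2 hW0) (Int.natCast_dvd.1 hd)
    exact absurd (hP ℓ hℓ).2.2.1 (by omega)
  rcases S.eq_empty_or_nonempty with rfl | ⟨v₀, hv₀⟩
  · simp only [card_empty, Nat.cast_zero]
    positivity
  have hS' : ∀ v : ℤ × ℤ, ∃ (τ : ℤ × (ℕ × ℕ)), v ∈ S → τ.1 ∣ W ∧ IsCoprime (τ.2.1 : ℤ) W ∧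
      0 < τ.2.1 ∧ (∃ y : ℤ, bform g v.1 v.2 = τ.1 * τ.2.1 * y ^ 2) ∧ τ.2.1 * 2 ^ j ≤ X ^ 2 ∧
      X ^ 2 < τ.2.1 * 2 ^ (j + 1) ∧ τ.2.2 < τ.2.1 ∧ (τ.2.1 : ℤ) ∣ g.eval (τ.2.2 : ℤ) ∧
      (τ.2.1 : ℤ) ∣ v.1 - τ.2.2 * v.2 := by
    intro v
    by_cases hv : v ∈ S
    · obtain ⟨-, -, hgcd, E, y, q, h1, h2, h3, h4, h5, h6⟩ := hS v hv
      have hd : (q : ℤ) ∣ bform g v.1 v.2 := by rw [h4]; exact ⟨E * y ^ 2, by ring⟩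
      obtain ⟨r, hr1, hr2, hr3⟩ := exists_root_of_dvd_bform h3
        (h.isCoprime_of_dvd_bform h2 hgcd hd) hd
      exact ⟨(E, q, r), fun _ => ⟨h1, h2, h3, ⟨y, h4⟩, h5, h6, hr1, hr2, hr3⟩⟩
    · exact ⟨0, fun h => absurd h hv⟩
  choose τ hτ using hS'
  set Q := X ^ 2 / 2 ^ j with hQdef
  have hQle : ∀ q, q * 2 ^ j ≤ X ^ 2 → q ≤ Q := fun q hq =>
    (Nat.le_div_iff_mul_le (by positivity)).2 hq
  have hQ0 : 0 < Q := (hτ v₀ hv₀).2.2.1.trans_le (hQle _ (hτ v₀ hv₀).2.2.2.2.1)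
  have hQX : (Q : ℝ) * 2 ^ j ≤ X ^ 2 := by exact_mod_cast Nat.div_mul_le_self (X ^ 2) (2 ^ j)
  have hQj : (Q : ℝ) ≤ X ^ 2 / j ^ 2 := by
    rw [le_div_iff₀ (by positivity)]
    refine le_trans ?_ hQX
    gcongr
    exact_mod_cast hj2
  set B : Finset (ℕ × ℕ) := S.image fun v => (τ v).2 with hBdef
  have hB : ∀ x ∈ B, 0 < x.1 ∧ x.1 ≤ Q ∧ x.2 < x.1 ∧
      IsCoprime (x.1 : ℤ) W ∧ (x.1 : ℤ) ∣ g.eval (x.2 : ℤ) := by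
    intro x hx
    obtain ⟨v, hv, rfl⟩ := mem_image.1 hx
    obtain ⟨h1, h2, h3, h4, h5, h6, h7, h8, h9⟩ := hτ v hv
    exact ⟨h3, hQle _ h5, h7, h2, h8⟩
  set B' := B.filter fun x => ∃ ℓ ∈ P, ℓ ∣ x.1 with hB'def
  have hBcard : (B.card : ℝ) ≤ A * Q := by exact_mod_cast hcount Q B hQ0 hB
  have hB'card : (B'.card : ℝ) ≤ 6 * A * Q * δ := by
    have h1 : B' ⊆ P.biUnion fun ℓ => B.filter fun x => ℓ ∣ x.1 := by
      intro x hx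
      obtain ⟨hx, ℓ, hℓ, hd⟩ := mem_filter.1 hx
      exact mem_biUnion.2 ⟨ℓ, hℓ, mem_filter.2 ⟨hx, hd⟩⟩
    have h2 : ∀ ℓ ∈ P, ((B.filter fun x => ℓ ∣ x.1).card : ℝ) ≤ 6 * A * Q / lam := by
      intro ℓ hℓ
      have h3 := h.card_roots_prime_dvd_le hcount (hP ℓ hℓ).1 (hPW ℓ hℓ) Q
        (B.filter fun x => ℓ ∣ x.1) (fun x hx => hB x (mem_filter.1 hx).1)
        (fun x hx => (mem_filter.1 hx).2)
      rw [le_div_iff₀ (by exact_mod_cast hlam)]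
      have h4 : (B.filter fun x => ℓ ∣ x.1).card * lam ≤ 6 * A * Q :=
        calc _ ≤ (B.filter fun x => ℓ ∣ x.1).card * ℓ := by gcongr; exact (hP ℓ hℓ).2.2.2
          _ ≤ _ := h3
          _ ≤ _ := by gcongr
      exact_mod_cast h4
    calc (B'.card : ℝ) ≤ ∑ ℓ ∈ P, ((B.filter fun x => ℓ ∣ x.1).card : ℝ) := by
          exact_mod_cast (card_le_card h1).trans card_biUnion_le
      _ ≤ ∑ ℓ ∈ P, (6 * A * Q / lam : ℝ) := sum_le_sum h2
      _ = 6 * A * Q * (P.card / lam) := by rw [sum_const, nsmul_eq_mul]; ring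
      _ ≤ 6 * A * Q * δ := by
        gcongr
        rw [hδdef]
        exact le_add_of_nonneg_left (by positivity)
  have hfib : ∀ σ ∈ S.image τ, ((S.filter fun v => τ v = σ).card : ℝ) ≤
      2 * G + 1 + 48 * 2 ^ j * (δ + if σ.2 ∈ B' then 1 else 0) := by
    intro σ hσ
    obtain ⟨v, hv, rfl⟩ := mem_image.1 hσ
    have hσB : (τ v).2 ∈ B := mem_image_of_mem _ hv
    obtain ⟨f1, f2, f3, f4, f5, f6, f7, f8, f9⟩ := hτ v hv
    have hf3 : (0 : ℝ) < (τ v).2.1 := by exact_mod_cast f3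
    have hXq : (X : ℝ) ^ 2 / (τ v).2.1 ≤ 2 * 2 ^ j := by
      rw [div_le_iff₀ hf3]
      have : (X : ℝ) ^ 2 ≤ (τ v).2.1 * 2 ^ (j + 1) := by exact_mod_cast f6.le
      calc _ ≤ _ := this
        _ = _ := by ring
    have hS₁ : ∀ w ∈ S.filter fun w => τ w = τ v, |w.1| ≤ X ∧ |w.2| ≤ X ∧
        (Int.gcd w.1 w.2 : ℤ) ∣ W ∧ ((τ v).2.1 : ℤ) ∣ w.1 - (τ v).2.2 * w.2 ∧
        ∃ y : ℤ, bform g w.1 w.2 = (τ v).1 * (τ v).2.1 * y ^ 2 := by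
      intro w hw
      obtain ⟨hw, hwv⟩ := mem_filter.1 hw
      obtain ⟨k1, k2, k3, -⟩ := hS w hw
      obtain ⟨-, -, -, k4, -, -, -, -, k5⟩ := hτ w hw
      rw [hwv] at k4 k5
      exact ⟨k1, k2, k3, k5, k4⟩
    by_cases hb : (τ v).2 ∈ B'
    · rw [if_pos hb]
      have h1 := h.card_fibre_le hW0 h5 h6 (lam := 1) f3 (τ v).2.2 (τ v).1 f1 _ hS₁ ∅ (by simp)
        one_pos (by simp) (by
          rw [prod_empty, one_pow, one_mul]
          exact (Nat.le_mul_of_pos_right _ (by positivity)).trans f5)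
      simp only [card_empty, pow_zero, Nat.cast_zero, zero_div, add_zero, mul_one] at h1
      have hδ0 : 0 ≤ δ := by positivity
      calc _ ≤ _ := h1
        _ ≤ 2 * G + 1 + 24 * (2 * 2 ^ j) := by gcongr
        _ = 2 * G + 1 + 48 * 2 ^ j * (0 + 1) := by ring
        _ ≤ _ := by gcongr
    · rw [if_neg hb, add_zero]
      have h1 := h.card_fibre_le hW0 h5 h6 f3 (τ v).2.2 (τ v).1 f1 _ hS₁ P hP hlam
        (fun ℓ hℓ hd => hb (mem_filter.2 ⟨hσB, ℓ, hℓ, hd⟩)) (by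
          calc _ ≤ 2 ^ j * (τ v).2.1 := by gcongr
            _ ≤ X ^ 2 := by rwa [mul_comm])
      calc _ ≤ _ := h1
        _ ≤ 2 * G + 1 + 24 * (2 * 2 ^ j) * δ := by gcongr
        _ = _ := by ring
  have hT : S.image τ ⊆ Icc (-(G : ℤ)) G ×ˢ B := by
    intro σ hσ
    obtain ⟨v, hv, rfl⟩ := mem_image.1 hσ
    refine mem_product.2 ⟨?_, mem_image_of_mem _ hv⟩
    have h1 := Nat.le_of_dvd (Int.natAbs_pos.2 hW0) (Int.natAbs_dvd_natAbs.2 (hτ v hv).1)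
    rw [mem_Icc]
    omega
  have hIcc : ((Icc (-(G : ℤ)) G).card : ℝ) = 2 * G + 1 := by
    rw [Int.card_Icc]
    have : ((G : ℤ) + 1 - -G).toNat = 2 * G + 1 := by omega
    rw [this]
    push_cast
    ring
  have hδ0 : 0 ≤ δ := by positivity
  have hprod : ∀ f : ℕ × ℕ → ℝ, ∑ σ ∈ Icc (-(G : ℤ)) G ×ˢ B, f σ.2 =
      (Icc (-(G : ℤ)) G).card * ∑ x ∈ B, f x := fun f => by
    rw [sum_product]
    dsimp only
    rw [sum_const, nsmul_eq_mul]
  calc (S.card : ℝ) = ∑ σ ∈ S.image τ, ((S.filter fun v => τ v = σ).card : ℝ) := by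
        exact_mod_cast card_eq_sum_card_image τ S
    _ ≤ ∑ σ ∈ S.image τ, (2 * G + 1 + 48 * 2 ^ j * (δ + if σ.2 ∈ B' then 1 else 0) : ℝ) :=
        sum_le_sum hfib
    _ ≤ ∑ σ ∈ Icc (-(G : ℤ)) G ×ˢ B,
          (2 * G + 1 + 48 * 2 ^ j * (δ + if σ.2 ∈ B' then 1 else 0) : ℝ) := by
        refine sum_le_sum_of_subset_of_nonneg hT fun σ _ _ => ?_
        split_ifs <;> positivity
    _ = (2 * G + 1) * (B.card * (2 * G + 1 + 48 * 2 ^ j * δ) + 48 * 2 ^ j * B'.card) := by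
        refine (hprod fun x => 2 * G + 1 + 48 * 2 ^ j * (δ + if x ∈ B' then 1 else 0)).trans ?_
        rw [hIcc]
        congr 1
        simp only [mul_add, sum_add_distrib, ← mul_sum, sum_ite_mem, sum_const, nsmul_eq_mul]
        rw [inter_eq_right.2 (filter_subset _ _)]
        ring
    _ ≤ (2 * G + 1) * ((A * Q) * (2 * G + 1 + 48 * 2 ^ j * δ) + 48 * 2 ^ j * (6 * A * Q * δ)) := by
        gcongr
    _ = (2 * G + 1) * A * ((2 * G + 1) * Q + 336 * δ * (Q * 2 ^ j)) := by ring
    _ ≤ (2 * G + 1) * A * ((2 * G + 1) * (X ^ 2 / j ^ 2) + 336 * (24 / j ^ 2) * X ^ 2) := by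
        gcongr
    _ = (2 * G + 1) * A * (2 * G + 1 + 8064) * X ^ 2 / j ^ 2 := by ring
    _ ≤ _ := by gcongr; linarith

end Polynomial

theorem exists_primeCounting_le (ε : ℝ) (hε : 0 < ε) : ∃ N : ℕ, ∀ n, N ≤ n →
    (n.primeCounting : ℝ) ≤ ε * n := by
  have h1 : Filter.Tendsto (fun x : ℝ => Real.log 4 / Real.log √x + √x / x) Filter.atTop
      (nhds (0 + 0)) := by
    refine Filter.Tendsto.add ?_ ?_
    · refine Filter.Tendsto.const_div_atTop ?_ _
      exact Real.tendsto_log_atTop.comp Real.tendsto_sqrt_atTop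
    · simp_rw [Real.sqrt_div_self']
      exact Filter.Tendsto.const_div_atTop Real.tendsto_sqrt_atTop _
  rw [add_zero] at h1
  have h2 := (h1.comp tendsto_natCast_atTop_atTop).eventually (gt_mem_nhds hε)
  obtain ⟨N, hN⟩ := Filter.eventually_atTop.1 h2
  refine ⟨N + 2, fun n hn => ?_⟩
  have h3 := Chebyshev.pi_le_log4_mul_div (x := n) (by exact_mod_cast (by omega : 1 < n))
  rw [Nat.floor_natCast] at h3
  have hn0 : (0 : ℝ) < n := by exact_mod_cast (by omega : 0 < n)
  have h4 := (hN n (by omega)).le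
  simp only [Function.comp] at h4
  calc _ ≤ _ := h3
    _ = (Real.log 4 / Real.log √n + √n / n) * n := by field_simp
    _ ≤ _ := by gcongr

namespace Polynomial

open Finset in
theorem SepBy.card_sq_mul_small_le {g : ℤ[X]} {W : ℤ} (h : SepBy g W) (hW0 : W ≠ 0)
    (h5 : 5 ≤ g.natDegree) (h6 : g.natDegree ≤ 6) {A : ℕ}
    (hcount : ∀ (Q : ℕ) (B : Finset (ℕ × ℕ)), 0 < Q → (∀ x ∈ B, 0 < x.1 ∧ x.1 ≤ Q ∧ x.2 < x.1 ∧
      IsCoprime (x.1 : ℤ) W ∧ (x.1 : ℤ) ∣ g.eval (x.2 : ℤ)) → B.card ≤ A * Q)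
    (ε : ℝ) (hε : 0 < ε) : ∃ J : ℕ, ∀ (X : ℕ) (S : Finset (ℤ × ℤ)),
      (∀ v ∈ S, |v.1| ≤ X ∧ |v.2| ≤ X ∧ (Int.gcd v.1 v.2 : ℤ) ∣ W ∧ ∃ (E y : ℤ) (q : ℕ),
        E ∣ W ∧ IsCoprime (q : ℤ) W ∧ 0 < q ∧ bform g v.1 v.2 = E * q * y ^ 2 ∧
        q * 2 ^ J ≤ X ^ 2) → (S.card : ℝ) ≤ ε * X ^ 2 := by
  classical
  obtain ⟨K, J₀, hK, hJ₀, hblock⟩ := h.card_block_le hW0 h5 h6 hcount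
  obtain ⟨J₁, hJ₁⟩ := exists_nat_ge (2 * K / ε)
  refine ⟨J₀ + J₁ + 1, fun X S hS => ?_⟩
  set T : ℕ → Finset (ℤ × ℤ) := fun j => S.filter fun v => ∃ (E y : ℤ) (q : ℕ),
        E ∣ W ∧ IsCoprime (q : ℤ) W ∧ 0 < q ∧ bform g v.1 v.2 = E * q * y ^ 2 ∧
        q * 2 ^ j ≤ X ^ 2 ∧ X ^ 2 < q * 2 ^ (j + 1) with hT
  have hsub : S ⊆ (Ioo (J₀ + J₁) (X ^ 2 + 1)).biUnion T := by
    intro v hv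
    obtain ⟨-, -, -, E, y, q, e1, e2, e3, e4, e5⟩ := hS v hv
    have hq : X ^ 2 / q ≠ 0 := by
      have : 0 < X ^ 2 / q := Nat.div_pos ((Nat.le_mul_of_pos_right _ (by positivity)).trans e5) e3
      omega
    have e6 : J₀ + J₁ + 1 ≤ Nat.log 2 (X ^ 2 / q) :=
      Nat.le_log_of_pow_le (by norm_num) ((Nat.le_div_iff_mul_le e3).2 (by rwa [mul_comm]))
    have e7 : 2 ^ Nat.log 2 (X ^ 2 / q) ≤ X ^ 2 / q := Nat.pow_log_le_self 2 hq
    have e8 : X ^ 2 / q < 2 ^ (Nat.log 2 (X ^ 2 / q) + 1) := Nat.lt_pow_succ_log_self (by norm_num) _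
    have e9 : Nat.log 2 (X ^ 2 / q) < 2 ^ Nat.log 2 (X ^ 2 / q) := Nat.lt_two_pow_self
    have e10 : X ^ 2 / q ≤ X ^ 2 := Nat.div_le_self _ _
    refine mem_biUnion.2 ⟨Nat.log 2 (X ^ 2 / q), mem_Ioo.2 ⟨by omega, by omega⟩,
      mem_filter.2 ⟨hv, E, y, q, e1, e2, e3, e4, ?_, ?_⟩⟩
    · rw [mul_comm]
      exact (Nat.le_div_iff_mul_le e3).1 e7
    · rw [mul_comm]
      exact (Nat.div_lt_iff_lt_mul e3).1 e8
  have hTj : ∀ j ∈ Ioo (J₀ + J₁) (X ^ 2 + 1), ((T j).card : ℝ) ≤ K * X ^ 2 / j ^ 2 := by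
    intro j hj
    rw [mem_Ioo] at hj
    refine hblock j (by omega) X (T j) fun v hv => ?_
    obtain ⟨hv, hv'⟩ := mem_filter.1 hv
    obtain ⟨k1, k2, k3, -⟩ := hS v hv
    exact ⟨k1, k2, k3, hv'⟩
  calc (S.card : ℝ) ≤ ∑ j ∈ Ioo (J₀ + J₁) (X ^ 2 + 1), ((T j).card : ℝ) := by
        exact_mod_cast (card_le_card hsub).trans card_biUnion_le
    _ ≤ ∑ j ∈ Ioo (J₀ + J₁) (X ^ 2 + 1), K * X ^ 2 / j ^ 2 := sum_le_sum hTj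
    _ = K * X ^ 2 * ∑ j ∈ Ioo (J₀ + J₁) (X ^ 2 + 1), ((j : ℝ) ^ 2)⁻¹ := by
        rw [mul_sum]
        simp_rw [div_eq_mul_inv]
    _ ≤ K * X ^ 2 * (2 / ((J₀ + J₁ : ℕ) + 1)) := by
        gcongr
        exact sum_Ioo_inv_sq_le _ _
    _ = (2 * K / ((J₀ + J₁ : ℕ) + 1)) * X ^ 2 := by ring
    _ ≤ ε * X ^ 2 := by
        gcongr
        rw [div_le_iff₀ (by positivity)]
        rw [div_le_iff₀ hε] at hJ₁
        push_cast
        nlinarith [mul_nonneg hε.le (Nat.cast_nonneg (α := ℝ) J₀)]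

open Finset in
theorem SepBy.card_roots_sq_le {g : ℤ[X]} {W : ℤ} (h : SepBy g W) {p : ℕ} (hp : p.Prime)
    (hpW : ¬ (p : ℤ) ∣ W) (R : Finset ℕ)
    (hR : ∀ r ∈ R, r < p ^ 2 ∧ (p : ℤ) ^ 2 ∣ g.eval (r : ℤ)) : R.card ≤ g.natDegree := by
  have : Fact p.Prime := ⟨hp⟩
  refine le_trans ?_ (h.card_roots_le hpW)
  refine card_le_card_of_injOn (fun r => (r : ZMod p)) ?_ ?_
  · intro r hr
    rw [mem_coe, mem_filter]
    refine ⟨mem_univ _, ?_⟩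
    have := (ZMod.intCast_zmod_eq_zero_iff_dvd (g.eval (r : ℤ)) p).2
      (dvd_trans (dvd_pow_self _ two_ne_zero) (hR r hr).2)
    rw [← eq_intCast (Int.castRingHom (ZMod p)), ← eval_map_apply] at this
    simpa using this
  · intro r hr s hs hrs
    have c1 : (p : ℤ) ∣ (r : ℤ) - s :=
      Nat.modEq_iff_dvd.1 ((ZMod.natCast_eq_natCast_iff _ _ _).1 hrs.symm)
    have c3 := h.dvd_sub_of_dvd_eval hp hpW c1 c1 (by rw [← sq]; exact (hR r hr).2)
      (by rw [← sq]; exact (hR s hs).2)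
    have l1 : (r : ℤ) < p * p := by
      rw [← sq]
      exact_mod_cast (hR r hr).1
    have l2 : (s : ℤ) < p * p := by
      rw [← sq]
      exact_mod_cast (hR s hs).1
    have e6 : (r : ℤ) - s = 0 := by
      refine Int.eq_zero_of_abs_lt_dvd c3 ?_
      rw [abs_lt]
      constructor <;> linarith [Int.natCast_nonneg r, Int.natCast_nonneg s]
    omega

open Finset in
theorem SepBy.card_prime_sq_dvd_le {g : ℤ[X]} {W : ℤ} (h : SepBy g W) (hW0 : W ≠ 0)
    {p X : ℕ} (hp : p.Prime) (hpW : ¬ (p : ℤ) ∣ W) (hXp : X ≤ p) (S : Finset (ℤ × ℤ))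
    (hS : ∀ v ∈ S, |v.1| ≤ X ∧ |v.2| ≤ X ∧ (Int.gcd v.1 v.2 : ℤ) ∣ W ∧
      (p : ℤ) ^ 2 ∣ bform g v.1 v.2) :
    S.card ≤ g.natDegree * (2 * W.natAbs + 25) := by
  classical
  have hcop : IsCoprime ((p ^ 2 : ℕ) : ℤ) W := by
    push_cast
    exact ((Nat.prime_iff_prime_int.1 hp).coprime_iff_not_dvd.2 hpW).pow_left
  have hex : ∀ v : ℤ × ℤ, ∃ r : ℕ, v ∈ S → r < p ^ 2 ∧ ((p ^ 2 : ℕ) : ℤ) ∣ g.eval (r : ℤ) ∧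
      ((p ^ 2 : ℕ) : ℤ) ∣ v.1 - r * v.2 := by
    intro v
    by_cases hv : v ∈ S
    · obtain ⟨-, -, h3, h4⟩ := hS v hv
      have hd : ((p ^ 2 : ℕ) : ℤ) ∣ bform g v.1 v.2 := by exact_mod_cast h4
      obtain ⟨r, hr⟩ := exists_root_of_dvd_bform (pow_pos hp.pos 2)
        (h.isCoprime_of_dvd_bform hcop h3 hd) hd
      exact ⟨r, fun _ => hr⟩
    · exact ⟨0, fun h => absurd h hv⟩
  choose ρ hρ using hex
  have himg : (S.image ρ).card ≤ g.natDegree := by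
    refine h.card_roots_sq_le hp hpW _ fun r hr => ?_
    obtain ⟨v, hv, rfl⟩ := mem_image.1 hr
    exact ⟨(hρ v hv).1, by exact_mod_cast (hρ v hv).2.1⟩
  have hfib : ∀ r ∈ S.image ρ, (S.filter fun v => ρ v = r).card ≤ 2 * W.natAbs + 25 := by
    intro r hr
    have h1 := lattice_sieve (q := p ^ 2) (X := p) (G := W.natAbs) (lam := 1) r (pow_pos hp.pos 2)
      (S.filter fun v => ρ v = r) (fun v hv => ?_) (fun v hv => ?_) (fun v hv => ?_) ∅ (by simp)
      (by simp) (by simp) (fun _ _ _ => True) (by simp) (by simp) one_pos (by simp)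
    · have hp0 : (p : ℝ) ≠ 0 := by exact_mod_cast hp.pos.ne'
      simp only [card_empty, pow_zero, Nat.cast_zero, zero_div, add_zero, mul_one, Nat.cast_pow] at h1
      rw [div_self (pow_ne_zero 2 hp0)] at h1
      have h2 : (((S.filter fun v => ρ v = r).card : ℕ) : ℝ) ≤ (2 * W.natAbs + 25 : ℕ) := by
        push_cast
        linarith
      exact_mod_cast h2
    · obtain ⟨k1, k2, -⟩ := hS v (mem_filter.1 hv).1
      exact ⟨k1.trans (by exact_mod_cast hXp), k2.trans (by exact_mod_cast hXp)⟩
    · have h1 := Int.natCast_dvd.1 (hS v (mem_filter.1 hv).1).2.2.1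
      exact ⟨Nat.pos_of_dvd_of_pos h1 (Int.natAbs_pos.2 hW0),
        Nat.le_of_dvd (Int.natAbs_pos.2 hW0) h1⟩
    · obtain ⟨hv, hvr⟩ := mem_filter.1 hv
      rw [← hvr]
      exact (hρ v hv).2.2
  rw [card_eq_sum_card_image ρ S]
  calc _ ≤ ∑ r ∈ S.image ρ, (2 * W.natAbs + 25) := sum_le_sum hfib
    _ = (S.image ρ).card * (2 * W.natAbs + 25) := by rw [sum_const, smul_eq_mul]
    _ ≤ _ := by gcongr

end Polynomial

namespace Polynomial

open Finset in
theorem SepBy.card_huge_prime_sq_le {g : ℤ[X]} {W : ℤ} (h : SepBy g W) (hW0 : W ≠ 0)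
    (h6 : g.natDegree ≤ 6) {A C : ℕ}
    (hcount : ∀ (Q : ℕ) (B : Finset (ℕ × ℕ)), 0 < Q → (∀ x ∈ B, 0 < x.1 ∧ x.1 ≤ Q ∧ x.2 < x.1 ∧
      IsCoprime (x.1 : ℤ) W ∧ (x.1 : ℤ) ∣ g.eval (x.2 : ℤ)) → B.card ≤ A * Q)
    (hC0 : 0 < C) (hC : ∀ (X : ℕ) (m n : ℤ), |m| ≤ X → |n| ≤ X →
      |bform g m n| ≤ C * X ^ g.natDegree)
    (ε : ℝ) (hε : 0 < ε) : ∃ J : ℕ, ∀ X : ℕ, 0 < X → ∀ S : Finset (ℤ × ℤ),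
      (∀ v ∈ S, |v.1| ≤ X ∧ |v.2| ≤ X ∧ (Int.gcd v.1 v.2 : ℤ) ∣ W ∧ ∃ (E N : ℤ) (p : ℕ),
        E ∣ W ∧ IsCoprime N W ∧ N ≠ 0 ∧ bform g v.1 v.2 = E * N ∧ 2 ^ J * C * X ^ 2 < p ∧
        (p : ℤ) ^ 2 ∣ N) → (S.card : ℝ) ≤ ε * X ^ 2 := by
  have key : ∀ (J X : ℕ) (S : Finset (ℤ × ℤ)), 0 < X →
      (∀ v ∈ S, |v.1| ≤ X ∧ |v.2| ≤ X ∧ (Int.gcd v.1 v.2 : ℤ) ∣ W ∧ ∃ (E N : ℤ) (p : ℕ),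
        E ∣ W ∧ IsCoprime N W ∧ N ≠ 0 ∧ bform g v.1 v.2 = E * N ∧ 2 ^ J * C * X ^ 2 < p ∧
        (p : ℤ) ^ 2 ∣ N) → ∀ v ∈ S, ∃ (E : ℤ) (p q : ℕ), E ∣ W ∧ IsCoprime (q : ℤ) W ∧ 0 < q ∧
          bform g v.1 v.2 = E * q * p ^ 2 ∧ 2 ^ J * C * X ^ 2 < p ∧
          q * p ^ 2 ≤ C * X ^ g.natDegree := by
    intro J X S hX hS v hv
    obtain ⟨k1, k2, -, E, N, p, e1, e2, e3, e4, e5, k, rfl⟩ := hS v hv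
    have hk : k ≠ 0 := right_ne_zero_of_mul e3
    have hbf : bform g v.1 v.2 = E * k.sign * k.natAbs * p ^ 2 := by
      rw [e4, mul_assoc E, Int.sign_mul_natAbs]
      ring
    refine ⟨E * k.sign, p, k.natAbs, ?_, ?_, Int.natAbs_pos.2 hk, hbf, e5, ?_⟩
    · refine dvd_trans ?_ e1
      have hs : IsUnit k.sign := by
        rw [Int.isUnit_iff_natAbs_eq, Int.natAbs_sign_of_ne_zero hk]
      exact (hs.mul_right_dvd).2 dvd_rfl
    · rw [Int.natCast_natAbs]
      exact (IsCoprime.of_mul_left_right e2).abs_left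
    · have h1 := hC X v.1 v.2 k1 k2
      have h2 : ((k.natAbs * p ^ 2 : ℕ) : ℤ) ≤ |bform g v.1 v.2| := by
        rw [e4, abs_mul, abs_mul, Int.abs_eq_natAbs k, abs_pow]
        have hE : 1 ≤ |E| := Int.one_le_abs (fun h0 => hW0 (zero_dvd_iff.1 (h0 ▸ e1)))
        push_cast
        rw [Nat.abs_cast, mul_comm ((p : ℤ) ^ 2)]
        exact le_mul_of_one_le_left (by positivity) hE
      exact_mod_cast h2.trans h1
  rcases le_or_gt 5 g.natDegree with h5 | h5
  · obtain ⟨J, hJ⟩ := h.card_sq_mul_small_le hW0 h5 h6 hcount ε hε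
    refine ⟨J, fun X hX S hS => hJ X S fun v hv => ?_⟩
    obtain ⟨E, p, q, e1, e2, e3, e4, e5, e6⟩ := key J X S hX hS v hv
    obtain ⟨k1, k2, k3, -⟩ := hS v hv
    refine ⟨k1, k2, k3, E, p, q, e1, e2, e3, e4, ?_⟩
    by_contra! hlt
    have h1 : C * X ^ g.natDegree ≤ C * X ^ 6 := by gcongr
    have h2 : X ^ 2 * p ^ 2 ≤ X ^ 2 * ((2 ^ J * C) * X ^ 4) :=
      calc X ^ 2 * p ^ 2 ≤ q * 2 ^ J * p ^ 2 := by gcongr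
        _ = 2 ^ J * (q * p ^ 2) := by ring
        _ ≤ 2 ^ J * (C * X ^ 6) := Nat.mul_le_mul_left _ (e6.trans h1)
        _ = _ := by ring
    have h3 := Nat.le_of_mul_le_mul_left h2 (by positivity)
    have h4 : (2 ^ J * C) * X ^ 4 ≤ (2 ^ J * C * X ^ 2) ^ 2 := by
      have : 1 ≤ 2 ^ J * C := Nat.succ_le_of_lt (by positivity)
      calc (2 ^ J * C) * X ^ 4 ≤ (2 ^ J * C) * (2 ^ J * C) * X ^ 4 := by
            exact Nat.mul_le_mul_right _ (Nat.le_mul_of_pos_left _ this)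
        _ = _ := by ring
    have h5 : (2 ^ J * C * X ^ 2) ^ 2 < p ^ 2 := Nat.pow_lt_pow_left e5 two_ne_zero
    omega
  · refine ⟨0, fun X hX S hS => ?_⟩
    have : S = ∅ := by
      refine eq_empty_of_forall_notMem fun v hv => ?_
      obtain ⟨E, p, q, -, -, e3, -, e5, e6⟩ := key 0 X S hX hS v hv
      have h1 : C * X ^ g.natDegree ≤ C * X ^ 4 := by (gcongr; omega)
      have h4 : C * X ^ 4 ≤ (C * X ^ 2) ^ 2 :=
        calc C * X ^ 4 ≤ C * C * X ^ 4 := by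
              exact Nat.mul_le_mul_right _ (Nat.le_mul_of_pos_left _ hC0)
          _ = _ := by ring
      rw [pow_zero, one_mul] at e5
      have h5 : (C * X ^ 2) ^ 2 < p ^ 2 := Nat.pow_lt_pow_left e5 two_ne_zero
      have h6 : p ^ 2 ≤ q * p ^ 2 := Nat.le_mul_of_pos_left _ e3
      omega
    rw [this, card_empty, Nat.cast_zero]
    positivity

open Finset in
theorem SepBy.card_large_prime_sq_le {g : ℤ[X]} {W : ℤ} (h : SepBy g W) (hW0 : W ≠ 0)
    (h6 : g.natDegree ≤ 6) {A : ℕ}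
    (hcount : ∀ (Q : ℕ) (B : Finset (ℕ × ℕ)), 0 < Q → (∀ x ∈ B, 0 < x.1 ∧ x.1 ≤ Q ∧ x.2 < x.1 ∧
      IsCoprime (x.1 : ℤ) W ∧ (x.1 : ℤ) ∣ g.eval (x.2 : ℤ)) → B.card ≤ A * Q)
    (ε : ℝ) (hε : 0 < ε) : ∃ X₀ : ℕ, ∀ X : ℕ, X₀ ≤ X → ∀ S : Finset (ℤ × ℤ),
      (∀ v ∈ S, |v.1| ≤ X ∧ |v.2| ≤ X ∧ (Int.gcd v.1 v.2 : ℤ) ∣ W ∧ ∃ (E N : ℤ) (p : ℕ),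
        E ∣ W ∧ IsCoprime N W ∧ N ≠ 0 ∧ bform g v.1 v.2 = E * N ∧ p.Prime ∧ X < p ∧
        (p : ℤ) ^ 2 ∣ N) → (S.card : ℝ) ≤ ε * X ^ 2 := by
  classical
  obtain ⟨C, hC0, hC⟩ := exists_abs_bform_le g
  obtain ⟨J, hJ⟩ := h.card_huge_prime_sq_le hW0 h6 hcount hC0 hC (ε / 2) (by positivity)
  set G := W.natAbs with hG
  set H := 2 ^ J * C with hH
  have hH0 : 0 < H := by positivity
  have hH0' : (0 : ℝ) < H := by exact_mod_cast hH0
  obtain ⟨N₀, hN₀⟩ := exists_primeCounting_le (ε / (2 * (6 * (2 * G + 25)) * H)) (by positivity)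
  refine ⟨N₀ + 1, fun X hX S hS => ?_⟩
  set S₁ := S.filter fun v => ∃ p : ℕ, p.Prime ∧ X < p ∧ p ≤ H * X ^ 2 ∧ ¬ (p : ℤ) ∣ W ∧
    (p : ℤ) ^ 2 ∣ bform g v.1 v.2 with hS₁
  have h1 : ((S \ S₁).card : ℝ) ≤ ε / 2 * X ^ 2 := by
    refine hJ X (by omega) _ fun v hv => ?_
    obtain ⟨hv, hv₁⟩ := mem_sdiff.1 hv
    obtain ⟨k1, k2, k3, E, N, p, e1, e2, e3, e4, e5, e6, e7⟩ := hS v hv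
    refine ⟨k1, k2, k3, E, N, p, e1, e2, e3, e4, ?_, e7⟩
    by_contra! hle
    refine hv₁ (mem_filter.2 ⟨hv, p, e5, e6, hle, fun hd => ?_, e4 ▸ e7.mul_left E⟩)
    have hu := e2.isUnit_of_dvd' ((dvd_pow_self _ two_ne_zero).trans e7) hd
    exact e5.one_lt.ne' (by simpa using Int.isUnit_iff_natAbs_eq.1 hu)
  have h2 : (S₁.card : ℝ) ≤ ε / 2 * X ^ 2 := by
    have hsub : S₁ ⊆ (Nat.primesBelow (H * X ^ 2 + 1)).biUnion fun p => S₁.filter fun v =>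
        X < p ∧ ¬ (p : ℤ) ∣ W ∧ (p : ℤ) ^ 2 ∣ bform g v.1 v.2 := by
      intro v hv
      obtain ⟨-, p, e1, e2, e3, e4, e5⟩ := mem_filter.1 hv
      exact mem_biUnion.2 ⟨p, Nat.mem_primesBelow.2 ⟨by omega, e1⟩, mem_filter.2 ⟨hv, e2, e4, e5⟩⟩
    have hp : ∀ p ∈ Nat.primesBelow (H * X ^ 2 + 1), (S₁.filter fun v =>
        X < p ∧ ¬ (p : ℤ) ∣ W ∧ (p : ℤ) ^ 2 ∣ bform g v.1 v.2).card ≤ 6 * (2 * G + 25) := by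
      intro p hp
      by_cases hc : X < p ∧ ¬ (p : ℤ) ∣ W
      · refine le_trans (h.card_prime_sq_dvd_le (X := X) hW0 (Nat.prime_of_mem_primesBelow hp) hc.2
          hc.1.le _ fun v hv => ?_) (Nat.mul_le_mul_right _ h6)
        obtain ⟨hv, -, -, hd⟩ := mem_filter.1 hv
        obtain ⟨k1, k2, k3, -⟩ := hS v (mem_filter.1 hv).1
        exact ⟨k1, k2, k3, hd⟩
      · rw [filter_false_of_mem fun v _ hv => hc ⟨hv.1, hv.2.1⟩]
        simp
    have h3 : S₁.card ≤ (H * X ^ 2).primeCounting * (6 * (2 * G + 25)) := by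
      refine (card_le_card hsub).trans (card_biUnion_le.trans ((sum_le_sum hp).trans ?_))
      rw [sum_const, smul_eq_mul, Nat.primesBelow_card_eq_primeCounting']
      rfl
    have h4 := hN₀ (H * X ^ 2) (by
      have : X ≤ X ^ 2 := Nat.le_self_pow two_ne_zero X
      have : X ^ 2 ≤ H * X ^ 2 := Nat.le_mul_of_pos_left _ hH0
      omega)
    calc (S₁.card : ℝ) ≤ (H * X ^ 2).primeCounting * (6 * (2 * G + 25)) := by exact_mod_cast h3
      _ ≤ ε / (2 * (6 * (2 * G + 25)) * H) * (H * X ^ 2 : ℕ) * (6 * (2 * G + 25)) := by gcongr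
      _ = ε / 2 * X ^ 2 := by
        push_cast
        field_simp
  have h3 : S.card ≤ (S \ S₁).card + S₁.card := by
    rw [card_sdiff_add_card_eq_card (filter_subset _ _)]
  calc (S.card : ℝ) ≤ (S \ S₁).card + S₁.card := by exact_mod_cast h3
    _ ≤ ε / 2 * X ^ 2 + ε / 2 * X ^ 2 := add_le_add h1 h2
    _ = _ := by ring

end Polynomial

namespace Polynomial

theorem SepBy.not_dvd_bform_of_dvd_bform {g k : ℤ[X]} {W : ℤ} (h : SepBy (g * k) W) {p : ℕ}
    (hp : p.Prime) (hpW : ¬ (p : ℤ) ∣ W) {m n : ℤ} (hgcd : (Int.gcd m n : ℤ) ∣ W)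
    (hg : (p : ℤ) ∣ bform g m n) : ¬ (p : ℤ) ∣ bform k m n := by
  intro hk
  have hcop := ((Nat.prime_iff_prime_int.1 hp).coprime_iff_not_dvd.2 hpW)
  have hn := (SepBy.of_dvd h (dvd_mul_right g k)).isCoprime_of_dvd_bform hcop hgcd hg
  obtain ⟨r, -, hr1, hr2⟩ := exists_root_of_dvd_bform hp.pos hn hg
  have hr3 := dvd_eval_of_dvd_bform hn hr2 hk
  obtain ⟨-, u, v, huv⟩ := h
  refine hpW ?_
  have h1 := congrArg (eval (r : ℤ)) huv
  simp only [derivative_mul, eval_add, eval_mul, eval_C] at h1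
  rw [← h1]
  exact dvd_add ((hr1.mul_right _).mul_left _)
    ((dvd_add (hr3.mul_left _) (hr1.mul_right _)).mul_left _)

theorem bform_of_natDegree_eq_zero {g : ℤ[X]} (hg : g.natDegree = 0) (m n : ℤ) :
    bform g m n = g.leadingCoeff := by
  rw [bform_eq_sum, hg]
  simp [leadingCoeff, hg]

/-- Pairs in a box at which the form attached to `f` is divisible by the square of a large prime
are rare, provided that all irreducible factors of `f` have degree at most six. -/
theorem card_large_prime_sq_dvd_le (f : ℤ[X]) (hf0 : f ≠ 0)
    (hfact : ∀ g, Irreducible g → g ∣ f → g.natDegree ≤ 6) :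
    ∃ D : ℤ, D ≠ 0 ∧ ∀ W : ℤ, W ≠ 0 → D ∣ W → SepBy f W → ∀ ε : ℝ, 0 < ε →
      ∃ X₀ : ℕ, ∀ X : ℕ, X₀ ≤ X → ∀ S : Finset (ℤ × ℤ),
      (∀ v ∈ S, |v.1| ≤ X ∧ |v.2| ≤ X ∧ (Int.gcd v.1 v.2 : ℤ) ∣ W ∧ ∃ (E N : ℤ) (p : ℕ),
        E ∣ W ∧ IsCoprime N W ∧ N ≠ 0 ∧ bform f v.1 v.2 = E * N ∧ p.Prime ∧ X < p ∧
        (p : ℤ) ^ 2 ∣ N) → (S.card : ℝ) ≤ ε * X ^ 2 := by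
  classical
  have hconst : ∀ (g : ℤ[X]) (W : ℤ), g.natDegree = 0 → SepBy g W → ∀ (E N : ℤ) (p : ℕ) (m n : ℤ),
      IsCoprime N W → bform g m n = E * N → p.Prime → (p : ℤ) ^ 2 ∣ N → False := by
    intro g W hg hW E N p m n e1 e2 e3 e4
    rw [bform_of_natDegree_eq_zero hg] at e2
    have h1 : (p : ℤ) ∣ N := (dvd_pow_self _ two_ne_zero).trans e4
    have h2 : (p : ℤ) ∣ W := (h1.mul_left E).trans (e2 ▸ hW.1)
    have hu := e1.isUnit_of_dvd' h1 h2
    exact e3.one_lt.ne' (by simpa using Int.isUnit_iff_natAbs_eq.1 hu)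
  induction f using WfDvdMonoid.induction_on_irreducible with
  | zero => exact absurd rfl hf0
  | unit u hu =>
    refine ⟨1, one_ne_zero, fun W hW0 _ hW ε hε => ⟨0, fun X _ S hS => ?_⟩⟩
    have : S = ∅ := by
      refine Finset.eq_empty_of_forall_notMem fun v hv => ?_
      obtain ⟨-, -, -, E, N, p, e1, e2, e3, e4, e5, e6, e7⟩ := hS v hv
      exact hconst u W (natDegree_eq_zero_of_isUnit hu) hW E N p _ _ e2 e4 e5 e7
    rw [this, Finset.card_empty, Nat.cast_zero]
    positivity
  | mul k g hk0 hg ih =>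
    obtain ⟨D, hD0, hD⟩ := ih hk0 fun i hi hik => hfact i hi (hik.mul_left g)
    have hgB : ∃ D : ℤ, D ≠ 0 ∧ ∀ W : ℤ, W ≠ 0 → D ∣ W → SepBy g W → ∀ ε : ℝ, 0 < ε →
        ∃ X₀ : ℕ, ∀ X : ℕ, X₀ ≤ X → ∀ S : Finset (ℤ × ℤ),
        (∀ v ∈ S, |v.1| ≤ X ∧ |v.2| ≤ X ∧ (Int.gcd v.1 v.2 : ℤ) ∣ W ∧ ∃ (E N : ℤ) (p : ℕ),
          E ∣ W ∧ IsCoprime N W ∧ N ≠ 0 ∧ bform g v.1 v.2 = E * N ∧ p.Prime ∧ X < p ∧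
          (p : ℤ) ^ 2 ∣ N) → (S.card : ℝ) ≤ ε * X ^ 2 := by
      rcases Nat.eq_zero_or_pos g.natDegree with hdeg | hdeg
      · refine ⟨1, one_ne_zero, fun W hW0 _ hW ε hε => ⟨0, fun X _ S hS => ?_⟩⟩
        have : S = ∅ := by
          refine Finset.eq_empty_of_forall_notMem fun v hv => ?_
          obtain ⟨-, -, -, E, N, p, e1, e2, e3, e4, e5, e6, e7⟩ := hS v hv
          exact hconst g W hdeg hW E N p _ _ e2 e4 e5 e7
        rw [this, Finset.card_empty, Nat.cast_zero]
        positivity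
      · obtain ⟨D, A, hD0, hA, hcount⟩ := exists_card_roots_le hg hdeg
        refine ⟨D, hD0, fun W hW0 hDW hW ε hε => hW.card_large_prime_sq_le hW0
          (hfact g hg (dvd_mul_right g k)) (A := A) (fun Q B hQ hB => hcount Q B hQ fun x hx => ?_)
          ε hε⟩
        obtain ⟨h1, h2, h3, h4, h5⟩ := hB x hx
        exact ⟨h1, h2, h3, h4.of_isCoprime_of_dvd_right hDW, h5⟩
    obtain ⟨D', hD'0, hD'⟩ := hgB
    refine ⟨D' * D, mul_ne_zero hD'0 hD0, fun W hW0 hDW hW ε hε => ?_⟩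
    obtain ⟨X₁, hX₁⟩ := hD W hW0 (dvd_of_mul_left_dvd hDW) (SepBy.of_dvd hW (dvd_mul_left k g))
      (ε / 2) (by positivity)
    obtain ⟨X₂, hX₂⟩ := hD' W hW0 (dvd_of_mul_right_dvd hDW) (SepBy.of_dvd hW (dvd_mul_right g k))
      (ε / 2) (by positivity)
    refine ⟨X₁ + X₂, fun X hX S hS => ?_⟩
    have hsplit : ∀ a b E N : ℤ, E ∣ W → IsCoprime N W → N ≠ 0 → a * b = E * N →
        ∃ E' N', E' ∣ W ∧ IsCoprime N' W ∧ N' ≠ 0 ∧ a = E' * N' := by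
      intro a b E N h1 h2 h3 h4
      obtain ⟨E', N', k1, k2, k3⟩ := exists_dvd_and_dvd_of_dvd_mul (Dvd.intro b h4)
      exact ⟨E', N', k1.trans h1, h2.of_isCoprime_of_dvd_left k2, ne_zero_of_dvd_ne_zero h3 k2, k3⟩
    have hprime : ∀ (E N : ℤ) (p : ℕ), IsCoprime N W → p.Prime → (p : ℤ) ∣ W →
        ¬ (p : ℤ) ∣ N := by
      intro E N p h1 h2 h3 h4
      have hu := h1.isUnit_of_dvd' h4 h3
      exact h2.one_lt.ne' (by simpa using Int.isUnit_iff_natAbs_eq.1 hu)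
    have hlift : ∀ (E N a : ℤ) (p : ℕ), E ∣ W → a = E * N → p.Prime → ¬ (p : ℤ) ∣ W →
        (p : ℤ) ^ 2 ∣ a → (p : ℤ) ^ 2 ∣ N := by
      intro E N a p h1 h2 h3 h4 h5
      have hc : IsCoprime ((p : ℤ) ^ 2) E :=
        (((Nat.prime_iff_prime_int.1 h3).coprime_iff_not_dvd.2 fun h => h4 (h.trans h1))).pow_left
      exact hc.dvd_of_dvd_mul_left (h2 ▸ h5)
    set S₁ := S.filter fun v => ∃ p : ℕ, p.Prime ∧ X < p ∧ ¬ (p : ℤ) ∣ W ∧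
      (p : ℤ) ^ 2 ∣ bform k v.1 v.2 with hS₁
    have h1 : (S₁.card : ℝ) ≤ ε / 2 * X ^ 2 := by
      refine hX₁ X (by omega) _ fun v hv => ?_
      obtain ⟨hv, p, f1, f2, f3, f4⟩ := Finset.mem_filter.1 hv
      obtain ⟨k1, k2, k3, E, N, -, e1, e2, e3, e4, -⟩ := hS v hv
      rw [bform_mul _ _ hg.ne_zero hk0, mul_comm] at e4
      obtain ⟨E', N', l1, l2, l3, l4⟩ := hsplit _ _ E N e1 e2 e3 e4
      exact ⟨k1, k2, k3, E', N', p, l1, l2, l3, l4, f1, f2, hlift E' N' _ p l1 l4 f1 f3 f4⟩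
    have h2 : ((S \ S₁).card : ℝ) ≤ ε / 2 * X ^ 2 := by
      refine hX₂ X (by omega) _ fun v hv => ?_
      obtain ⟨hv, hv₁⟩ := Finset.mem_sdiff.1 hv
      obtain ⟨k1, k2, k3, E, N, p, e1, e2, e3, e4, f1, f2, f5⟩ := hS v hv
      have hpW : ¬ (p : ℤ) ∣ W := fun hd =>
        hprime E N p e2 f1 hd ((dvd_pow_self _ two_ne_zero).trans f5)
      rw [bform_mul _ _ hg.ne_zero hk0] at e4
      obtain ⟨E', N', l1, l2, l3, l4⟩ := hsplit _ _ E N e1 e2 e3 e4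
      have hd : (p : ℤ) ^ 2 ∣ bform g v.1 v.2 * bform k v.1 v.2 := e4 ▸ f5.mul_left E
      have hpp := Nat.prime_iff_prime_int.1 f1
      have hgd : (p : ℤ) ^ 2 ∣ bform g v.1 v.2 := by
        by_cases hpk : (p : ℤ) ∣ bform k v.1 v.2
        · have hpg : ¬ (p : ℤ) ∣ bform g v.1 v.2 := fun hpg =>
            hW.not_dvd_bform_of_dvd_bform f1 hpW k3 hpg hpk
          have := ((hpp.coprime_iff_not_dvd.2 hpg).pow_left (m := 2)).dvd_of_dvd_mul_left hd
          exact absurd (Finset.mem_filter.2 ⟨hv, p, f1, f2, hpW, this⟩) hv₁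
        · exact ((hpp.coprime_iff_not_dvd.2 hpk).pow_left (m := 2)).dvd_of_dvd_mul_right hd
      exact ⟨k1, k2, k3, E', N', p, l1, l2, l3, l4, f1, f2, hlift E' N' _ p l1 l4 f1 hpW hgd⟩
    have h3 : S.card = (S \ S₁).card + S₁.card :=
      (Finset.card_sdiff_add_card_eq_card (Finset.filter_subset _ _)).symm
    rw [h3]
    push_cast
    linarith

end Polynomial

namespace Polynomial

theorem natDegree_aeval_X_one_le (π : MvPolynomial (Fin 2) ℤ) :
    (MvPolynomial.aeval ![(X : ℤ[X]), 1] π).natDegree ≤ π.totalDegree := by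
  refine (MvPolynomial.aeval_natDegree_le π le_rfl _ (n := 1) fun i => ?_).trans (by simp)
  fin_cases i <;> simp

theorem natDegree_le_of_irreducible_dvd_map {F : MvPolynomial (Fin 2) ℤ} {e : ℕ}
    (hfact : ∀ g : MvPolynomial (Fin 2) ℤ, Irreducible g → g ∣ F → g.totalDegree ≤ e)
    (φ : MvPolynomial (Fin 2) ℤ →+* ℤ[X]) (hφ : ∀ π, (φ π).natDegree ≤ π.totalDegree)
    (h0 : φ F ≠ 0) {g : ℤ[X]} (hg : Irreducible g) (hgF : g ∣ φ F) : g.natDegree ≤ e := by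
  have hF : F ≠ 0 := by
    rintro rfl
    exact h0 (map_zero φ)
  obtain ⟨s, hs, hsF⟩ := WfDvdMonoid.exists_factors F hF
  have h1 : g ∣ φ s.prod := hgF.trans (_root_.map_dvd φ hsF.symm.dvd)
  rw [map_multiset_prod] at h1
  obtain ⟨π, hπ, hgπ⟩ := hg.prime.exists_mem_multiset_map_dvd h1
  have hπF : π ∣ F := (Multiset.dvd_prod hπ).trans hsF.dvd
  have hπ0 : φ π ≠ 0 := ne_zero_of_dvd_ne_zero h0 (_root_.map_dvd φ hπF)
  exact (natDegree_le_of_dvd hgπ hπ0).trans ((hφ π).trans (hfact π (hs π hπ) hπF))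

theorem exists_squarefree_eval_eq {d : ℕ} {F : MvPolynomial (Fin 2) ℤ} (hF : F.IsHomogeneous d)
    (hF0 : F ≠ 0) (hsq : ∀ g : MvPolynomial (Fin 2) ℤ, ¬ IsUnit g → ¬ g ^ 2 ∣ F) {e : ℕ}
    (hfact : ∀ g : MvPolynomial (Fin 2) ℤ, Irreducible g → g ∣ F → g.totalDegree ≤ e) :
    ∃ (f : ℤ[X]) (k : ℕ), k ≤ 1 ∧ f.natDegree + k = d ∧ Squarefree f ∧
      (∀ g, Irreducible g → g ∣ f → g.natDegree ≤ e) ∧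
      ∀ m n : ℤ, MvPolynomial.eval ![m, n] F = n ^ k * bform f m n := by
  set f := MvPolynomial.aeval ![(X : ℤ[X]), 1] F with hf
  have hd : f.natDegree ≤ d := (natDegree_aeval_X_one_le F).trans hF.totalDegree_le
  obtain ⟨k, rfl⟩ := Nat.exists_eq_add_of_le hd
  have hFf : F = f.homogenize f.natDegree * MvPolynomial.X 1 ^ k := by
    rw [← homogenize_one k, ← homogenize_mul _ _ le_rfl (by simp), mul_one]
    exact (homogenize_eq_of_isHomogeneous hF rfl).symm
  have hf0 : f ≠ 0 := by
    rintro h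
    rw [h] at hFf
    simp [hF0] at hFf
  refine ⟨f, k, ?_, rfl, ?_, fun g hg hgf => natDegree_le_of_irreducible_dvd_map hfact
    (MvPolynomial.aeval ![(X : ℤ[X]), 1]).toRingHom natDegree_aeval_X_one_le hf0 hg hgf,
    fun m n => ?_⟩
  · by_contra! hk
    refine hsq (MvPolynomial.X 1) ?_ ?_
    · exact MvPolynomial.X_prime.not_isUnit
    · rw [hFf]
      exact (pow_dvd_pow _ hk).mul_left _
  · intro h hh
    by_contra hu
    have h2 : (h.homogenize h.natDegree) ^ 2 ∣ F := by
      have hne : h ≠ 0 := by rintro rfl; simp [hf0] at hh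
      rw [hFf, sq, ← homogenize_mul _ _ le_rfl le_rfl, ← natDegree_mul hne hne]
      exact (homogenize_dvd hh).mul_right _
    refine hsq _ (fun hu2 => hu ?_) h2
    have := hu2.map (MvPolynomial.aeval ![(X : ℤ[X]), 1])
    rwa [aeval_homogenize_X_one _ le_rfl] at this
  · conv_lhs => rw [hFf]
    simp [bform, MvPolynomial.aeval_eq_eval, mul_comm]

end Polynomial

namespace Polynomial

theorem bform_modEq (f : ℤ[X]) {N m m' n n' : ℤ} (hm : m ≡ m' [ZMOD N]) (hn : n ≡ n' [ZMOD N]) :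
    bform f m n ≡ bform f m' n' [ZMOD N] := by
  rw [bform_eq_sum, bform_eq_sum]
  exact Int.ModEq.sum fun i _ => ((hm.pow i).mul_left _).mul (hn.pow _)

theorem exists_not_dvd_bform {f : ℤ[X]} {k q : ℕ} (hq : q.Prime) (hd : f.natDegree + k ≤ q)
    (hf : ¬ C (q : ℤ) ∣ f) : ∃ u v : ℤ, ¬ (q : ℤ) ∣ v ^ k * bform f u v := by
  by_contra! H
  have := Fact.mk hq
  have hf0 : f.map (Int.castRingHom (ZMod q)) ≠ 0 := by
    intro h
    refine hf ((C_dvd_iff_dvd_coeff _ _).2 fun i => ?_)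
    have h1 := congrArg (fun g => coeff g i) h
    simpa [coeff_map, ZMod.intCast_zmod_eq_zero_iff_dvd] using h1
  have hroot : ∀ x : ZMod q, (f.map (Int.castRingHom (ZMod q))).eval x = 0 := by
    intro x
    obtain ⟨u, rfl⟩ := ZMod.intCast_surjective x
    have h1 := H u 1
    have h2 := bform_mul_right f u 1
    simp only [mul_one, one_pow, one_mul] at h1 h2
    rw [h2] at h1
    have h3 := (ZMod.intCast_zmod_eq_zero_iff_dvd _ q).2 h1
    rw [eval_map, eval₂_at_intCast]
    exact h3
  have hle : q ≤ (f.map (Int.castRingHom (ZMod q))).natDegree := by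
    by_contra! h
    exact hf0 (eq_zero_of_natDegree_lt_card_of_eval_eq_zero _ Function.injective_id hroot
      (by rwa [ZMod.card]))
  have hle2 := natDegree_map_le (f := Int.castRingHom (ZMod q)) (p := f)
  have hk : k = 0 := by omega
  have hdeg : (f.map (Int.castRingHom (ZMod q))).natDegree = f.natDegree := by omega
  have h1 := H 1 0
  rw [hk, pow_zero, one_mul, bform_zero_right, one_pow, mul_one] at h1
  refine hf0 (leadingCoeff_eq_zero.1 ?_)
  rw [leadingCoeff, hdeg, coeff_map]
  simpa using (ZMod.intCast_zmod_eq_zero_iff_dvd _ q).2 h1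

theorem bform_C_mul (c : ℤ) (f : ℤ[X]) (hc : c ≠ 0) (hf : f ≠ 0) (m n : ℤ) :
    bform (C c * f) m n = c * bform f m n := by
  rw [bform_mul _ _ (by simpa using hc) hf]
  congr 1
  rw [bform, natDegree_C, homogenize_C, pow_zero, mul_one]
  exact MvPolynomial.aeval_C _ _

theorem exists_not_sq_dvd_bform {f : ℤ[X]} (hf : Squarefree f) {k q : ℕ} (hq : q.Prime)
    (hd : f.natDegree + k ≤ q) : ∃ u v : ℤ, ¬ (q : ℤ) ^ 2 ∣ v ^ k * bform f u v := by
  by_cases h : C (q : ℤ) ∣ f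
  · obtain ⟨g, rfl⟩ := h
    have hq0 : (q : ℤ) ≠ 0 := by exact_mod_cast hq.ne_zero
    have hg0 : g ≠ 0 := by
      rintro rfl
      exact hf.ne_zero (mul_zero _)
    have hg : ¬ C (q : ℤ) ∣ g := fun hg => by
      have h1 := isUnit_C.1 (hf _ (mul_dvd_mul_left _ hg))
      exact (Nat.prime_iff_prime_int.1 hq).not_isUnit h1
    rw [natDegree_C_mul hq0] at hd
    obtain ⟨u, v, huv⟩ := exists_not_dvd_bform hq hd hg
    refine ⟨u, v, fun h => huv ?_⟩
    rw [bform_C_mul _ _ hq0 hg0, mul_left_comm, sq] at h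
    exact Int.dvd_of_mul_dvd_mul_left hq0 h
  · obtain ⟨u, v, huv⟩ := exists_not_dvd_bform hq hd h
    exact ⟨u, v, fun h => huv ((dvd_pow_self _ two_ne_zero).trans h)⟩

end Polynomial

theorem Int.exists_modEq_modEq {x y : ℤ} (h : IsCoprime x y) (a b : ℤ) :
    ∃ c, c ≡ a [ZMOD x] ∧ c ≡ b [ZMOD y] := by
  obtain ⟨u, v, huv⟩ := h
  refine ⟨a * (v * y) + b * (u * x), (Int.modEq_iff_dvd.2 ⟨u * (a - b), ?_⟩),
    (Int.modEq_iff_dvd.2 ⟨v * (b - a), ?_⟩)⟩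
  · linear_combination (-a) * huv
  · linear_combination (-b) * huv

theorem exists_modEq_forall_not_sq_dvd (Φ : ℤ → ℤ → ℤ)
    (hΦ : ∀ N m m' n n' : ℤ, m ≡ m' [ZMOD N] → n ≡ n' [ZMOD N] → Φ m n ≡ Φ m' n' [ZMOD N])
    (L : ℤ) (a b : ℤ) (Q : Finset ℕ) (hQ : ∀ q ∈ Q, q.Prime)
    (hQL : ∀ q ∈ Q, ¬ (q : ℤ) ∣ L) (hloc : ∀ q ∈ Q, ∃ u v : ℤ, ¬ (q : ℤ) ^ 2 ∣ Φ u v) :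
    ∃ a₀ b₀ : ℤ, a₀ ≡ a [ZMOD L] ∧ b₀ ≡ b [ZMOD L] ∧ ∀ q ∈ Q, ¬ (q : ℤ) ^ 2 ∣ Φ a₀ b₀ := by
  induction Q using Finset.induction_on with
  | empty => exact ⟨a, b, rfl, rfl, by simp⟩
  | insert q Q hqQ ih =>
    obtain ⟨a₁, b₁, ha₁, hb₁, h₁⟩ := ih (fun q hq => hQ q (Finset.mem_insert_of_mem hq))
      (fun q hq => hQL q (Finset.mem_insert_of_mem hq))
      (fun q hq => hloc q (Finset.mem_insert_of_mem hq))
    have hqp := hQ q (Finset.mem_insert_self _ _)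
    have hqi := Nat.prime_iff_prime_int.1 hqp
    obtain ⟨u, v, huv⟩ := hloc q (Finset.mem_insert_self _ _)
    have hcop : IsCoprime (L * ∏ q' ∈ Q, (q' : ℤ) ^ 2) ((q : ℤ) ^ 2) := by
      refine IsCoprime.mul_left ?_ (IsCoprime.prod_left fun q' hq' => ?_)
      · exact ((hqi.coprime_iff_not_dvd.2 (hQL q (Finset.mem_insert_self _ _))).symm).pow_right
      · refine IsCoprime.pow (Nat.isCoprime_iff_coprime.2 ?_)
        exact (Nat.coprime_primes (hQ q' (Finset.mem_insert_of_mem hq')) hqp).2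
          fun h => hqQ (h ▸ hq')
    obtain ⟨a₀, ha₀, ha₀'⟩ := Int.exists_modEq_modEq hcop a₁ u
    obtain ⟨b₀, hb₀, hb₀'⟩ := Int.exists_modEq_modEq hcop b₁ v
    have hL : L ∣ L * ∏ q' ∈ Q, (q' : ℤ) ^ 2 := Dvd.intro _ rfl
    refine ⟨a₀, b₀, (ha₀.of_dvd hL).trans ha₁, (hb₀.of_dvd hL).trans hb₁, ?_⟩
    intro q' hq'
    rcases Finset.mem_insert.1 hq' with rfl | hq'
    · rw [(hΦ _ _ _ _ _ ha₀' hb₀').dvd_iff]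
      exact huv
    · have hd : (q' : ℤ) ^ 2 ∣ L * ∏ q' ∈ Q, (q' : ℤ) ^ 2 :=
        (Finset.dvd_prod_of_mem (fun q' : ℕ => (q' : ℤ) ^ 2) hq').mul_left _
      rw [(hΦ _ _ _ _ _ (ha₀.of_dvd hd) (hb₀.of_dvd hd)).dvd_iff]
      exact h₁ q' hq'

theorem card_filter_dvd_le (Y Q L : ℕ) (hQL : IsCoprime (Q : ℤ) L) (c : ℤ) :
    ((Finset.Icc 1 Y).filter fun x : ℕ => (Q : ℤ) ∣ c + L * x).card ≤ Y / Q + 1 := by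
  rw [← Finset.card_range (Y / Q + 1)]
  refine Finset.card_le_card_of_injOn (fun x => x / Q) ?_ ?_
  · intro x hx
    simp only [Finset.coe_filter, Finset.mem_Icc, Set.mem_ofPred_eq] at hx
    simp only [Finset.coe_range, Set.mem_Iio]
    have := Nat.div_le_div_right (c := Q) hx.1.2
    omega
  · intro x hx y hy hxy
    simp only [Finset.coe_filter, Finset.mem_Icc, Set.mem_ofPred_eq] at hx hy
    have h1 : (Q : ℤ) ∣ L * ((y : ℤ) - x) := by
      have := dvd_sub hy.2 hx.2
      rwa [show c + L * (y : ℤ) - (c + L * x) = L * ((y : ℤ) - x) by ring] at this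
    have h2 : x ≡ y [MOD Q] := (Nat.modEq_iff_dvd).2 (hQL.dvd_of_dvd_mul_left h1)
    have h3 := Nat.div_add_mod x Q
    have h4 := Nat.div_add_mod y Q
    have h5 : x / Q = y / Q := hxy
    have h6 : x % Q = y % Q := h2
    rw [h5, h6] at h3
    omega

theorem exists_eq_mul_isCoprime (L : ℕ) {Z : ℤ} (hZ : Z ≠ 0)
    (h : ∀ q : ℕ, q.Prime → q ∣ L → ∃ e : ℕ, q ^ e ∣ L ∧ ¬ (q : ℤ) ^ e ∣ Z) :
    ∃ E N : ℤ, E ∣ L ∧ IsCoprime N L ∧ N ≠ 0 ∧ Z = E * N := by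
  obtain ⟨N, hN⟩ : (Int.gcd Z L : ℤ) ∣ Z := Int.gcd_dvd_left _ _
  refine ⟨Int.gcd Z L, N, Int.gcd_dvd_right _ _, ?_, ?_, hN⟩
  · rw [Int.isCoprime_iff_gcd_eq_one]
    refine Nat.coprime_of_dvd fun q hq hqN hqL => ?_
    have hqN' : (q : ℤ) ∣ N := Int.natCast_dvd.2 hqN
    have hqL' : q ∣ L := by simpa using hqL
    obtain ⟨e, he, heZ⟩ := h q hq hqL'
    have key : ∀ j ≤ e, (q : ℤ) ^ j ∣ Int.gcd Z L := by
      intro j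
      induction j with
      | zero => simp
      | succ j ih =>
        intro hj
        refine Int.dvd_coe_gcd ?_ ?_
        · rw [hN, pow_succ]
          exact mul_dvd_mul (ih (by omega)) hqN'
        · exact (pow_dvd_pow _ hj).trans (by exact_mod_cast he)
    exact heZ ((key e le_rfl).trans (Int.gcd_dvd_left _ _))
  · rintro rfl
    simp at hN
    exact hZ hN

namespace Polynomial

theorem SepBy.card_bad_le {f : ℤ[X]} {L k : ℕ} (hf : SepBy f L) (hk : k ≤ 1) {q : ℕ} (hq : q.Prime)
    (hqL : ¬ q ∣ L) (a b : ℤ) (Y : ℕ) :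
    ((Finset.Icc 1 Y ×ˢ Finset.Icc 1 Y).filter fun v : ℕ × ℕ =>
      ((q : ℤ) ∣ a + L * v.1 ∧ (q : ℤ) ∣ b + L * v.2) ∨
      (q : ℤ) ^ 2 ∣ (b + L * v.2) ^ k * bform f (a + L * v.1) (b + L * v.2)).card ≤
    (Y / q + 1) ^ 2 + (f.natDegree + 1) * (Y * (Y / q ^ 2 + 1)) := by
  classical
  have hqi := Nat.prime_iff_prime_int.1 hq
  have hqL' : ¬ (q : ℤ) ∣ L := by exact_mod_cast hqL
  have hcop : IsCoprime (q : ℤ) L := hqi.coprime_iff_not_dvd.2 hqL'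
  have hcop2 : IsCoprime ((q ^ 2 : ℕ) : ℤ) L := by
    push_cast
    exact hcop.pow_left
  have hq2 : 0 < q ^ 2 := pow_pos hq.pos 2
  set I := Finset.Icc 1 Y with hI
  have hIc : I.card = Y := by simp [hI]
  set R := (Finset.range (q ^ 2)).filter fun r : ℕ => (q : ℤ) ^ 2 ∣ f.eval (r : ℤ) with hR
  have hRc : R.card ≤ f.natDegree := by
    refine hf.card_roots_sq_le hq hqL' R fun r hr => ?_
    rw [hR, Finset.mem_filter, Finset.mem_range] at hr
    exact hr
  set A := (I.filter fun x : ℕ => (q : ℤ) ∣ a + L * x) ×ˢ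
    (I.filter fun x : ℕ => (q : ℤ) ∣ b + L * x) with hA
  set B := I ×ˢ (I.filter fun x : ℕ => ((q ^ 2 : ℕ) : ℤ) ∣ b + L * x) with hB
  set T := (R ×ˢ I).biUnion fun s : ℕ × ℕ =>
    (I.filter fun x : ℕ => ((q ^ 2 : ℕ) : ℤ) ∣ (a - s.1 * (b + L * s.2)) + L * x) ×ˢ
      ({s.2} : Finset ℕ) with hT
  have hsub : ((I ×ˢ I).filter fun v : ℕ × ℕ =>
      ((q : ℤ) ∣ a + L * v.1 ∧ (q : ℤ) ∣ b + L * v.2) ∨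
      (q : ℤ) ^ 2 ∣ (b + L * v.2) ^ k * bform f (a + L * v.1) (b + L * v.2)) ⊆ A ∪ (B ∪ T) := by
    rintro ⟨x, y⟩ hv
    simp only [Finset.mem_filter, Finset.mem_product] at hv
    obtain ⟨⟨hx, hy⟩, hv⟩ := hv
    rw [Finset.mem_union, Finset.mem_union]
    by_cases hboth : (q : ℤ) ∣ a + L * x ∧ (q : ℤ) ∣ b + L * y
    · left
      simp [hA, hx, hy, hboth]
    right
    have hdiv := hv.resolve_left hboth
    by_cases hn : (q : ℤ) ∣ b + L * y
    · left
      have hm : ¬ (q : ℤ) ∣ bform f (a + L * x) (b + L * y) := fun h =>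
        hboth ⟨hf.dvd_of_dvd_bform hq hqL' hn h, hn⟩
      have h1 : (q : ℤ) ^ 2 ∣ (b + L * y) ^ k :=
        ((hqi.coprime_iff_not_dvd.2 hm).pow_left).dvd_of_dvd_mul_right hdiv
      have h2 : (q : ℤ) ^ 2 ∣ b + L * y := by
        simpa using h1.trans (pow_dvd_pow (b + L * y : ℤ) hk)
      simp [hB, hx, hy, h2]
    · right
      have hn' : IsCoprime (q : ℤ) (b + L * y) := hqi.coprime_iff_not_dvd.2 hn
      have h1 : (q : ℤ) ^ 2 ∣ bform f (a + L * x) (b + L * y) :=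
        (hn'.pow (m := 2) (n := k)).dvd_of_dvd_mul_left hdiv
      obtain ⟨r, hr, hr1, hr2⟩ := exists_root_of_dvd_bform (q := q ^ 2) (g := f) hq2
        (m := a + L * x) (n := b + L * y) (by push_cast; exact hn'.pow_left)
        (by push_cast; exact h1)
      rw [hT, Finset.mem_biUnion]
      refine ⟨(r, y), ?_, ?_⟩
      · rw [Finset.mem_product, hR, Finset.mem_filter, Finset.mem_range]
        push_cast at hr1
        exact ⟨⟨hr, hr1⟩, hy⟩
      · rw [Finset.mem_product, Finset.mem_filter, Finset.mem_singleton]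
        refine ⟨⟨hx, ?_⟩, rfl⟩
        convert hr2 using 1
        ring
  have hAc : A.card ≤ (Y / q + 1) ^ 2 := by
    rw [hA, Finset.card_product, sq]
    exact Nat.mul_le_mul (card_filter_dvd_le _ _ _ hcop _)
      (card_filter_dvd_le _ _ _ hcop _)
  have hBc : B.card ≤ Y * (Y / q ^ 2 + 1) := by
    rw [hB, Finset.card_product, hIc]
    exact Nat.mul_le_mul le_rfl (card_filter_dvd_le _ _ _ hcop2 _)
  have hTc : T.card ≤ f.natDegree * (Y * (Y / q ^ 2 + 1)) := by
    refine (Finset.card_biUnion_le_card_mul _ _ (Y / q ^ 2 + 1) fun s hs => ?_).trans ?_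
    · rw [Finset.card_product, Finset.card_singleton, mul_one]
      exact card_filter_dvd_le _ _ _ hcop2 _
    · rw [Finset.card_product, hIc, mul_assoc]
      exact Nat.mul_le_mul hRc le_rfl
  have h1 := (Finset.card_le_card hsub).trans (Finset.card_union_le _ _)
  have h2 := Finset.card_union_le B T
  nlinarith

end Polynomial

theorem sum_primes_bad_le (D L B : ℕ) (hL : 0 < L) (hB : 8 * (D + 3) ≤ B + 1) :
    ∃ Y₀ : ℕ, ∀ Y, Y₀ ≤ Y → ∀ Q : Finset ℕ,
      (∀ q ∈ Q, q.Prime ∧ B < q ∧ q ≤ L * (Y + 1)) →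
      ((∑ q ∈ Q, ((Y / q + 1) ^ 2 + (D + 1) * (Y * (Y / q ^ 2 + 1))) : ℕ) : ℝ) ≤ Y ^ 2 / 2 := by
  have hL' : (0 : ℝ) < L := by exact_mod_cast hL
  obtain ⟨N, hN⟩ := exists_primeCounting_le (1 / (8 * L * (D + 3))) (by positivity)
  refine ⟨N + 1, fun Y hY Q hQ => ?_⟩
  have hY1 : (1 : ℝ) ≤ Y := by exact_mod_cast (by omega : 1 ≤ Y)
  have hX : N ≤ L * (Y + 1) := by nlinarith
  have hpi := hN _ hX
  have hQc : (Q.card : ℝ) ≤ Y / (4 * (D + 3)) := by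
    have h1 : Q.card ≤ (L * (Y + 1)).primeCounting := by
      rw [← Nat.primesLE_card_eq_primeCounting]
      refine Finset.card_le_card fun q hq => ?_
      rw [Nat.mem_primesLE]
      exact ⟨(hQ q hq).2.2, (hQ q hq).1⟩
    calc (Q.card : ℝ) ≤ (L * (Y + 1)).primeCounting := by exact_mod_cast h1
      _ ≤ _ := hpi
      _ = (Y + 1) / (8 * (D + 3)) := by push_cast; field_simp
      _ ≤ (2 * Y) / (8 * (D + 3)) := by gcongr; linarith
      _ = _ := by field_simp; norm_num
  have hterm : ∀ q ∈ Q, (((Y / q + 1) ^ 2 + (D + 1) * (Y * (Y / q ^ 2 + 1)) : ℕ) : ℝ) ≤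
      (D + 3) * Y ^ 2 * ((q : ℝ) ^ 2)⁻¹ + (D + 3) * Y := by
    intro q hq
    have h1 : ((Y / q : ℕ) : ℝ) ≤ Y / q := Nat.cast_div_le
    have h2 : ((Y / q ^ 2 : ℕ) : ℝ) ≤ Y / q ^ 2 := by
      have := @Nat.cast_div_le ℝ _ _ _ Y (q ^ 2)
      push_cast at this
      exact this
    push_cast
    have h3 : (((Y / q : ℕ) : ℝ) + 1) ^ 2 ≤ 2 * (Y ^ 2 * ((q : ℝ) ^ 2)⁻¹) + 2 := by
      have h4 : (((Y / q : ℕ) : ℝ)) ^ 2 ≤ Y ^ 2 * ((q : ℝ) ^ 2)⁻¹ := by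
        calc _ ≤ ((Y : ℝ) / q) ^ 2 := by gcongr
          _ = _ := by rw [div_pow, div_eq_mul_inv]
      nlinarith [sq_nonneg (((Y / q : ℕ) : ℝ) - 1)]
    have h5 : ((D : ℝ) + 1) * (Y * (((Y / q ^ 2 : ℕ) : ℝ) + 1)) ≤
        (D + 1) * (Y * (Y / q ^ 2 + 1)) := by gcongr
    have h6 : ((D : ℝ) + 1) * (Y * (Y / q ^ 2 + 1)) =
        (D + 1) * (Y ^ 2 * ((q : ℝ) ^ 2)⁻¹) + (D + 1) * Y := by
      rw [div_eq_mul_inv]; ring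
    nlinarith
  have hsum : ∑ q ∈ Q, ((q : ℝ) ^ 2)⁻¹ ≤ 1 / (4 * (D + 3)) := by
    calc ∑ q ∈ Q, ((q : ℝ) ^ 2)⁻¹ ≤ ∑ q ∈ Finset.Ioo B (L * (Y + 1) + 1), ((q : ℝ) ^ 2)⁻¹ := by
          refine Finset.sum_le_sum_of_subset_of_nonneg (fun q hq => ?_) fun _ _ _ => by positivity
          have := hQ q hq
          rw [Finset.mem_Ioo]
          omega
      _ ≤ 2 / (B + 1) := sum_Ioo_inv_sq_le _ _
      _ ≤ 2 / (8 * (D + 3)) := by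
          have : (8 * (D + 3) : ℝ) ≤ B + 1 := by exact_mod_cast hB
          gcongr
      _ = _ := by field_simp; norm_num
  push_cast at hterm ⊢
  calc _ ≤ ∑ q ∈ Q, ((D + 3) * Y ^ 2 * ((q : ℝ) ^ 2)⁻¹ + (D + 3) * Y) := Finset.sum_le_sum hterm
    _ = (D + 3) * Y ^ 2 * ∑ q ∈ Q, ((q : ℝ) ^ 2)⁻¹ + Q.card * ((D + 3) * Y) := by
      rw [Finset.sum_add_distrib, ← Finset.mul_sum, Finset.sum_const, nsmul_eq_mul]
    _ ≤ (D + 3) * Y ^ 2 * (1 / (4 * (D + 3))) + Y / (4 * (D + 3)) * ((D + 3) * Y) := by gcongr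
    _ = _ := by field_simp; ring

namespace Polynomial

theorem dvd_bform_of_dvd {f : ℤ[X]} (hf : f.natDegree ≠ 0) {g m n : ℤ} (hm : g ∣ m) (hn : g ∣ n) :
    g ∣ bform f m n := by
  rw [bform_eq_sum]
  refine Finset.dvd_sum fun i hi => ?_
  rcases Nat.eq_zero_or_pos i with rfl | hi0
  · exact (dvd_pow hn (by simpa using hf)).mul_left _
  · exact ((dvd_pow hm hi0.ne').mul_left _).mul_right _

theorem SepBy.large_prime_sq_dvd {f : ℤ[X]} {L k : ℕ} (hf : SepBy f L) {m n : ℤ}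
    {X : ℕ} (hm0 : 0 < m) (hmX : m ≤ X) (hn0 : 0 < n) (hnX : n ≤ X)
    (hΦ : n ^ k * bform f m n ≠ 0)
    (hloc : ∀ q : ℕ, q.Prime → q ∣ L → ∃ e : ℕ, q ^ e ∣ L ∧ ¬ (q : ℤ) ^ e ∣ n ^ k * bform f m n)
    (hboth : ∀ q : ℕ, q.Prime → q ≤ X → ¬ q ∣ L → (q : ℤ) ∣ m → ¬ (q : ℤ) ∣ n)
    {q : ℕ} (hq : q.Prime) (hqX : X < q) (hqL : ¬ q ∣ L)
    (hdiv : (q : ℤ) ^ 2 ∣ n ^ k * bform f m n) :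
    (Int.gcd m n : ℤ) ∣ L ∧ ∃ (E N : ℤ) (p : ℕ), E ∣ L ∧ IsCoprime N L ∧ N ≠ 0 ∧
      bform f m n = E * N ∧ p.Prime ∧ X < p ∧ (p : ℤ) ^ 2 ∣ N := by
  have hqi := Nat.prime_iff_prime_int.1 hq
  have hqL' : IsCoprime (q : ℤ) L := hqi.coprime_iff_not_dvd.2 (by exact_mod_cast hqL)
  obtain ⟨E₀, N₀, hE₀, hN₀, hN₀0, hEN₀⟩ := exists_eq_mul_isCoprime L hΦ hloc
  obtain ⟨E, N, hE, hN, hEN⟩ := exists_dvd_and_dvd_of_dvd_mul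
    (hEN₀ ▸ Dvd.intro_left _ rfl : bform f m n ∣ E₀ * N₀)
  have hEL := hE.trans hE₀
  have hNL : IsCoprime N L := hN₀.of_isCoprime_of_dvd_left hN
  have hN0 : N ≠ 0 := ne_zero_of_dvd_ne_zero hN₀0 hN
  have hqn : ¬ (q : ℤ) ∣ n := fun h => by
    have := Int.le_of_dvd hn0 h
    omega
  have hqb : (q : ℤ) ^ 2 ∣ bform f m n :=
    ((hqi.coprime_iff_not_dvd.2 hqn).pow (m := 2) (n := k)).dvd_of_dvd_mul_left hdiv
  have hqN : (q : ℤ) ^ 2 ∣ N :=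
    ((hqL'.of_isCoprime_of_dvd_right hEL).pow_left).dvd_of_dvd_mul_left (hEN ▸ hqb)
  refine ⟨?_, E, N, q, hEL, hNL, hN0, hEN, hq, hqX, hqN⟩
  have hdeg : f.natDegree ≠ 0 := by
    intro h0
    rw [bform_of_natDegree_eq_zero h0] at hqb
    have h1 : (q : ℤ) ∣ L := ((dvd_pow_self _ two_ne_zero).trans hqb).trans hf.1
    exact hqL (by exact_mod_cast h1)
  have hg := dvd_bform_of_dvd hdeg (Int.gcd_dvd_left m n) (Int.gcd_dvd_right m n)
  obtain ⟨g₁, g₂, hg₁, hg₂, hgg⟩ := exists_dvd_and_dvd_of_dvd_mul (hEN ▸ hg)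
  have hu : g₂.natAbs = 1 := by
    by_contra hne
    obtain ⟨s, hs, hsg⟩ := Nat.exists_prime_and_dvd hne
    have hsg' : (s : ℤ) ∣ g₂ := Int.natCast_dvd.2 hsg
    have hsm : (s : ℤ) ∣ Int.gcd m n := hgg ▸ hsg'.mul_left _
    have h1 := hsm.trans (Int.gcd_dvd_left m n)
    have h2 := hsm.trans (Int.gcd_dvd_right m n)
    have hsX : s ≤ X := by
      have := Int.le_of_dvd hm0 h1
      omega
    refine hboth s hs hsX (fun hsL => ?_) h1 h2
    have hsL' : (s : ℤ) ∣ L := by exact_mod_cast hsL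
    exact (Nat.prime_iff_prime_int.1 hs).not_isUnit
      (hNL.isUnit_of_dvd' (hsg'.trans hg₂) hsL')
  rw [hgg]
  exact (Int.isUnit_iff_natAbs_eq.2 hu).mul_right_dvd.2 (hg₁.trans hEL)

theorem SepBy.card_good_ge {f : ℤ[X]} {L k : ℕ} (hL : 0 < L) (hf : SepBy f L) (hk : k ≤ 1)
    (hsmall : ∀ q : ℕ, q.Prime → q ≤ 8 * (f.natDegree + 3) → q ∣ L)
    (hlarge : ∀ ε : ℝ, 0 < ε → ∃ X₀ : ℕ, ∀ X : ℕ, X₀ ≤ X → ∀ S : Finset (ℤ × ℤ),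
      (∀ v ∈ S, |v.1| ≤ X ∧ |v.2| ≤ X ∧ (Int.gcd v.1 v.2 : ℤ) ∣ L ∧ ∃ (E N : ℤ) (p : ℕ),
        E ∣ L ∧ IsCoprime N L ∧ N ≠ 0 ∧ bform f v.1 v.2 = E * N ∧ p.Prime ∧ X < p ∧
        (p : ℤ) ^ 2 ∣ N) → (S.card : ℝ) ≤ ε * X ^ 2)
    {a b : ℕ} (ha : a < L) (hb : b < L)
    (hloc : ∀ q : ℕ, q.Prime → q ∣ L → ∃ e : ℕ, q ^ e ∣ L ∧
      ¬ (q : ℤ) ^ e ∣ (b : ℤ) ^ k * bform f (a : ℤ) (b : ℤ)) :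
    ∃ Y₀ : ℕ, ∀ Y : ℕ, Y₀ ≤ Y → ∃ S : Finset (ℕ × ℕ), (Y ^ 2 / 4 : ℝ) ≤ S.card ∧
      ∀ v ∈ S, ∀ q : ℕ, q.Prime → ¬ q ∣ L → ¬ (q : ℤ) ^ 2 ∣
        (b + L * v.2 : ℤ) ^ k * bform f (a + L * v.1 : ℤ) (b + L * v.2) := by
  classical
  have hL' : (0 : ℝ) < L := by exact_mod_cast hL
  obtain ⟨Y₁, hY₁⟩ := sum_primes_bad_le f.natDegree L (8 * (f.natDegree + 3)) hL (Nat.le_succ _)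
  obtain ⟨X₀, hX₀⟩ := hlarge (1 / (16 * L ^ 2)) (by positivity)
  obtain ⟨q₀, hq₀L, hq₀⟩ := Nat.exists_infinite_primes (L + 1)
  have hq₀dvd : ¬ q₀ ∣ L := fun h => by
    have := Nat.le_of_dvd hL h
    omega
  refine ⟨Y₁ + X₀ + q₀, fun Y hY => ?_⟩
  have hY1 : 1 ≤ Y := by have := hq₀.pos; omega
  set X := L * (Y + 1) with hX
  have hYX : Y ≤ X := by nlinarith
  set P := Finset.Icc 1 Y ×ˢ Finset.Icc 1 Y with hP
  set m : ℕ × ℕ → ℤ := fun v => a + L * v.1 with hm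
  set n : ℕ × ℕ → ℤ := fun v => b + L * v.2 with hn
  set Φ : ℕ × ℕ → ℤ := fun v => n v ^ k * bform f (m v) (n v) with hΦ
  set bad : ℕ → ℕ × ℕ → Prop := fun q v =>
    ((q : ℤ) ∣ m v ∧ (q : ℤ) ∣ n v) ∨ (q : ℤ) ^ 2 ∣ Φ v with hbad
  set Q := (Finset.range (X + 1)).filter fun q => q.Prime ∧ ¬ q ∣ L with hQ
  have hQmem : ∀ q, q ∈ Q ↔ q ≤ X ∧ q.Prime ∧ ¬ q ∣ L := fun q => by
    rw [hQ, Finset.mem_filter, Finset.mem_range, Nat.lt_succ_iff]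
  set B₁ := Q.biUnion fun q => P.filter (bad q) with hB₁
  set B₂ := (P \ B₁).filter fun v => ∃ q : ℕ, q.Prime ∧ ¬ q ∣ L ∧ X < q ∧ (q : ℤ) ^ 2 ∣ Φ v with hB₂
  have hPc : (P.card : ℝ) = Y ^ 2 := by
    rw [hP, Finset.card_product]
    simp [sq]
  have hB₁c : (B₁.card : ℝ) ≤ Y ^ 2 / 2 := by
    refine le_trans ?_ (hY₁ Y (by omega) Q fun q hq => ?_)
    · refine Nat.cast_le.2 (Finset.card_biUnion_le.trans (Finset.sum_le_sum fun q hq => ?_))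
      rw [hQmem] at hq
      exact hf.card_bad_le hk hq.2.1 hq.2.2 a b Y
    · rw [hQmem] at hq
      refine ⟨hq.2.1, ?_, hq.1⟩
      by_contra! h
      exact hq.2.2 (hsmall q hq.2.1 h)
  have hcoord : ∀ c y : ℕ, c < L → y ∈ Finset.Icc 1 Y →
      0 < (c + L * y : ℤ) ∧ (c + L * y : ℤ) ≤ X := by
    intro c y hc hy
    rw [Finset.mem_Icc] at hy
    constructor
    · have : 0 < c + L * y := by nlinarith
      exact_mod_cast this
    · have : c + L * y ≤ X := by rw [hX]; nlinarith
      exact_mod_cast this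
  have hmn : ∀ v ∈ P, (0 < m v ∧ m v ≤ X) ∧ (0 < n v ∧ n v ≤ X) := fun v hv => by
    rw [hP, Finset.mem_product] at hv
    exact ⟨hcoord a v.1 ha hv.1, hcoord b v.2 hb hv.2⟩
  have hlocv : ∀ v, ∀ q : ℕ, q.Prime → q ∣ L → ∃ e : ℕ, q ^ e ∣ L ∧ ¬ (q : ℤ) ^ e ∣ Φ v := by
    intro v q hq hqL
    obtain ⟨e, he, hne⟩ := hloc q hq hqL
    refine ⟨e, he, fun h => hne ?_⟩
    have hmod : ∀ c y : ℕ, (c + L * y : ℤ) ≡ c [ZMOD (q : ℤ) ^ e] := fun c y => by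
      have h1 : (q : ℤ) ^ e ∣ L := by exact_mod_cast he
      exact (Int.modEq_iff_dvd.2 (by simpa using h1.mul_right (y : ℤ)))
    exact (((hmod b v.2).pow k).mul (bform_modEq f (hmod a v.1) (hmod b v.2))).dvd_iff.1 h
  have hB₂c : (B₂.card : ℝ) ≤ Y ^ 2 / 4 := by
    have hinj : Function.Injective fun v : ℕ × ℕ => (m v, n v) := by
      intro v w hvw
      have hL0 : (L : ℤ) ≠ 0 := by exact_mod_cast hL.ne'
      have h1 := congrArg Prod.fst hvw
      have h2 := congrArg Prod.snd hvw
      simp only [hm, hn, add_right_inj, mul_right_inj' hL0, Nat.cast_inj] at h1 h2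
      exact Prod.ext h1 h2
    have h1 := hX₀ X (by omega) (B₂.image fun v => (m v, n v)) ?_
    · rw [Finset.card_image_of_injective _ hinj] at h1
      refine h1.trans ?_
      have h2 : (X : ℝ) ≤ 2 * L * Y := by
        have : X ≤ 2 * L * Y := by rw [hX]; nlinarith
        exact_mod_cast this
      calc (1 / (16 * L ^ 2) : ℝ) * X ^ 2 ≤ 1 / (16 * L ^ 2) * (2 * L * Y) ^ 2 := by gcongr
        _ = _ := by field_simp; norm_num
    · intro w hw
      rw [Finset.mem_image] at hw
      obtain ⟨v, hv, rfl⟩ := hw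
      rw [hB₂, Finset.mem_filter, Finset.mem_sdiff] at hv
      obtain ⟨⟨hvP, hvB⟩, q, hq, hqL, hqX, hdiv⟩ := hv
      have hnb : ∀ s : ℕ, s.Prime → s ≤ X → ¬ s ∣ L → ¬ bad s v := fun s h1 h2 h3 h4 =>
        hvB (Finset.mem_biUnion.2 ⟨s, (hQmem s).2 ⟨h2, h1, h3⟩, Finset.mem_filter.2 ⟨hvP, h4⟩⟩)
      obtain ⟨⟨hm0, hmX⟩, hn0, hnX⟩ := hmn v hvP
      have hΦ0 : Φ v ≠ 0 := fun h =>
        hnb q₀ hq₀ (by omega) hq₀dvd (Or.inr (h ▸ dvd_zero _))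
      refine ⟨abs_le.2 ⟨by omega, hmX⟩, abs_le.2 ⟨by omega, hnX⟩, ?_⟩
      exact hf.large_prime_sq_dvd hm0 hmX hn0 hnX hΦ0 (hlocv v)
        (fun s h1 h2 h3 h4 h5 => hnb s h1 h2 h3 (Or.inl ⟨h4, h5⟩)) hq hqX hqL hdiv
  refine ⟨(P \ B₁) \ B₂, ?_, ?_⟩
  · have h1 := Finset.le_card_sdiff B₁ P
    have h2 := Finset.le_card_sdiff B₂ (P \ B₁)
    have h3 : P.card ≤ ((P \ B₁) \ B₂).card + B₁.card + B₂.card := by omega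
    have h4 : (P.card : ℝ) ≤ ((P \ B₁) \ B₂).card + B₁.card + B₂.card := by exact_mod_cast h3
    linarith
  · intro v hv q hq hqL hdiv
    rw [Finset.mem_sdiff] at hv
    rcases le_or_gt q X with h | h
    · exact (Finset.mem_sdiff.1 hv.1).2 (Finset.mem_biUnion.2 ⟨q, (hQmem q).2 ⟨h, hq, hqL⟩,
        Finset.mem_filter.2 ⟨(Finset.mem_sdiff.1 hv.1).1, Or.inr hdiv⟩⟩)
    · exact hv.2 (Finset.mem_filter.2 ⟨hv.1, q, hq, hqL, h, hdiv⟩)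

end Polynomial

namespace Polynomial

theorem infinite_forall_not_sq_dvd {f : ℤ[X]} (hf : Squarefree f)
    (hfact : ∀ g, Irreducible g → g ∣ f → g.natDegree ≤ 6) {k : ℕ} (hk : k ≤ 1) {M : ℕ}
    (hM : 0 < M) (hMsmall : ∀ q : ℕ, q.Prime → q < f.natDegree + k → q ∣ M) {a b : ℤ}
    (hloc : ∀ q : ℕ, q.Prime → q ∣ M → ∃ e : ℕ, q ^ e ∣ M ∧ ¬ (q : ℤ) ^ e ∣ b ^ k * bform f a b) :
    {v : ℤ × ℤ | v.1 ≡ a [ZMOD M] ∧ v.2 ≡ b [ZMOD M] ∧ ∀ q : ℕ, q.Prime → ¬ q ∣ M →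
      ¬ (q : ℤ) ^ 2 ∣ v.2 ^ k * bform f v.1 v.2}.Infinite := by
  classical
  have hΦ : ∀ N m m' n n' : ℤ, m ≡ m' [ZMOD N] → n ≡ n' [ZMOD N] →
      n ^ k * bform f m n ≡ n' ^ k * bform f m' n' [ZMOD N] := fun N m m' n n' h1 h2 =>
    (h2.pow k).mul (bform_modEq f h1 h2)
  obtain ⟨W, hW0, hW⟩ := exists_sepBy hf
  obtain ⟨D, hD0, hD⟩ := card_large_prime_sq_dvd_le f hf.ne_zero hfact
  obtain ⟨T, hT0, hWDT, hsmallT⟩ : ∃ T : ℕ, T ≠ 0 ∧ (W * D).natAbs ∣ T ∧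
      ∀ q : ℕ, q.Prime → q ≤ 8 * (f.natDegree + 3) → q ∣ T :=
    ⟨(W * D).natAbs * (8 * (f.natDegree + 3)).factorial,
      Nat.mul_ne_zero (Int.natAbs_ne_zero.2 (mul_ne_zero hW0 hD0)) (Nat.factorial_ne_zero _),
      Dvd.intro _ rfl, fun q hq hqs => (hq.dvd_factorial.2 hqs).mul_left _⟩
  set Q := T.primeFactors.filter fun q => ¬ q ∣ M with hQ
  have hQmem : ∀ q, q ∈ Q ↔ (q.Prime ∧ q ∣ T) ∧ ¬ q ∣ M := fun q => by
    rw [hQ, Finset.mem_filter, Nat.mem_primeFactors_of_ne_zero hT0]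
  set R := ∏ q ∈ Q, q ^ 2 with hR
  have hR0 : 0 < R := Finset.prod_pos fun q hq => pow_pos ((hQmem q).1 hq).1.1.pos 2
  set L := M * T * R with hLdef
  have hL : 0 < L := Nat.mul_pos (Nat.mul_pos hM (Nat.pos_of_ne_zero hT0)) hR0
  have hML : M ∣ L := (Dvd.intro _ rfl : M ∣ M * T).mul_right R
  have hTL : T ∣ L := (Dvd.intro_left _ rfl : T ∣ M * T).mul_right R
  have hWDL : W * D ∣ (L : ℤ) :=
    Int.natAbs_dvd.1 (by exact_mod_cast hWDT.trans hTL)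
  have hfL : SepBy f L := by
    obtain ⟨c, hc⟩ := (Dvd.intro _ rfl : W ∣ W * D).trans hWDL
    rw [hc]
    exact hW.mul_right c
  have hDL : D ∣ (L : ℤ) := (Dvd.intro_left _ rfl : D ∣ W * D).trans hWDL
  have hL0 : (L : ℤ) ≠ 0 := by exact_mod_cast hL.ne'
  have hQL : ∀ q : ℕ, q.Prime → q ∣ L → ¬ q ∣ M → q ∈ Q := by
    intro q hq hqL hqM
    rw [hQmem]
    refine ⟨⟨hq, ?_⟩, hqM⟩
    rcases hq.dvd_mul.1 hqL with h | h
    · exact (hq.dvd_mul.1 h).resolve_left hqM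
    · obtain ⟨s, hs, hqs⟩ := (Prime.dvd_finsetProd_iff hq.prime _).1 h
      rw [(Nat.prime_dvd_prime_iff_eq hq ((hQmem s).1 hs).1.1).1 (hq.dvd_of_dvd_pow hqs)]
      exact ((hQmem s).1 hs).1.2
  have hQsq : ∀ q ∈ Q, q ^ 2 ∣ L := fun q hq => (Finset.dvd_prod_of_mem _ hq).mul_left _
  obtain ⟨a₀, b₀, ha₀, hb₀, hab₀⟩ := exists_modEq_forall_not_sq_dvd
    (fun m n => n ^ k * bform f m n) hΦ M a b Q (fun q hq => ((hQmem q).1 hq).1.1)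
    (fun q hq => by exact_mod_cast ((hQmem q).1 hq).2)
    (fun q hq => exists_not_sq_dvd_bform hf ((hQmem q).1 hq).1.1 (by
      by_contra! h
      exact ((hQmem q).1 hq).2 (hMsmall q ((hQmem q).1 hq).1.1 h)))
  have hred : ∀ c : ℤ, ∃ c' : ℕ, c' < L ∧ (c' : ℤ) ≡ c [ZMOD L] := by
    intro c
    have h1 := Int.emod_nonneg c hL0
    have h2 := Int.emod_lt_of_pos c (by exact_mod_cast hL : (0 : ℤ) < L)
    refine ⟨(c % L).toNat, by omega, ?_⟩
    rw [Int.toNat_of_nonneg h1]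
    exact Int.mod_modEq c L
  obtain ⟨a₁, ha₁, ha₁₀⟩ := hred a₀
  obtain ⟨b₁, hb₁, hb₁₀⟩ := hred b₀
  have hML' : (M : ℤ) ∣ L := by exact_mod_cast hML
  obtain ⟨Y₀, hY₀⟩ := hfL.card_good_ge hL hk
    (fun q hq hqs => (hsmallT q hq hqs).trans hTL)
    (hD L hL0 hDL hfL) ha₁ hb₁ (by
      intro q hq hqL
      by_cases hqM : q ∣ M
      · obtain ⟨e, he, hne⟩ := hloc q hq hqM
        refine ⟨e, he.trans hML, fun h => hne ?_⟩
        have he' : (q : ℤ) ^ e ∣ M := by exact_mod_cast he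
        exact (hΦ _ _ _ _ _ (((ha₁₀.of_dvd hML').trans ha₀).of_dvd he')
          (((hb₁₀.of_dvd hML').trans hb₀).of_dvd he')).dvd_iff.1 h
      · have hqQ := hQL q hq hqL hqM
        refine ⟨2, hQsq q hqQ, fun h => hab₀ q hqQ ?_⟩
        have he' : (q : ℤ) ^ 2 ∣ L := by exact_mod_cast hQsq q hqQ
        exact (hΦ _ _ _ _ _ (ha₁₀.of_dvd he') (hb₁₀.of_dvd he')).dvd_iff.1 h)
  intro hfin
  obtain ⟨S, hSc, hS⟩ := hY₀ (Y₀ + 4 * hfin.toFinset.card + 4) (by omega)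
  have hmod : ∀ c y : ℕ, (c + L * y : ℤ) ≡ c [ZMOD L] := fun c y =>
    Int.modEq_iff_dvd.2 (by simp)
  have hinj : Function.Injective fun v : ℕ × ℕ => ((a₁ + L * v.1 : ℤ), (b₁ + L * v.2 : ℤ)) := by
    intro v w hvw
    have h1 := congrArg Prod.fst hvw
    have h2 := congrArg Prod.snd hvw
    simp only [add_right_inj, mul_right_inj' hL0, Nat.cast_inj] at h1 h2
    exact Prod.ext h1 h2
  have hle : S.card ≤ hfin.toFinset.card := by
    refine Finset.card_le_card_of_injOn _ (fun v hv => ?_) hinj.injOn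
    rw [Finset.mem_coe, Set.Finite.mem_toFinset]
    refine ⟨(((hmod a₁ v.1).trans ha₁₀).of_dvd hML').trans ha₀,
      (((hmod b₁ v.2).trans hb₁₀).of_dvd hML').trans hb₀, fun q hq hqM hdiv => ?_⟩
    by_cases hqL : q ∣ L
    · have hqQ := hQL q hq hqL hqM
      have he' : (q : ℤ) ^ 2 ∣ L := by exact_mod_cast hQsq q hqQ
      refine hab₀ q hqQ ((hΦ _ _ _ _ _ (((hmod a₁ v.1).trans ha₁₀).of_dvd he')
        (((hmod b₁ v.2).trans hb₁₀).of_dvd he')).dvd_iff.1 hdiv)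
    · exact hS v hv q hq hqL hdiv
  have hle' : (S.card : ℝ) ≤ hfin.toFinset.card := by exact_mod_cast hle
  have hc : (0 : ℝ) ≤ hfin.toFinset.card := Nat.cast_nonneg _
  have hy : (0 : ℝ) ≤ Y₀ := Nat.cast_nonneg _
  push_cast at hSc
  nlinarith [mul_nonneg hy hc]

end Polynomial

open MvPolynomial

theorem pseudo_squarefree_sieve
    (d : ℕ) (F : MvPolynomial (Fin 2) ℤ) (hF : F.IsHomogeneous d)
    (hsqfree : ∀ g : MvPolynomial (Fin 2) ℤ, ¬ IsUnit g → ¬ (g^2 ∣ F))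
    (hfact : ∀ g : MvPolynomial (Fin 2) ℤ, Irreducible g → g ∣ F → g.totalDegree ≤ 6)
    (r : ℕ) (p : Fin r → ℕ) (hp : ∀ i, (p i).Prime) (hpinj : Function.Injective p)
    (t : Fin r → ℕ)
    (M : ℕ) (hM : 0 < M)
    (hMsmall : ∀ q : ℕ, q.Prime → q < d → q^2 ∣ M)
    (hMp : (∏ i, p i ^ (t i + 1)) ∣ M)
    (a b : ℤ) (hab0 : MvPolynomial.eval ![a, b] F ≠ 0)
    (hsq : ∀ q : ℕ, q.Prime → q ∣ M → (∀ i, q ≠ p i) →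
      ¬ ((q : ℤ)^2 ∣ MvPolynomial.eval ![a, b] F))
    (hval : ∀ i, padicValInt (p i) (MvPolynomial.eval ![a, b] F) = t i) :
    {mn : ℤ × ℤ | mn.1 ≡ a [ZMOD (M : ℤ)] ∧ mn.2 ≡ b [ZMOD (M : ℤ)] ∧
      ∃ ℓ : ℤ, Squarefree ℓ ∧ (∀ i, ¬ ((p i : ℤ) ∣ ℓ)) ∧
        MvPolynomial.eval ![mn.1, mn.2] F = (∏ i, (p i : ℤ) ^ (t i)) * ℓ}.Infinite := by
  have hF0 : F ≠ 0 := by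
    rintro rfl
    exact hab0 (map_zero _)
  obtain ⟨f, k, hk, hd, hf, hf6, hΦ⟩ := Polynomial.exists_squarefree_eval_eq hF hF0 hsqfree hfact
  have hmul : ∀ i, p i ^ (t i + 1) ∣ M := fun i =>
    (Finset.dvd_prod_of_mem (fun i => p i ^ (t i + 1)) (Finset.mem_univ i)).trans hMp
  have hMM : M ∣ M ^ 2 := dvd_pow_self _ two_ne_zero
  have hvali : ∀ i, ∀ e : ℕ, (p i : ℤ) ^ e ∣ eval ![a, b] F ↔ e ≤ t i := fun i e => by
    have := Fact.mk (hp i)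
    rw [padicValInt_dvd_iff, hval i, or_iff_right hab0]
  refine (Polynomial.infinite_forall_not_sq_dvd hf hf6 hk (pow_pos hM 2) (a := a) (b := b)
    (fun q hq hqd => ?_) fun q hq hqM => ?_).mono ?_
  · exact (dvd_pow_self q two_ne_zero).trans ((hMsmall q hq (hd ▸ hqd)).trans hMM)
  · rw [← hΦ]
    by_cases h : ∃ i, q = p i
    · obtain ⟨i, rfl⟩ := h
      exact ⟨t i + 1, (hmul i).trans hMM, fun h => by simpa using (hvali i _).1 h⟩
    · have hqM' := hq.dvd_of_dvd_pow hqM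
      exact ⟨2, pow_dvd_pow_of_dvd hqM' 2, hsq q hq hqM' (not_exists.1 h)⟩
  · rintro ⟨m, n⟩ ⟨hm, hn, hgood⟩
    have hZ : eval ![m, n] F ≡ eval ![a, b] F [ZMOD ((M ^ 2 : ℕ) : ℤ)] := by
      rw [hΦ, hΦ]
      exact (hn.pow k).mul (Polynomial.bform_modEq f hm hn)
    have hMMi : (M : ℤ) ∣ ((M ^ 2 : ℕ) : ℤ) := by exact_mod_cast hMM
    refine ⟨hm.of_dvd hMMi, hn.of_dvd hMMi, ?_⟩
    have hpow : ∀ i, ∀ e ≤ t i + 1, (p i : ℤ) ^ e ∣ eval ![m, n] F ↔ e ≤ t i := fun i e he => by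
      have h1 : (p i : ℤ) ^ e ∣ M := by exact_mod_cast (pow_dvd_pow _ he).trans (hmul i)
      rw [(hZ.of_dvd (h1.trans hMMi)).dvd_iff, hvali]
    obtain ⟨ℓ, hℓ⟩ : (∏ i, (p i : ℤ) ^ t i) ∣ eval ![m, n] F := by
      refine Finset.prod_dvd_of_coprime (fun i _ j _ hij => ?_) fun i _ =>
        (hpow i _ (Nat.le_succ _)).2 le_rfl
      refine IsCoprime.pow (Nat.isCoprime_iff_coprime.2 ?_)
      exact (Nat.coprime_primes (hp i) (hp j)).2 fun h => hij (hpinj h)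
    have hpℓ : ∀ i, ¬ (p i : ℤ) ∣ ℓ := fun i h => by
      have h1 : (p i : ℤ) ^ (t i + 1) ∣ eval ![m, n] F := by
        rw [hℓ, pow_succ]
        exact mul_dvd_mul
          (Finset.dvd_prod_of_mem (fun i => (p i : ℤ) ^ t i) (Finset.mem_univ i)) h
      simpa using (hpow i _ le_rfl).1 h1
    refine ⟨ℓ, ?_, hpℓ, hℓ⟩
    rw [← Int.squarefree_natAbs, Nat.squarefree_iff_prime_squarefree]
    intro q hq hqℓ
    have h1 : (q : ℤ) ^ 2 ∣ ℓ := by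
      rw [sq, ← Nat.cast_mul]
      exact Int.natCast_dvd.2 hqℓ
    have h2 : (q : ℤ) ^ 2 ∣ eval ![m, n] F := hℓ ▸ h1.mul_left _
    by_cases h : ∃ i, q = p i
    · obtain ⟨i, rfl⟩ := h
      exact hpℓ i ((dvd_pow_self _ two_ne_zero).trans h1)
    by_cases hqM : q ∣ M
    · refine hsq q hq hqM (not_exists.1 h) ((hZ.of_dvd ?_).dvd_iff.1 h2)
      exact_mod_cast pow_dvd_pow_of_dvd hqM 2
    · exact hgood q hq (fun h => hqM (hq.dvd_of_dvd_pow h)) (hΦ m n ▸ h2)
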